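/- Fix an integer-valued multiplicative function f with f(p) = F(p) for all primes p, with F(T) ∈ ℤ[T] nonconstant, fix δ ∈ (0,1] and K > 0, and set J = J(x) = ⌊log log log x⌋ and y = y(x) = exp((log x)^{δ/2}). Call a positive integer n convenient (with respect to x) if n ≤ x and n admits an expression n = m·P_J···P₁ where P₁, …, P_J are primes with max{P(m), y} < P_J < ··· < P₁ and P_J···P₁ ≤ x/m. Then for every ε > 0 there exists x₀ such that for all x ≥ x₀ and all positive integers q ≤ (log x)^K with α(q) ≠ 0, #{n ≤ x : n inconvenient and gcd(f(n), q) = 1} ≤ ε·#{n ≤ x : gcd(f(n), q) = 1}. Equivalently, #{n ≤ x : gcd(f(n), q) = 1} ∼ #{n ≤ x convenient : gcd(f(n), q) = 1} uniformly in q ≤ (log x)^K with α(q) ≠ 0. -/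

import Mathlib

/-- The number of positive integers `n ≤ x` satisfying the predicate `P`. -/
noncomputable def cnt (x : ℝ) (P : ℕ → Prop) : ℕ :=
  Set.ncard {n : ℕ | 0 < n ∧ (n : ℝ) ≤ x ∧ P n}

/-- `α(q) = (1/φ(q)) · #{a mod q : gcd(a·F(a), q) = 1}`. -/
noncomputable def alpha (F : Polynomial ℤ) (q : ℕ) : ℝ :=
  (Set.ncard {a : ℕ | a < q ∧ Int.gcd ((a : ℤ) * F.eval (a : ℤ)) (q : ℤ) = 1} : ℝ)
    / (Nat.totient q : ℝ)

/-- The largest prime factor `P(m)`, with `P(1) = 1`. -/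
def largestPrimeFactor (m : ℕ) : ℕ := (m.primeFactorsList).reverse.getD 0 1

/-- `n` is convenient with respect to `x` (and the parameter `δ`): `n ≤ x`, and writing
`J = ⌊log log log x⌋` and `y = exp((log x)^{δ/2})`, `n` admits an expression
`n = m · P_J ⋯ P_1` with primes `max{P(m), y} < P_J < ⋯ < P_1` and `P_J ⋯ P_1 ≤ x/m`.
(Here `Ps i` plays the role of `P_{i+1}`, so `StrictAnti Ps` says `P_1 > P_2 > ⋯ > P_J`.) -/
def convenient (δ x : ℝ) (n : ℕ) : Prop :=
  0 < n ∧ (n : ℝ) ≤ x ∧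
    ∃ (m : ℕ) (Ps : Fin (Nat.floor (Real.log (Real.log (Real.log x)))) → ℕ),
      0 < m ∧ (∀ i, (Ps i).Prime) ∧ StrictAnti Ps ∧
      (∀ i, (largestPrimeFactor m : ℝ) < Ps i ∧
            Real.exp (Real.log x ^ (δ / 2)) < (Ps i : ℝ)) ∧
      ((∏ i, Ps i : ℕ) : ℝ) ≤ x / (m : ℝ) ∧
      n = m * ∏ i, Ps i


namespace S11
open Finset

noncomputable def gj (j : ℕ) (s : ℂ) (u : ℝ) : ℂ := ((Real.log u : ℝ) : ℂ) ^ j * (u : ℂ) ^ (-s)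

lemma one_add_log_sq_le {u : ℝ} (hu : 1 ≤ u) : (1 + Real.log u) ^ 2 ≤ 25 * √u := by
  have h0 : 0 ≤ Real.log u := Real.log_nonneg hu
  have h1 : Real.log u ≤ u ^ (1/4 : ℝ) / (1/4) := Real.log_le_rpow_div (by linarith) (by norm_num)
  have h2 : 1 ≤ u ^ (1/4 : ℝ) := Real.one_le_rpow hu (by norm_num)
  have h3 : (u ^ (1/4 : ℝ)) ^ 2 = √u := by
    rw [Real.sqrt_eq_rpow, ← Real.rpow_natCast, ← Real.rpow_mul (by linarith)]; norm_num
  rw [← h3]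
  have : 1 + Real.log u ≤ 5 * u ^ (1/4 : ℝ) := by linarith
  calc _ ≤ (5 * u ^ (1/4 : ℝ)) ^ 2 := by gcongr
    _ = _ := by ring

lemma norm_cpow_neg {u : ℝ} (hu : 0 < u) (s : ℂ) : ‖(u : ℂ) ^ (-s)‖ = u ^ (-s.re) := by
  rw [Complex.norm_cpow_eq_rpow_re_of_pos hu]; simp

lemma gj_norm {j : ℕ} (hj : j ≤ 2) {s : ℂ} (hs : 1 ≤ s.re) {u : ℝ} (hu : 1 ≤ u) :
    ‖gj j s u‖ ≤ (1 + Real.log u) ^ 2 / u := by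
  have h0 : 0 ≤ Real.log u := Real.log_nonneg hu
  unfold gj
  rw [norm_mul, norm_pow, norm_cpow_neg (by linarith), Complex.norm_real, Real.norm_of_nonneg h0,
    div_eq_mul_inv]
  have h1 : u ^ (-s.re) ≤ u⁻¹ := by
    rw [← Real.rpow_neg_one]; exact Real.rpow_le_rpow_of_exponent_le hu (by linarith)
  have h2 : Real.log u ^ j ≤ (1 + Real.log u) ^ 2 := by
    calc Real.log u ^ j ≤ (1 + Real.log u) ^ j := by gcongr; linarith
      _ ≤ _ := pow_le_pow_right₀ (by linarith) hj
  gcongr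

lemma gj_norm' {j : ℕ} (hj : j ≤ 2) {s : ℂ} (hs : 1 ≤ s.re) {u : ℝ} (hu : 1 ≤ u) :
    ‖gj j s u‖ ≤ 25 / √u := by
  refine (gj_norm hj hs hu).trans ?_
  have hsq : 0 < √u := Real.sqrt_pos.mpr (by linarith)
  rw [div_le_div_iff₀ (by linarith) hsq]
  have := one_add_log_sq_le hu
  nlinarith [Real.mul_self_sqrt (show 0 ≤ u by linarith)]

lemma gj_deriv (j : ℕ) {s : ℂ} (hs : s ≠ 0) {u : ℝ} (hu : 0 < u) :
    HasDerivAt (gj j s) (((j : ℂ) * ((Real.log u : ℝ) : ℂ) ^ (j-1) * ((u⁻¹ : ℝ) : ℂ)) * (u : ℂ) ^ (-s)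
      + ((Real.log u : ℝ) : ℂ) ^ j * (-s * (u : ℂ) ^ (-s-1))) u := by
  unfold gj
  have h1 : HasDerivAt (fun u : ℝ => ((Real.log u : ℝ) : ℂ)) ((u⁻¹ : ℝ) : ℂ) u :=
    (Real.hasDerivAt_log hu.ne').ofReal_comp
  have h2 := h1.pow j
  have h3 : HasDerivAt (fun u : ℝ => (u : ℂ) ^ (-s)) (-s * (u : ℂ) ^ (-s-1)) u :=
    hasDerivAt_ofReal_cpow_const hu.ne' (by simpa using hs)
  exact h2.mul h3

lemma inv_pow_le_tel {n : ℕ} (hn : 1 ≤ n) :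
    1 / ((n : ℝ) * √n) ≤ 4 * (1 / √(n : ℝ) - 1 / √((n + 1 : ℕ) : ℝ)) := by
  have hn' : (1 : ℝ) ≤ n := by exact_mod_cast hn
  set a := √(n : ℝ)
  set b := √((n + 1 : ℕ) : ℝ)
  have ha2 : a * a = n := Real.mul_self_sqrt (by linarith)
  have hb2 : b * b = n + 1 := by
    have := Real.mul_self_sqrt (show (0:ℝ) ≤ ((n + 1 : ℕ) : ℝ) by positivity)
    push_cast at this ⊢; simpa [b] using this
  have ha : 0 < a := Real.sqrt_pos.mpr (by linarith)
  have hb : 0 < b := Real.sqrt_pos.mpr (by positivity)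
  have hab : a ≤ b := Real.sqrt_le_sqrt (by push_cast; linarith)
  have hb3 : b ≤ 2 * a := by nlinarith
  have h1 : (b - a) * (b + a) = 1 := by nlinarith
  have : 1 / a - 1 / b = 1 / (a * b * (a + b)) := by
    field_simp; nlinarith
  rw [this, ← ha2, mul_one_div, div_le_div_iff₀ (by positivity) (by positivity)]
  have h2 : b * (a + b) ≤ 4 * (a * a) := by
    nlinarith
  nlinarith

lemma gj_diff {j : ℕ} (hj : j ≤ 2) {s : ℂ} (hs : 1 ≤ s.re) {n : ℕ} (hn : 1 ≤ n) :
    ‖gj j s ((n + 1 : ℕ) : ℝ) - gj j s (n : ℝ)‖ ≤ 25 * (2 + ‖s‖) * (1 / ((n : ℝ) * √n)) := by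
  have hn' : (1 : ℝ) ≤ n := by exact_mod_cast hn
  have hs0 : s ≠ 0 := by rintro rfl; simp at hs; linarith
  have key : ∀ u ∈ Set.Icc (n : ℝ) (n + 1), ‖((j : ℂ) * ((Real.log u : ℝ) : ℂ) ^ (j-1) * ((u⁻¹ : ℝ) : ℂ)) * (u : ℂ) ^ (-s)
      + ((Real.log u : ℝ) : ℂ) ^ j * (-s * (u : ℂ) ^ (-s-1))‖ ≤ 25 * (2 + ‖s‖) * (1 / ((n : ℝ) * √n)) := by
    intro u hu
    have hu1 : 1 ≤ u := hn'.trans hu.1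
    have h0 : 0 ≤ Real.log u := Real.log_nonneg hu1
    have hu0 : 0 < u := by linarith
    have e1 : ‖(u : ℂ) ^ (-s)‖ ≤ u⁻¹ := by
      rw [norm_cpow_neg hu0, ← Real.rpow_neg_one]
      exact Real.rpow_le_rpow_of_exponent_le hu1 (by linarith)
    have e2 : ‖(u : ℂ) ^ (-s-1)‖ ≤ u⁻¹ * u⁻¹ := by
      rw [Complex.cpow_sub _ _ (by exact_mod_cast hu0.ne'), Complex.cpow_one, norm_div, Complex.norm_real,
        Real.norm_of_nonneg hu0.le, div_eq_mul_inv]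
      gcongr
    have e3 : ‖((Real.log u : ℝ) : ℂ) ^ j‖ ≤ (1 + Real.log u) ^ 2 := by
      rw [norm_pow, Complex.norm_real, Real.norm_of_nonneg h0]
      calc Real.log u ^ j ≤ (1 + Real.log u) ^ j := by gcongr; linarith
        _ ≤ _ := pow_le_pow_right₀ (by linarith) hj
    have e4 : ‖(j : ℂ) * ((Real.log u : ℝ) : ℂ) ^ (j-1)‖ ≤ 2 * (1 + Real.log u) ^ 2 := by
      rw [norm_mul, norm_pow, Complex.norm_real, Real.norm_of_nonneg h0, Complex.norm_natCast]
      have : Real.log u ^ (j-1) ≤ (1 + Real.log u) ^ 2 := by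
        calc Real.log u ^ (j-1) ≤ (1 + Real.log u) ^ (j-1) := by gcongr; linarith
          _ ≤ _ := pow_le_pow_right₀ (by linarith) (by omega)
      have hj' : (j : ℝ) ≤ 2 := by exact_mod_cast hj
      gcongr
    have hsq := one_add_log_sq_le hu1
    have hsu : 0 < √u := Real.sqrt_pos.mpr hu0
    calc _ ≤ ‖((j : ℂ) * ((Real.log u : ℝ) : ℂ) ^ (j-1) * ((u⁻¹ : ℝ) : ℂ)) * (u : ℂ) ^ (-s)‖
        + ‖((Real.log u : ℝ) : ℂ) ^ j * (-s * (u : ℂ) ^ (-s-1))‖ := norm_add_le _ _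
      _ ≤ (2 * (1 + Real.log u) ^ 2 * u⁻¹) * u⁻¹ + (1 + Real.log u) ^ 2 * (‖s‖ * (u⁻¹ * u⁻¹)) := by
        have n1 : ‖((u⁻¹ : ℝ) : ℂ)‖ = u⁻¹ := by
          rw [Complex.norm_real, Real.norm_of_nonneg (by positivity)]
        have f1 : ‖((j : ℂ) * ((Real.log u : ℝ) : ℂ) ^ (j-1) * ((u⁻¹ : ℝ) : ℂ)) * (u : ℂ) ^ (-s)‖ ≤
            (2 * (1 + Real.log u) ^ 2 * u⁻¹) * u⁻¹ := by
          rw [norm_mul _ ((u : ℂ) ^ (-s)), norm_mul _ ((u⁻¹ : ℝ) : ℂ), n1]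
          gcongr
        have f2 : ‖((Real.log u : ℝ) : ℂ) ^ j * (-s * (u : ℂ) ^ (-s-1))‖ ≤
            (1 + Real.log u) ^ 2 * (‖s‖ * (u⁻¹ * u⁻¹)) := by
          rw [norm_mul, norm_mul (-s), norm_neg]
          gcongr
        exact add_le_add f1 f2
      _ = (2 + ‖s‖) * ((1 + Real.log u) ^ 2 * (u⁻¹ * u⁻¹)) := by ring
      _ ≤ (2 + ‖s‖) * (25 * √u * (u⁻¹ * u⁻¹)) := by gcongr
      _ = 25 * (2 + ‖s‖) * (1 / (u * √u)) := by
        have := Real.mul_self_sqrt hu0.le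
        field_simp
        rw [Real.sq_sqrt hu0.le]
      _ ≤ _ := by
        have := hu.1
        gcongr
  have := (convex_Icc (n : ℝ) (n + 1)).norm_image_sub_le_of_norm_hasDerivWithin_le
    (f := gj j s) (C := 25 * (2 + ‖s‖) * (1 / ((n : ℝ) * √n)))
    (fun u hu => (gj_deriv j hs0 (show 0 < u by linarith [hu.1])).hasDerivWithinAt) key
    (x := (n : ℝ)) (y := (n : ℝ) + 1) (by simp) (by simp)
  simpa using this

lemma abel_id (c g : ℕ → ℂ) {N M : ℕ} (h : N ≤ M) :
    ∑ k ∈ Ico N M, c k * g k = (∑ k ∈ range M, c k) * g M - (∑ k ∈ range N, c k) * g N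
      - ∑ k ∈ Ico N M, (∑ i ∈ range (k+1), c i) * (g (k+1) - g k) := by
  induction M, h using Nat.le_induction with
  | base => simp
  | succ M h ih =>
    rw [Finset.sum_Ico_succ_top h, ih, Finset.sum_Ico_succ_top h, Finset.sum_range_succ]
    ring

lemma abel_bd (c g : ℕ → ℂ) {N M : ℕ} (h : N ≤ M) {A : ℝ} (hA : ∀ n, ‖∑ k ∈ range n, c k‖ ≤ A) :
    ‖∑ k ∈ Ico N M, c k * g k‖ ≤ A * (‖g M‖ + ‖g N‖ + ∑ k ∈ Ico N M, ‖g (k+1) - g k‖) := by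
  rw [abel_id c g h]
  have h1 : ‖∑ k ∈ Ico N M, (∑ i ∈ range (k+1), c i) * (g (k+1) - g k)‖ ≤
      ∑ k ∈ Ico N M, A * ‖g (k+1) - g k‖ := by
    refine (norm_sum_le _ _).trans (Finset.sum_le_sum fun k _ => ?_)
    rw [norm_mul]; gcongr; exact hA _
  rw [← Finset.mul_sum] at h1
  refine (norm_sub_le _ _).trans ?_
  have h2 := norm_sub_le ((∑ k ∈ range M, c k) * g M) ((∑ k ∈ range N, c k) * g N)
  rw [norm_mul, norm_mul] at h2
  have h3 : ‖∑ k ∈ range M, c k‖ * ‖g M‖ ≤ A * ‖g M‖ := by gcongr; exact hA _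
  have h4 : ‖∑ k ∈ range N, c k‖ * ‖g N‖ ≤ A * ‖g N‖ := by gcongr; exact hA _
  linarith

lemma char_sum_period {d : ℕ} [NeZero d] {χ : DirichletCharacter ℂ d} (hχ : χ ≠ 1) :
    ∑ k ∈ range d, χ (k : ZMod d) = 0 := by
  have h := MulChar.sum_eq_zero_of_ne_one hχ
  rw [← h]
  refine Finset.sum_bij (fun k _ => (k : ZMod d)) (by simp) ?_ ?_ (by simp)
  · intro a ha b hb hab
    rw [ZMod.natCast_eq_natCast_iff'] at hab
    simp at ha hb
    rwa [Nat.mod_eq_of_lt ha, Nat.mod_eq_of_lt hb] at hab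
  · intro b _
    exact ⟨b.val, by simp [ZMod.val_lt], by simp⟩

lemma char_sum_bd {d : ℕ} [NeZero d] {χ : DirichletCharacter ℂ d} (hχ : χ ≠ 1) (n : ℕ) :
    ‖∑ k ∈ range n, χ (k : ZMod d)‖ ≤ d := by
  induction n using Nat.strong_induction_on with
  | _ n ih =>
    by_cases hn : n < d
    · refine (norm_sum_le _ _).trans ((Finset.sum_le_sum (g := fun _ => (1:ℝ)) fun k _ => χ.norm_le_one _).trans ?_)
      simp; exact_mod_cast hn.le
    · push Not at hn
      obtain ⟨m, rfl⟩ := Nat.exists_eq_add_of_le hn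
      rw [Finset.sum_range_add, char_sum_period hχ, zero_add]
      have := ih m (by have := NeZero.pos d; omega)
      simpa using this

lemma gj_tail {d : ℕ} [NeZero d] {χ : DirichletCharacter ℂ d} (hχ : χ ≠ 1) {j : ℕ} (hj : j ≤ 2)
    {s : ℂ} (hs : 1 ≤ s.re) {N M : ℕ} (hN : 1 ≤ N) (h : N ≤ M) :
    ‖∑ k ∈ Ico N M, χ (k : ZMod d) * gj j s (k : ℝ)‖ ≤ 150 * d * (2 + ‖s‖) / √N := by
  have hN' : (1 : ℝ) ≤ N := by exact_mod_cast hN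
  have hM' : (N : ℝ) ≤ M := by exact_mod_cast h
  refine (abel_bd (fun k => χ (k : ZMod d)) (fun k => gj j s (k : ℝ)) h (char_sum_bd hχ)).trans ?_
  have h1 : ∑ k ∈ Ico N M, ‖gj j s ((k+1 : ℕ) : ℝ) - gj j s (k : ℝ)‖ ≤ 100 * (2 + ‖s‖) * (1 / √(N : ℝ)) := by
    have : ∑ k ∈ Ico N M, ‖gj j s ((k+1 : ℕ) : ℝ) - gj j s (k : ℝ)‖ ≤
        ∑ k ∈ Ico N M, 100 * (2 + ‖s‖) * (1 / √(k : ℝ) - 1 / √((k + 1 : ℕ) : ℝ)) := by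
      refine Finset.sum_le_sum fun k hk => ?_
      have hk1 : 1 ≤ k := hN.trans (Finset.mem_Ico.mp hk).1
      refine (gj_diff hj hs hk1).trans ?_
      have := inv_pow_le_tel hk1
      have h0 : 0 ≤ 25 * (2 + ‖s‖) := by positivity
      nlinarith [mul_le_mul_of_nonneg_left this h0]
    refine this.trans ?_
    rw [← Finset.mul_sum, Finset.sum_Ico_eq_sub _ h, Finset.sum_range_sub', Finset.sum_range_sub']
    have : 0 ≤ 1 / √(M : ℝ) := by positivity
    gcongr
    simp only [Nat.cast_zero]
    linarith
  have h2 : ‖gj j s (N : ℝ)‖ ≤ 25 / √(N : ℝ) := gj_norm' hj hs hN'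
  have h3 : ‖gj j s (M : ℝ)‖ ≤ 25 / √(N : ℝ) := (gj_norm' hj hs (hN'.trans hM')).trans (by gcongr)
  have hs0 : 0 ≤ ‖s‖ := norm_nonneg s
  have hq : 0 < √(N : ℝ) := Real.sqrt_pos.mpr (by linarith)
  calc _ ≤ (d : ℝ) * (25 / √(N : ℝ) + 25 / √(N : ℝ) + 100 * (2 + ‖s‖) * (1 / √(N : ℝ))) := by
        gcongr
    _ = d * (50 + 100 * (2 + ‖s‖)) / √N := by field_simp; ring
    _ ≤ _ := by
      apply div_le_div_of_nonneg_right _ hq.le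
      nlinarith [mul_nonneg (show (0:ℝ) ≤ d by positivity) hs0]

end S11


namespace S11
open Finset

noncomputable def ww (d : ℕ) (t : ℝ) : ℝ := (Real.log d + 1) * (|t| + 2)

lemma ww_ge_two {d : ℕ} (hd : 1 ≤ d) (t : ℝ) : 2 ≤ ww d t := by
  have : 0 ≤ Real.log d := Real.log_natCast_nonneg d
  unfold ww
  nlinarith [abs_nonneg t]

lemma term_logpow (j : ℕ) (f : ℕ → ℂ) {s : ℂ} (n : ℕ) (hs : s ≠ 0):
    LSeries.term (LSeries.logMul^[j] f) s n = f n * gj j s (n : ℝ) := by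
  rcases eq_or_ne n 0 with rfl | hn
  · rcases eq_or_ne j 0 with rfl | hj
    · simp [gj, hs]
    · simp [gj, hj]
  · rw [LSeries.term_of_ne_zero hn]
    have : ∀ j, LSeries.logMul^[j] f n = (Complex.log n) ^ j * f n := by
      intro j
      induction j with
      | zero => simp
      | succ j ih => rw [Function.iterate_succ_apply', LSeries.logMul, ih]; ring
    rw [this, gj, Complex.cpow_neg, Complex.natCast_log]
    push_cast
    rw [div_eq_mul_inv]; ring

lemma summable_logpow {d : ℕ} [NeZero d] (χ : DirichletCharacter ℂ d) (j : ℕ) {s : ℂ} (hs : 1 < s.re) :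
    LSeriesSummable (LSeries.logMul^[j] (fun n => χ n)) s := by
  apply LSeriesSummable_of_abscissaOfAbsConv_lt_re
  rw [LSeries.absicssaOfAbsConv_logPowMul, DirichletCharacter.absicssaOfAbsConv_eq_one (NeZero.ne d)]
  exact_mod_cast hs

lemma summable_gj {d : ℕ} [NeZero d] (χ : DirichletCharacter ℂ d) (j : ℕ) {s : ℂ} (hs : 1 < s.re) :
    Summable (fun n : ℕ => χ n * gj j s (n : ℝ)) := by
  have h := summable_logpow χ j hs
  have hs0 : s ≠ 0 := by rintro rfl; simp at hs; linarith
  unfold LSeriesSummable at h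
  refine h.congr fun n => ?_
  rw [term_logpow _ _ _ hs0]

lemma LSeries_logpow {d : ℕ} [NeZero d] (χ : DirichletCharacter ℂ d) (j : ℕ) {s : ℂ} (hs : 1 < s.re) :
    LSeries (LSeries.logMul^[j] (fun n => χ n)) s = ∑' n : ℕ, χ n * gj j s (n : ℝ) := by
  have hs0 : s ≠ 0 := by rintro rfl; simp at hs; linarith
  unfold LSeries
  exact tsum_congr fun n => term_logpow _ _ _ hs0

/-- tail bound -/
lemma tsum_tail {d : ℕ} [NeZero d] {χ : DirichletCharacter ℂ d} (hχ : χ ≠ 1) {j : ℕ} (hj : j ≤ 2)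
    {s : ℂ} (hs : 1 < s.re) {N : ℕ} (hN : 1 ≤ N) :
    ‖(∑' n : ℕ, χ n * gj j s (n : ℝ)) - ∑ k ∈ range N, χ (k : ZMod d) * gj j s (k : ℝ)‖
      ≤ 150 * d * (2 + ‖s‖) / √N := by
  have h := (summable_gj χ j hs).hasSum.tendsto_sum_nat
  have h2 := (h.sub_const (∑ k ∈ range N, χ (k : ZMod d) * gj j s (k : ℝ))).norm
  refine le_of_tendsto h2 ?_
  filter_upwards [Filter.eventually_ge_atTop N] with M hM
  rw [← Finset.sum_Ico_eq_sub _ hM]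
  exact gj_tail hχ hj hs.le hN hM

lemma head_bd (c : ℕ → ℂ) (hc : ∀ n, ‖c n‖ ≤ 1) {j : ℕ} (hj : j ≤ 2)
    {s : ℂ} (hs : 1 ≤ s.re) {N : ℕ} (hN : 1 ≤ N) :
    ‖∑ k ∈ range N, c k * gj j s (k : ℝ)‖ ≤ (1 + Real.log N) ^ 3 := by
  have hN' : (1:ℝ) ≤ N := by exact_mod_cast hN
  have h0 : 0 ≤ Real.log N := Real.log_nonneg hN'
  have hs0 : s ≠ 0 := by rintro rfl; simp at hs; linarith
  have hz : gj j s ((0:ℕ):ℝ) = 0 := by simp [gj, hs0]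
  calc _ ≤ ∑ k ∈ range N, ‖c k * gj j s (k : ℝ)‖ := norm_sum_le _ _
    _ ≤ ∑ k ∈ range N, (1 + Real.log N) ^ 2 * (k : ℝ)⁻¹ := by
      refine Finset.sum_le_sum fun k hk => ?_
      rcases eq_or_ne k 0 with rfl | hk0
      · rw [hz]; simp
      have hk1 : (1:ℝ) ≤ k := by exact_mod_cast Nat.one_le_iff_ne_zero.mpr hk0
      have hkN : (k:ℝ) ≤ N := by exact_mod_cast (Finset.mem_range.mp hk).le
      rw [norm_mul]
      have h1 := gj_norm hj hs hk1
      have h2 : Real.log k ≤ Real.log N := Real.log_le_log (by linarith) hkN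
      have h3 : 0 ≤ Real.log k := Real.log_nonneg hk1
      calc ‖c k‖ * ‖gj j s (k:ℝ)‖ ≤ 1 * ((1 + Real.log k) ^ 2 / k) := by gcongr; exact hc k
        _ = (1 + Real.log k) ^ 2 * (k:ℝ)⁻¹ := by rw [one_mul, div_eq_mul_inv]
        _ ≤ _ := by gcongr
    _ = (1 + Real.log N) ^ 2 * ∑ k ∈ range N, (k : ℝ)⁻¹ := by rw [Finset.mul_sum]
    _ ≤ (1 + Real.log N) ^ 2 * (1 + Real.log N) := by
      gcongr
      have h1 : ∑ k ∈ range N, (k : ℝ)⁻¹ ≤ ∑ k ∈ range (N+1), (k : ℝ)⁻¹ :=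
        Finset.sum_le_sum_of_subset_of_nonneg (by intro a; simp; omega) (fun _ _ _ => by positivity)
      rw [Finset.sum_range_succ'] at h1
      have h2 := harmonic_le_one_add_log N
      simp only [harmonic] at h2
      push_cast at h1 h2
      simp at h1
      linarith
    _ = _ := by ring

lemma L_bd {d : ℕ} [NeZero d] {χ : DirichletCharacter ℂ d} (hχ : χ ≠ 1) {j : ℕ} (hj : j ≤ 2)
    {s : ℂ} (hs : 1 < s.re) (hs2 : s.re ≤ 2) :
    ‖∑' n : ℕ, χ n * gj j s (n : ℝ)‖ ≤ 100 * ww d s.im ^ 3 := by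
  have hd : (1:ℝ) ≤ d := by exact_mod_cast NeZero.one_le
  set A : ℝ := d * (2 + ‖s‖) with hA
  have hs0 := norm_nonneg s
  have hA2 : 2 ≤ A := by nlinarith
  set N := ⌈A^2⌉₊ with hN
  have hNA : A^2 ≤ N := Nat.le_ceil _
  have hN1 : 1 ≤ N := by
    have : (1:ℝ) ≤ N := by nlinarith
    exact_mod_cast this
  have hN2 : (N:ℝ) ≤ 2 * A^2 := by
    have := Nat.ceil_lt_add_one (show 0 ≤ A^2 by positivity)
    nlinarith
  have ht := tsum_tail hχ hj hs hN1
  have hh := head_bd (fun k => χ (k : ZMod d)) (fun n => χ.norm_le_one _) hj hs.le hN1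
  have hsq : A ≤ √N := Real.le_sqrt_of_sq_le hNA
  have ht2 : 150 * d * (2 + ‖s‖) / √N ≤ 150 := by
    rw [div_le_iff₀ (by linarith)]
    calc 150 * d * (2 + ‖s‖) = 150 * A := by rw [hA]; ring
      _ ≤ _ := by gcongr
  have hlog : Real.log N ≤ 1 + 2 * Real.log d + 2 * (3 + |s.im|) := by
    have h1 : ‖s‖ ≤ 2 + |s.im| := by
      have := Complex.norm_le_abs_re_add_abs_im s
      rw [abs_of_pos (by linarith)] at this
      linarith
    have h2 : Real.log (2 + ‖s‖) ≤ 3 + |s.im| := by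
      have := Real.log_le_sub_one_of_pos (show 0 < 2 + ‖s‖ by linarith)
      linarith
    have h3 : Real.log 2 ≤ 1 := by linarith [Real.log_two_lt_d9]
    calc Real.log N ≤ Real.log (2 * A^2) := Real.log_le_log (by exact_mod_cast hN1) hN2
      _ = Real.log 2 + 2 * (Real.log d + Real.log (2 + ‖s‖)) := by
        rw [Real.log_mul (by norm_num) (by positivity), Real.log_pow, hA, Real.log_mul (by positivity) (by positivity)]
        norm_num
      _ ≤ _ := by linarith
  have hld : 0 ≤ Real.log d := Real.log_nonneg hd
  have hw : 1 + Real.log N ≤ 4 * ww d s.im := by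
    unfold ww
    nlinarith [abs_nonneg s.im, mul_nonneg hld (abs_nonneg s.im)]
  have hw2 := ww_ge_two (d := d) NeZero.one_le s.im
  have h0 : 0 ≤ Real.log N := Real.log_natCast_nonneg N
  have h1 : (1 + Real.log N)^3 ≤ (4 * ww d s.im)^3 := by gcongr
  have h2 : (2:ℝ)^3 ≤ ww d s.im ^ 3 := by gcongr
  have h3 := norm_le_norm_sub_add (∑' n : ℕ, χ n * gj j s (n : ℝ)) (∑ k ∈ range N, χ (k : ZMod d) * gj j s (k : ℝ))
  rw [mul_pow] at h1
  linarith

end S11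


namespace S11
open Finset MeasureTheory

lemma zeta_bd {s : ℂ} (hs : 1 < s.re) : ‖riemannZeta s‖ ≤ ‖s‖ * (1 / ‖s - 1‖ + 1) := by
  have hO : (fun n : ℕ ↦ ∑ k ∈ Icc 1 n, ‖(1 : ℕ → ℂ) k‖) =O[Filter.atTop] fun n ↦ (n : ℝ) ^ (1:ℝ) := by
    simp
    exact Asymptotics.isBigO_refl _ _
  have h := LSeries_eq_mul_integral' (1 : ℕ → ℂ) zero_le_one hs hO
  rw [LSeries_one_eq_riemannZeta hs] at h
  have i1 : IntegrableOn (fun t : ℝ => (t:ℂ) ^ (-s)) (Set.Ioi 1) :=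
    integrableOn_Ioi_cpow_of_lt (by simpa using hs) zero_lt_one
  have i3 : IntegrableOn (fun t : ℝ => t ^ (-s.re - 1)) (Set.Ioi 1) :=
    integrableOn_Ioi_rpow_of_lt (by linarith) zero_lt_one
  have bd : ∀ t ∈ Set.Ioi (1:ℝ), ‖((t - (⌊t⌋₊ : ℝ) : ℝ) : ℂ) * (t:ℂ) ^ (-(s+1))‖ ≤ t ^ (-s.re - 1) := by
    intro t ht
    have ht0 : (0:ℝ) < t := lt_trans zero_lt_one ht
    have a1 := Nat.floor_le ht0.le
    have a2 := Nat.lt_floor_add_one t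
    rw [norm_mul, norm_cpow_neg ht0, Complex.norm_real, Real.norm_of_nonneg (by linarith)]
    have : -(s+1).re = -s.re - 1 := by simp; ring
    rw [this]
    have := Real.rpow_nonneg ht0.le (-s.re - 1)
    nlinarith
  have i2 : IntegrableOn (fun t : ℝ => ((t - (⌊t⌋₊ : ℝ) : ℝ) : ℂ) * (t:ℂ) ^ (-(s+1))) (Set.Ioi 1) := by
    refine Integrable.mono' i3 ?_ ((ae_restrict_iff' measurableSet_Ioi).mpr (Filter.Eventually.of_forall bd))
    refine AEStronglyMeasurable.mul ?_ ?_
    · refine (Measurable.aestronglyMeasurable ?_)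
      refine Complex.measurable_ofReal.comp (measurable_id.sub ?_)
      exact (measurable_from_top (f := fun n : ℕ => (n:ℝ))).comp Nat.measurable_floor
    · refine ContinuousOn.aestronglyMeasurable ?_ measurableSet_Ioi
      intro t ht
      have ht0 : (0:ℝ) < t := lt_trans zero_lt_one ht
      exact (Complex.continuousAt_ofReal_cpow_const _ _ (Or.inr ht0.ne')).continuousWithinAt
  have e : ∫ t in Set.Ioi (1 : ℝ), (∑ k ∈ Icc 1 ⌊t⌋₊, (1 : ℕ → ℂ) k) * (t:ℂ) ^ (-(s + 1)) =
      (∫ t in Set.Ioi (1:ℝ), (t:ℂ) ^ (-s)) - ∫ t in Set.Ioi (1:ℝ), ((t - (⌊t⌋₊ : ℝ) : ℝ) : ℂ) * (t:ℂ) ^ (-(s+1)) := by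
    rw [← integral_sub i1 i2]
    refine setIntegral_congr_fun measurableSet_Ioi fun t ht => ?_
    have ht0 : (0:ℝ) < t := lt_trans zero_lt_one ht
    have htc : (t:ℂ) ≠ 0 := by exact_mod_cast ht0.ne'
    have : (t:ℂ) ^ (-s) = t * (t:ℂ) ^ (-(s+1)) := by
      rw [show -s = 1 + (-(s+1)) by ring, Complex.cpow_add _ _ htc, Complex.cpow_one]
    simp only [this]
    simp
    ring
  rw [e, integral_Ioi_cpow_of_lt (by simpa using hs) zero_lt_one] at h
  rw [h, norm_mul]
  gcongr
  refine (norm_sub_le _ _).trans ?_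
  gcongr
  · simp
    rw [show -s + 1 = -(s - 1) by ring, norm_neg]
  · calc _ ≤ ∫ t in Set.Ioi (1:ℝ), t ^ (-s.re - 1) :=
          norm_integral_le_of_norm_le i3 ((ae_restrict_iff' measurableSet_Ioi).mpr (Filter.Eventually.of_forall bd))
      _ ≤ 1 := by
          rw [integral_Ioi_rpow_of_lt (by linarith) zero_lt_one]
          simp
          exact inv_le_one_of_one_le₀ hs.le

lemma triv_bd {d : ℕ} [NeZero d] {s : ℂ} (hs : 1 < s.re) :
    ‖LSeries (fun n => (1 : DirichletCharacter ℂ d) n) s‖ ≤ 2 ^ d.primeFactors.card * (‖s‖ * (1 / ‖s - 1‖ + 1)) := by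
  have hs1 : s ≠ 1 := by rintro rfl; simp at hs
  have h := DirichletCharacter.LFunctionTrivChar_eq_mul_riemannZeta (N := d) hs1
  rw [DirichletCharacter.LFunctionTrivChar, DirichletCharacter.LFunction_eq_LSeries _ hs] at h
  rw [h, norm_mul]
  gcongr
  · rw [norm_prod, ← Finset.prod_const]
    refine Finset.prod_le_prod (fun _ _ => norm_nonneg _) fun p hp => ?_
    have hp1 := (Nat.prime_of_mem_primeFactors hp).one_lt
    have hp1' : (1:ℝ) ≤ p := by exact_mod_cast hp1.le
    have : ‖(p:ℂ) ^ (-s)‖ ≤ 1 := by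
      have := norm_cpow_neg (u := (p:ℝ)) (by linarith) s
      rw [Complex.ofReal_natCast] at this
      rw [this]
      exact Real.rpow_le_one_of_one_le_of_nonpos hp1' (by linarith)
    calc _ ≤ ‖(1:ℂ)‖ + ‖(p:ℂ) ^ (-s)‖ := norm_sub_le _ _
      _ ≤ 2 := by simp; linarith
  · exact zeta_bd hs

/-- real point bound for any character -/
lemma char_real_bd {d : ℕ} [NeZero d] (χ : DirichletCharacter ℂ d) {s : ℂ} (hs : 1 < s.re) (hs2 : s.re ≤ 2) :
    ‖LSeries (fun n => χ n) s‖ ≤ 4 / (s.re - 1) := by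
  have hsr : (1:ℝ) < ((s.re : ℝ) : ℂ).re := by simpa using hs
  have h1 : ‖LSeries (fun n => χ n) s‖ ≤ ∑' n : ℕ, ‖LSeries.term (1 : ℕ → ℂ) s n‖ := by
    unfold LSeries
    refine (norm_tsum_le_tsum_norm ?_).trans (Summable.tsum_le_tsum ?_ ?_ ?_)
    · exact (DirichletCharacter.LSeriesSummable_of_one_lt_re χ hs).norm
    · intro n
      exact LSeries.norm_term_le _ (by simpa using χ.norm_le_one _)
    · exact (DirichletCharacter.LSeriesSummable_of_one_lt_re χ hs).norm
    · exact (LSeriesSummable_one_iff.mpr hs).norm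
  have h2 : ((∑' n : ℕ, ‖LSeries.term (1 : ℕ → ℂ) s n‖ : ℝ) : ℂ) = riemannZeta ((s.re : ℝ) : ℂ) := by
    rw [← LSeries_one_eq_riemannZeta hsr, LSeries, Complex.ofReal_tsum]
    refine tsum_congr fun n => ?_
    rw [LSeries.norm_term_eq]
    rcases eq_or_ne n 0 with rfl | hn
    · simp
    · simp [hn, LSeries.term_of_ne_zero, Complex.ofReal_cpow]
  have h3 := zeta_bd hsr
  rw [← h2, Complex.norm_real, Complex.norm_real, Real.norm_eq_abs, Real.norm_eq_abs, abs_of_pos (show 0 < s.re by linarith)] at h3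
  have h4 : ‖((s.re : ℝ) : ℂ) - 1‖ = s.re - 1 := by
    rw [← Complex.ofReal_one, ← Complex.ofReal_sub, Complex.norm_real, Real.norm_of_nonneg (by linarith)]
  rw [h4] at h3
  refine h1.trans ((le_abs_self _).trans (h3.trans ?_))
  have : 0 < s.re - 1 := by linarith
  rw [le_div_iff₀ this]
  field_simp
  nlinarith

end S11


namespace S11
open Finset MeasureTheory

noncomputable abbrev LS {d : ℕ} (χ : DirichletCharacter ℂ d) (s : ℂ) : ℂ := LSeries (fun n => χ n) s

lemma LS_eq {d : ℕ} [NeZero d] (χ : DirichletCharacter ℂ d) {s : ℂ} (hs : 1 < s.re) :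
    LS χ s = ∑' n : ℕ, χ n * gj 0 s (n : ℝ) := LSeries_logpow χ 0 hs

lemma abscissa_lt {d : ℕ} [NeZero d] (χ : DirichletCharacter ℂ d) {s : ℂ} (hs : 1 < s.re) :
    LSeries.abscissaOfAbsConv (fun n => χ n) < s.re := by
  rw [DirichletCharacter.absicssaOfAbsConv_eq_one (NeZero.ne d)]
  exact_mod_cast hs

lemma LS_lip {d : ℕ} [NeZero d] {χ : DirichletCharacter ℂ d} (hχ : χ ≠ 1) {a b : ℝ} (ha : 1 < a) (hab : a ≤ b)
    (hb : b ≤ 2) (t : ℝ) :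
    ‖LS χ (b + t * Complex.I) - LS χ (a + t * Complex.I)‖ ≤ 100 * ww d t ^ 3 * (b - a) := by
  have hd : ∀ u ∈ Set.Icc a b, HasDerivWithinAt (fun u : ℝ => LS χ ((u:ℂ) + t * Complex.I))
      (- LSeries (LSeries.logMul (fun n => χ n)) ((u:ℂ) + t * Complex.I)) (Set.Icc a b) u := by
    intro u hu
    have hu1 : 1 < ((u:ℂ) + t * Complex.I).re := by simp; linarith [hu.1]
    have h := LSeries_hasDerivAt (abscissa_lt χ hu1)
    have h2 : HasDerivAt (fun z : ℂ => LS χ (z + t * Complex.I))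
      (- LSeries (LSeries.logMul (fun n => χ n)) ((u:ℂ) + t * Complex.I)) (u:ℂ) := h.comp_add_const (u:ℂ) _
    exact h2.comp_ofReal.hasDerivWithinAt
  have bd : ∀ u ∈ Set.Icc a b, ‖- LSeries (LSeries.logMul (fun n => χ n)) ((u:ℂ) + t * Complex.I)‖ ≤ 100 * ww d t ^ 3 := by
    intro u hu
    have hu1 : 1 < ((u:ℂ) + t * Complex.I).re := by simp; linarith [hu.1]
    have hu2 : ((u:ℂ) + t * Complex.I).re ≤ 2 := by simp; linarith [hu.2]
    have := L_bd hχ (j := 1) (by norm_num) hu1 hu2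
    rw [← LSeries_logpow χ 1 hu1] at this
    rw [norm_neg]
    simpa using this
  have := (convex_Icc a b).norm_image_sub_le_of_norm_hasDerivWithin_le hd bd (x := a) (y := b)
    (by simp [hab]) (by simp [hab])
  rwa [Real.norm_of_nonneg (by linarith)] at this

lemma low341 {d : ℕ} [NeZero d] {χ : DirichletCharacter ℂ d} (hχ : χ ≠ 1) {Y : ℝ} (hY : 1 ≤ Y) (t : ℝ)
    (h2 : ∀ σ : ℝ, 1 < σ → σ ≤ 2 → ‖LS (χ^2) (σ + 2 * t * Complex.I)‖ ≤ Y) {σ : ℝ} (h1 : 1 < σ) (hσ : σ ≤ 2) :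
    1 / (2 * 10 ^ 9 * Y * ww d t ^ 9) ≤ ‖LS χ (σ + t * Complex.I)‖ := by
  set w := ww d t with hw
  have hw2 : 2 ≤ w := ww_ge_two (d := d) NeZero.one_le t
  set B : ℝ := 200 * w ^ 3 with hB
  have hB0 : 0 < B := by positivity
  have hB1 : 1 ≤ B := by
    have : (1:ℝ) ≤ w ^ 3 := one_le_pow₀ (by linarith)
    linarith
  set η : ℝ := 1 / (64 * Y * B ^ 4) with hη
  have hη0 : 0 < η := by positivity
  have hη1 : η ≤ 1 := by
    rw [hη, div_le_one (by positivity)]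
    have : 1 ≤ B ^ 4 := one_le_pow₀ hB1
    nlinarith
  have key : ∀ σ : ℝ, 1 + η ≤ σ → σ ≤ 2 → B * η ≤ ‖LS χ (σ + t * Complex.I)‖ := by
    intro u hu hu2
    have hu0 : 0 < u - 1 := by linarith
    have h := DirichletCharacter.norm_LSeries_product_ge_one χ hu0 t
    have e1 : (1:ℂ) + ((u - 1 : ℝ):ℂ) + Complex.I * t = u + t * Complex.I := by push_cast; ring
    have e2 : (1:ℂ) + ((u - 1 : ℝ):ℂ) + 2 * Complex.I * t = u + 2 * t * Complex.I := by push_cast; ring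
    have e3 : (1:ℂ) + ((u - 1 : ℝ):ℂ) = u := by push_cast; ring
    rw [e1, e2, e3, norm_mul, norm_mul, norm_pow, norm_pow] at h
    have b1 := char_real_bd (1 : DirichletCharacter ℂ d) (s := (u:ℂ)) (by simp; linarith) (by simpa using hu2)
    simp only [Complex.ofReal_re] at b1
    have b1' : ‖LS (1 : DirichletCharacter ℂ d) (u:ℂ)‖ ≤ 4 / η := b1.trans (by gcongr; linarith)
    have b2 := h2 u (by linarith) hu2
    set A := ‖LS χ (u + t * Complex.I)‖ with hA
    have hA0 : 0 ≤ A := norm_nonneg _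
    have h' : 1 ≤ (4 / η) ^ 3 * A ^ 4 * Y := by
      refine le_trans h ?_
      have : ‖LSeries (fun n => (1 : DirichletCharacter ℂ d) n) (u:ℂ)‖ ^ 3 ≤ (4/η)^3 := by gcongr
      gcongr
    have h3 : (B * η) ^ 4 ≤ A ^ 4 := by
      have e : (B * η) ^ 4 = η ^ 3 / (64 * Y) := by
        rw [hη]; field_simp
      rw [e, div_le_iff₀ (by positivity)]
      have : (4 / η)^3 * A^4 * Y = 64 * A^4 * Y / η^3 := by field_simp; norm_num; ring
      rw [this, le_div_iff₀ (by positivity)] at h'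
      linarith
    exact le_of_pow_le_pow_left₀ (by norm_num) hA0 h3
  have fin : 1 / (2 * 10 ^ 9 * Y * w ^ 9) ≤ B / 2 * η := by
    have : B / 2 * η = 1 / (1024000000 * Y * w^9) := by
      rw [hη, hB]; field_simp; norm_num
    rw [this]
    gcongr; norm_num
  by_cases hc : 1 + η ≤ σ
  · have := key σ hc hσ
    refine fin.trans (le_trans ?_ this)
    nlinarith [mul_pos hB0 hη0]
  · push Not at hc
    have k := key (1 + η) le_rfl (by linarith)
    have l := LS_lip hχ h1 hc.le (by linarith) t
    have m := norm_le_norm_sub_add (LS χ (((1 + η : ℝ) : ℂ) + t * Complex.I)) (LS χ (σ + t * Complex.I))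
    have : 100 * w ^ 3 * (1 + η - σ) ≤ B / 2 * η := by
      rw [hB]
      have : 1 + η - σ ≤ η := by linarith
      calc 100 * w ^ 3 * (1 + η - σ) ≤ 100 * w ^ 3 * η := by gcongr
        _ = _ := by ring
    refine fin.trans ?_
    linarith

end S11


namespace S11
open Finset MeasureTheory

noncomputable def gs (x : ℝ) (k : ℕ) : ℝ := ∑ i ∈ range k, x ^ i

lemma gs_ge {x : ℝ} (h0 : 0 < x) {k : ℕ} (hk : 1 ≤ k) : k * √(x ^ (k-1)) ≤ gs x k := by
  have h := Real.sum_sqrt_mul_sqrt_le (range k) (f := fun i => x^i) (g := fun i => x^(k-1-i))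
    (fun i => by positivity) (fun i => by positivity)
  have e : ∑ i ∈ range k, x^(k-1-i) = gs x k := Finset.sum_range_reflect (fun i => x^i) k
  rw [e] at h
  have g0 : 0 ≤ gs x k := Finset.sum_nonneg fun i _ => by positivity
  change _ ≤ √(gs x k) * √(gs x k) at h
  rw [Real.mul_self_sqrt g0] at h
  refine le_trans (le_of_eq ?_) h
  rw [Finset.sum_congr rfl (g := fun _ => √(x^(k-1)))]
  · simp
  · intro i hi
    have := Finset.mem_range.mp hi
    rw [← Real.sqrt_mul (by positivity), ← pow_add]
    congr 2; omega

lemma gs_succ (x : ℝ) (k : ℕ) : gs x (k+1) = 1 + x * gs x k := by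
  unfold gs
  rw [Finset.sum_range_succ', Finset.mul_sum]
  simp [pow_succ']; ring

lemma one_sub_pow_eq (x : ℝ) (k : ℕ) : 1 - x^k = (1-x) * gs x k := by
  unfold gs
  have := geom_sum_mul x k
  linarith

noncomputable def bk (x : ℝ) (k : ℕ) : ℝ := 1 / (k * (1-x)) - x^k / (1-x^k)

lemma gs_pos {x : ℝ} (h0 : 0 < x) {k : ℕ} (hk : 1 ≤ k) : 0 < gs x k := by
  refine Finset.sum_pos (fun i _ => by positivity) ⟨0, by simp; omega⟩

lemma bk_eq {x : ℝ} (h1 : x < 1) (k : ℕ) :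
    bk x k = (1 / k - x^k / gs x k) / (1-x) := by
  unfold bk
  rw [one_sub_pow_eq]
  have : 1 - x ≠ 0 := by linarith
  rw [sub_div, div_div, div_div, mul_comm (gs x k)]

lemma bk_anti {x : ℝ} (h0 : 0 < x) (h1 : x < 1) {k : ℕ} (hk : 1 ≤ k) : bk x (k+1) ≤ bk x k := by
  rw [bk_eq h1, bk_eq h1]
  have g1 := gs_pos h0 hk
  have g2 := gs_pos h0 (show 1 ≤ k+1 by omega)
  have hk' : (0:ℝ) < k := by exact_mod_cast hk
  apply div_le_div_of_nonneg_right _ (by linarith)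
  have e1 : x^k / gs x k - x^(k+1) / gs x (k+1) = x^k / (gs x k * gs x (k+1)) := by
    rw [div_sub_div _ _ g1.ne' g2.ne']
    congr 1
    rw [gs_succ]; ring
  have e2 : 1 / (k:ℝ) - 1 / ((k+1:ℕ):ℝ) = 1 / (k * (k+1)) := by
    push_cast
    field_simp
    ring
  have main : x^k / (gs x k * gs x (k+1)) ≤ 1 / (k * (k+1)) := by
    rw [div_le_div_iff₀ (by positivity) (by positivity)]
    have a1 := gs_ge h0 hk
    have a2 := gs_ge h0 (show 1 ≤ k+1 by omega)
    simp only [Nat.add_sub_cancel] at a2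
    push_cast at a2
    have s1 : x^k ≤ √(x^(k-1)) * √(x^k) := by
      rw [← Real.sqrt_mul (by positivity)]
      apply Real.le_sqrt_of_sq_le
      rw [← pow_mul, ← pow_add]
      exact pow_le_pow_of_le_one h0.le h1.le (by omega)
    calc x^k * (k * (k+1)) ≤ (√(x^(k-1)) * √(x^k)) * (k * (k+1)) := by gcongr
      _ = (k * √(x^(k-1))) * ((k+1) * √(x^k)) := by ring
      _ ≤ gs x k * gs x (k+1) := by gcongr
      _ = _ := by ring
  linarith

lemma bk_nonneg {x : ℝ} (h0 : 0 < x) (h1 : x < 1) {k : ℕ} (hk : 1 ≤ k) : 0 ≤ bk x k := by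
  rw [bk_eq h1]
  have g1 := gs_pos h0 hk
  have hk' : (0:ℝ) < k := by exact_mod_cast hk
  refine div_nonneg ?_ (by linarith)
  rw [sub_nonneg, div_le_div_iff₀ g1 hk']
  have : ∑ i ∈ range k, x^k ≤ gs x k := by
    refine Finset.sum_le_sum fun i hi => pow_le_pow_of_le_one h0.le h1.le (Finset.mem_range.mp hi).le
  simp at this
  linarith

lemma bk_one {x : ℝ} (h1 : x < 1) : bk x 1 = 1 := by
  have : 1 - x ≠ 0 := by linarith
  unfold bk
  field_simp
  simp

lemma abel_bk {d : ℕ} [NeZero d] {χ : DirichletCharacter ℂ d} (hχ : χ ≠ 1) {x : ℝ} (h0 : 0 < x) (h1 : x < 1)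
    {M : ℕ} (hM : 1 ≤ M) : ‖∑ k ∈ Ico 1 M, χ (k : ZMod d) * (bk x k : ℂ)‖ ≤ 2 * d := by
  refine (abel_bd (fun k => χ (k : ZMod d)) (fun k => (bk x k : ℂ)) hM (char_sum_bd hχ)).trans ?_
  have e : ∑ k ∈ Ico 1 M, ‖((bk x (k+1) : ℝ):ℂ) - bk x k‖ = bk x 1 - bk x M := by
    rw [Finset.sum_congr rfl (g := fun k => bk x k - bk x (k+1))]
    · rw [Finset.sum_Ico_eq_sub _ hM, Finset.sum_range_sub', Finset.sum_range_sub']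
      ring
    · intro k hk
      have hk1 := (Finset.mem_Ico.mp hk).1
      rw [← Complex.ofReal_sub, Complex.norm_real, Real.norm_of_nonpos]
      · ring
      · linarith [bk_anti h0 h1 hk1]
  rw [e, Complex.norm_real, Complex.norm_real, Real.norm_of_nonneg (bk_nonneg h0 h1 hM),
    Real.norm_of_nonneg (bk_nonneg h0 h1 le_rfl), bk_one h1]
  linarith

/-- truncated Lambert -/
lemma lambert_trunc {x : ℝ} (h0 : 0 < x) (h1 : x < 1) {k : ℕ} (hk : 1 ≤ k) (N : ℕ) :
    |x^k/(1-x^k) - ∑ n ∈ Icc 1 N with k ∣ n, x^n| ≤ x^N / (1-x) := by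
  have e : ∑ n ∈ Icc 1 N with k ∣ n, x^n = ∑ m ∈ range (N/k), x^k * (x^k)^m := by
    symm
    refine Finset.sum_bij (fun m _ => k * (m+1)) ?_ ?_ ?_ ?_
    · intro m hm
      have := Finset.mem_range.mp hm
      simp
      refine ⟨Nat.mul_pos hk (by omega), ?_⟩
      calc k * (m+1) ≤ k * (N/k) := Nat.mul_le_mul_left _ this
        _ ≤ N := Nat.mul_div_le N k
    · intro a _ b _ hab
      have := Nat.eq_of_mul_eq_mul_left hk hab
      omega
    · intro n hn
      simp at hn
      obtain ⟨⟨h3, h2⟩, c, rfl⟩ := hn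
      have hc : 1 ≤ c := by
        rcases Nat.eq_zero_or_pos c with rfl | h
        · simp at h3
        · exact h
      refine ⟨c-1, ?_, ?_⟩
      · simp
        have : c ≤ N / k := by rw [Nat.le_div_iff_mul_le hk]; linarith [mul_comm k c]
        omega
      · congr 1; omega
    · intro m _
      rw [← pow_mul, ← pow_add]; congr 1; ring
  have hxk : x^k ≤ x := by simpa using pow_le_pow_of_le_one h0.le h1.le hk
  have hxk0 : 0 < x^k := by positivity
  rw [e, ← Finset.mul_sum]
  have g := geom_sum_mul (x^k) (N/k)
  have h2 : ∑ i ∈ range (N/k), (x^k)^i = (1 - (x^k)^(N/k)) / (1 - x^k) := by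
    rw [eq_div_iff (by linarith)]; linarith
  rw [h2]
  have : x^k/(1-x^k) - x^k * ((1 - (x^k)^(N/k)) / (1 - x^k)) = x^(k*(N/k+1)) / (1-x^k) := by
    rw [pow_mul, pow_succ]
    ring
  rw [this, abs_of_nonneg (div_nonneg (by positivity) (by linarith))]
  have hle : N ≤ k * (N/k+1) := (Nat.lt_mul_div_succ N hk).le
  have := pow_le_pow_of_le_one h0.le h1.le hle
  apply div_le_div₀ (by positivity) this (by linarith) (by linarith)

lemma zetaMul_app {d : ℕ} (χ : DirichletCharacter ℂ d) (n : ℕ) :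
    χ.zetaMul n = ∑ k ∈ n.divisors, χ (k : ZMod d) := by
  rw [DirichletCharacter.zetaMul, ArithmeticFunction.coe_zeta_mul_apply]
  refine Finset.sum_congr rfl fun k hk => ?_
  have : k ≠ 0 := (Nat.pos_of_mem_divisors hk).ne'
  exact if_neg this

open scoped ComplexOrder in
lemma zetaMul_sq {d : ℕ} {χ : DirichletCharacter ℂ d} (hχ : χ ^ 2 = 1) {m : ℕ} (hm : m ≠ 0) :
    1 ≤ χ.zetaMul (m^2) := by
  have hm2 : m^2 ≠ 0 := pow_ne_zero _ hm
  rw [χ.isMultiplicative_zetaMul.multiplicative_factorization _ hm2]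
  refine Finset.prod_induction _ (fun z : ℂ => 1 ≤ z) (fun a b ha hb => one_le_mul_of_one_le_of_one_le ha hb) le_rfl ?_
  intro p hp
  have hpp := Nat.prime_of_mem_primeFactors hp
  have he : (m^2).factorization p = 2 * m.factorization p := by simp [Nat.factorization_pow]
  rw [he]
  have h := χ.isMultiplicative_zetaMul
  change 1 ≤ χ.zetaMul (p ^ (2 * m.factorization p))
  rw [zetaMul_app, Nat.sum_divisors_prime_pow hpp]
  simp only [Nat.cast_pow, map_pow]
  rw [Finset.sum_range_succ']
  rcases MulChar.isQuadratic_iff_sq_eq_one.mpr hχ p with h | h | h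
  · simp [h]
  · simp [h]
    exact_mod_cast Nat.zero_le _
  · rw [← Finset.sum_range_succ' (fun i => χ p ^ i)]
    simp only [h, neg_one_geom_sum]
    simp [Nat.even_add_one]

open scoped ComplexOrder in
lemma quad_lower {d : ℕ} [NeZero d] {χ : DirichletCharacter ℂ d} (hχ2 : χ ^ 2 = 1) {x : ℝ} (h0 : 0 < x) (h1 : x < 1)
    {N M : ℕ} (hMN : M^2 ≤ N) :
    M * x^(M^2) - N * (x^N/(1-x)) ≤ (∑ k ∈ Ico 1 (N+1), χ (k : ZMod d) * ((x^k/(1-x^k) : ℝ) : ℂ)).re := by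
  have e1 : ∑ k ∈ Icc 1 N, χ (k : ZMod d) * ((∑ n ∈ Icc 1 N with k ∣ n, x^n : ℝ) : ℂ) =
      ∑ n ∈ Icc 1 N, χ.zetaMul n * ((x^n : ℝ) : ℂ) := by
    simp only [Complex.ofReal_sum, Finset.sum_filter, Finset.mul_sum]
    rw [Finset.sum_comm]
    refine Finset.sum_congr rfl fun n hn => ?_
    have hn' := Finset.mem_Icc.mp hn
    rw [zetaMul_app, Finset.sum_mul]
    have : n.divisors = (Icc 1 N).filter (fun k => k ∣ n) := by
      ext k
      simp only [Nat.mem_divisors, Finset.mem_filter, Finset.mem_Icc]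
      constructor
      · rintro ⟨h, h'⟩
        exact ⟨⟨Nat.pos_of_dvd_of_pos h (by omega), (Nat.le_of_dvd (by omega) h).trans hn'.2⟩, h⟩
      · rintro ⟨_, h⟩; exact ⟨h, by omega⟩
    rw [this, Finset.sum_filter]
    refine Finset.sum_congr rfl fun k hk => ?_
    have : k ≠ 0 := by have := (Finset.mem_Icc.mp hk).1; omega
    split_ifs <;> simp
  have e2 : M * x^(M^2) ≤ (∑ n ∈ Icc 1 N, χ.zetaMul n * ((x^n : ℝ) : ℂ)).re := by
    rw [Complex.re_sum]
    simp only [Complex.re_mul_ofReal]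
    have hnn : ∀ n, 0 ≤ (χ.zetaMul n).re := fun n => (Complex.le_def.mp (DirichletCharacter.zetaMul_nonneg hχ2 n)).1
    calc (M:ℝ) * x^(M^2) = ∑ m ∈ Icc 1 M, x^(M^2) := by simp
      _ ≤ ∑ m ∈ Icc 1 M, (χ.zetaMul (m^2)).re * x^(m^2) := by
        refine Finset.sum_le_sum fun m hm => ?_
        have hm' := Finset.mem_Icc.mp hm
        have a1 : (1:ℝ) ≤ (χ.zetaMul (m^2)).re := by
          have := (Complex.le_def.mp (zetaMul_sq hχ2 (m := m) (by omega))).1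
          simpa using this
        have a2 : x^(M^2) ≤ x^(m^2) := pow_le_pow_of_le_one h0.le h1.le (Nat.pow_le_pow_left hm'.2 2)
        have : 0 ≤ x^(m^2) := by positivity
        nlinarith
      _ = ∑ n ∈ (Icc 1 M).image (fun m => m^2), (χ.zetaMul n).re * x^n := by
        rw [Finset.sum_image]
        intro a _ b _ hab
        exact Nat.pow_left_injective (n := 2) (by norm_num) hab
      _ ≤ _ := by
        refine Finset.sum_le_sum_of_subset_of_nonneg ?_ (fun n _ _ => mul_nonneg (hnn n) (by positivity))
        intro n hn
        simp only [Finset.mem_image, Finset.mem_Icc] at hn ⊢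
        obtain ⟨m, ⟨h1, h2⟩, rfl⟩ := hn
        exact ⟨Nat.one_le_pow _ _ h1, (Nat.pow_le_pow_left h2 2).trans hMN⟩
  have e3 : ‖(∑ k ∈ Icc 1 N, χ (k : ZMod d) * ((∑ n ∈ Icc 1 N with k ∣ n, x^n : ℝ) : ℂ)) -
      ∑ k ∈ Ico 1 (N+1), χ (k : ZMod d) * ((x^k/(1-x^k) : ℝ) : ℂ)‖ ≤ N * (x^N/(1-x)) := by
    rw [show Ico 1 (N+1) = Icc 1 N by ext; simp]
    rw [← Finset.sum_sub_distrib]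
    refine (norm_sum_le _ _).trans ?_
    calc _ ≤ ∑ k ∈ Icc 1 N, x^N/(1-x) := by
          refine Finset.sum_le_sum fun k hk => ?_
          rw [← mul_sub, norm_mul, ← Complex.ofReal_sub, Complex.norm_real, Real.norm_eq_abs, abs_sub_comm]
          have := lambert_trunc h0 h1 (Finset.mem_Icc.mp hk).1 N
          calc _ ≤ 1 * (x^N/(1-x)) := by gcongr; exact χ.norm_le_one _
            _ = _ := one_mul _
      _ = _ := by simp
  rw [e1] at e3
  have := (Complex.abs_re_le_norm _).trans e3
  rw [Complex.sub_re] at this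
  have := (abs_le.mp this).2
  linarith

end S11


namespace S11
open Finset MeasureTheory Filter Topology

lemma LS_lip2 {d : ℕ} [NeZero d] {χ : DirichletCharacter ℂ d} (hχ : χ ≠ 1) {a b : ℂ} (ha : 1 < a.re) (ha2 : a.re ≤ 2)
    (ha3 : |a.im| ≤ 1) (hb : 1 < b.re) (hb2 : b.re ≤ 2) (hb3 : |b.im| ≤ 1) :
    ‖LS χ b - LS χ a‖ ≤ 100 * ww d 1 ^ 3 * ‖b - a‖ := by
  have hconv : Convex ℝ {z : ℂ | (1 < z.re ∧ z.re ≤ 2) ∧ |z.im| ≤ 1} := by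
    have h := ((convex_Ioc (1:ℝ) 2).linear_preimage Complex.reLm).inter
      ((convex_Icc (-1:ℝ) 1).linear_preimage Complex.imLm)
    have e : {z : ℂ | (1 < z.re ∧ z.re ≤ 2) ∧ |z.im| ≤ 1} =
        Complex.reLm ⁻¹' Set.Ioc 1 2 ∩ Complex.imLm ⁻¹' Set.Icc (-1) 1 := by
      ext z; simp [abs_le]
    rw [e]; exact h
  refine hconv.norm_image_sub_le_of_norm_hasDerivWithin_le
    (f' := fun z => - LSeries (LSeries.logMul (fun n => χ n)) z)
    (fun z hz => (LSeries_hasDerivAt (abscissa_lt χ hz.1.1)).hasDerivWithinAt) ?_ ⟨⟨ha, ha2⟩, ha3⟩ ⟨⟨hb, hb2⟩, hb3⟩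
  intro z hz
  have := L_bd hχ (j := 1) (by norm_num) hz.1.1 hz.1.2
  rw [← LSeries_logpow χ 1 hz.1.1] at this
  rw [norm_neg]
  refine (show ‖LSeries (LSeries.logMul (fun n => χ n)) z‖ ≤ _ by simpa using this).trans ?_
  have h0 : 0 ≤ Real.log d := Real.log_natCast_nonneg d
  have : ww d z.im ≤ ww d 1 := by
    unfold ww; apply mul_le_mul_of_nonneg_left _ (by linarith); simpa using hz.2
  have := ww_ge_two (d := d) NeZero.one_le z.im
  gcongr

lemma quad_near {d : ℕ} [NeZero d] {χ : DirichletCharacter ℂ d} (hχ : χ ≠ 1) (hχ2 : χ ^ 2 = 1) {s : ℂ}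
    (hs : 1 < s.re) (hs2 : s.re ≤ 2) (hs3 : |s.im| ≤ 1) :
    1 / (72 * d) - 100 * ww d 1 ^ 3 * ‖s - 1‖ ≤ ‖LS χ s‖ := by
  have hd : (1:ℝ) ≤ d := by exact_mod_cast NeZero.one_le
  have A : ∀ N : ℕ, 1 ≤ N → (∑ k ∈ Ico 1 N, χ (k : ZMod d) * (k:ℂ)⁻¹).re ≤
      ‖LS χ s‖ + 100 * ww d 1 ^ 3 * ‖s - 1‖ + 600 * d / √N := by
    intro N hN
    have t1 : Tendsto (fun z : ℂ => (∑ k ∈ Ico 1 N, χ (k : ZMod d) * gj 0 z (k:ℝ)).re) (𝓝 1)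
        (𝓝 (∑ k ∈ Ico 1 N, χ (k : ZMod d) * (k:ℂ)⁻¹).re) := by
      refine (Complex.continuous_re.tendsto _).comp (tendsto_finsetSum _ fun k hk => ?_)
      have hk0 : (k:ℂ) ≠ 0 := by
        have := (Finset.mem_Ico.mp hk).1
        exact_mod_cast (by omega : k ≠ 0)
      refine Tendsto.const_mul _ ?_
      have c : Continuous (fun z : ℂ => (k:ℂ) ^ (-z)) := by
        exact continuous_neg.const_cpow (Or.inl hk0)
      have := c.tendsto 1
      simpa [gj, Complex.cpow_neg_one] using this
    have t2 : Tendsto (fun η : ℝ => (1 + η : ℂ)) (𝓝[>] 0) (𝓝 1) := by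
      have : Continuous (fun η : ℝ => (1 + η : ℂ)) := by fun_prop
      have := this.tendsto 0
      simp only [Complex.ofReal_zero, add_zero] at this
      exact this.mono_left nhdsWithin_le_nhds
    have t3 := t1.comp t2
    have t4 : Tendsto (fun η : ℝ => ‖LS χ s‖ + 100 * ww d 1 ^ 3 * ‖s - (1 + η : ℂ)‖ + 600 * d / √N) (𝓝[>] 0)
        (𝓝 (‖LS χ s‖ + 100 * ww d 1 ^ 3 * ‖s - 1‖ + 600 * d / √N)) := by
      exact ((((tendsto_const_nhds.sub t2).norm).const_mul _).const_add _).add_const _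
    refine le_of_tendsto_of_tendsto t3 t4 ?_
    have : Set.Ioo (0:ℝ) 1 ∈ 𝓝[>] (0:ℝ) := Ioo_mem_nhdsGT one_pos
    filter_upwards [this] with η hη
    have r1 : 1 < (1 + η : ℂ).re := by simp [hη.1]
    have r2 : (1 + η : ℂ).re ≤ 2 := by simp; linarith [hη.2]
    have r3 : |(1 + η : ℂ).im| ≤ 1 := by simp
    have l := LS_lip2 hχ r1 r2 r3 hs hs2 hs3
    have tt := tsum_tail hχ (j := 0) (by norm_num) r1 hN
    rw [← LS_eq χ r1] at tt
    have hz : (∑ k ∈ range N, χ (k : ZMod d) * gj 0 (1 + η) (k : ℝ)) = ∑ k ∈ Ico 1 N, χ (k : ZMod d) * gj 0 (1+η) (k:ℝ) := by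
      rw [Finset.range_eq_Ico, Finset.sum_eq_sum_Ico_succ_bot hN]
      have : (0:ℂ) ^ (-(1 + (η:ℂ))) = 0 := by
        apply Complex.zero_cpow
        intro h
        have := congrArg Complex.re h
        simp at this; linarith [hη.1]
      simp only [gj, Nat.cast_zero, Complex.ofReal_zero, this]
      simp
    rw [hz] at tt
    have n1 : ‖(1 + η : ℂ)‖ ≤ 2 := by
      rw [← Complex.ofReal_one, ← Complex.ofReal_add, Complex.norm_real, Real.norm_of_nonneg (by linarith [hη.1])]
      linarith [hη.2]
    have tt2 : 150 * (d:ℝ) * (2 + ‖(1 + η : ℂ)‖) / √N ≤ 600 * d / √N := by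
      apply div_le_div_of_nonneg_right _ (Real.sqrt_nonneg _); nlinarith
    have i1 := Complex.abs_re_le_norm (LS χ (1+η) - ∑ k ∈ Ico 1 N, χ (k : ZMod d) * gj 0 (1+η) (k:ℝ))
    rw [Complex.sub_re] at i1
    have i2 := (abs_le.mp i1).1
    have i3 := Complex.re_le_norm (LS χ (1+η))
    have i4 : ‖LS χ (1+η)‖ ≤ ‖LS χ s‖ + ‖LS χ s - LS χ (1+η)‖ := by
      have := norm_sub_norm_le (LS χ (1+η)) (LS χ s)
      rw [norm_sub_rev] at this
      linarith
    change (∑ k ∈ Ico 1 N, χ (k : ZMod d) * gj 0 (1+η) (k:ℝ)).re ≤ _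
    linarith
  set x : ℝ := 1 - 1 / (72 * d^2) with hx
  have hx1 : x < 1 := by rw [hx]; have : 0 < 1 / (72 * (d:ℝ)^2) := by positivity
                         linarith
  have hx0 : 0 < x := by
    rw [hx]
    have : 1 / (72 * (d:ℝ)^2) ≤ 1 / 72 := by
      apply one_div_le_one_div_of_le (by norm_num); nlinarith
    linarith
  have h1x : 1 - x = 1 / (72 * d^2) := by rw [hx]; ring
  have B : ∀ N : ℕ, (6*d)^2 ≤ N → (1 - x) * ((6 * d : ℕ) * x^((6*d)^2) - 2 * d) - N * x^N ≤
      (∑ k ∈ Ico 1 (N+1), χ (k : ZMod d) * (k:ℂ)⁻¹).re := by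
    intro N hN
    have q := quad_lower hχ2 hx0 hx1 hN
    have ab := abel_bk hχ hx0 hx1 (show 1 ≤ N + 1 by omega)
    have e : (∑ k ∈ Ico 1 (N+1), χ (k : ZMod d) * (k:ℂ)⁻¹) = ((1-x : ℝ) : ℂ) * 
        ((∑ k ∈ Ico 1 (N+1), χ (k : ZMod d) * (bk x k : ℂ)) + ∑ k ∈ Ico 1 (N+1), χ (k : ZMod d) * ((x^k/(1-x^k) : ℝ) : ℂ)) := by
      rw [← Finset.sum_add_distrib, Finset.mul_sum]
      refine Finset.sum_congr rfl fun k hk => ?_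
      rw [← mul_add, ← Complex.ofReal_add, mul_left_comm, ← Complex.ofReal_mul]
      congr 1
      have : (1 - x) * (bk x k + x^k/(1-x^k)) = (k:ℝ)⁻¹ := by
        unfold bk
        have : 1 - x ≠ 0 := by linarith
        have hk0 : (k:ℝ) ≠ 0 := by
          have := (Finset.mem_Ico.mp hk).1
          exact_mod_cast (by omega : k ≠ 0)
        rw [sub_add_cancel]
        field_simp
      rw [this]; simp
    rw [e, Complex.re_ofReal_mul, Complex.add_re]
    have i2 := (abs_le.mp ((Complex.abs_re_le_norm _).trans ab)).1
    have h1 : (0:ℝ) < 1 - x := by linarith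
    have e3 : (1-x) * (N * (x^N/(1-x))) = N * x^N := by field_simp
    calc _ = (1-x) * (-(2*d) + ((6 * d : ℕ) * x^((6*d)^2) - N * (x^N/(1-x)))) := by rw [mul_add, mul_sub, mul_sub, e3]; ring
      _ ≤ _ := by
        apply mul_le_mul_of_nonneg_left _ h1.le
        linarith
  have C : (1 - x) * ((6 * d : ℕ) * x^((6*d)^2) - 2 * d) ≤ ‖LS χ s‖ + 100 * ww d 1 ^ 3 * ‖s - 1‖ := by
    have t1 : Tendsto (fun N : ℕ => ‖LS χ s‖ + 100 * ww d 1 ^ 3 * ‖s - 1‖ + 600 * d / √((N + 1 : ℕ):ℝ) + N * x^N) atTop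
        (𝓝 (‖LS χ s‖ + 100 * ww d 1 ^ 3 * ‖s - 1‖ + 0 + 0)) := by
      refine (Tendsto.const_add _ ?_).add (tendsto_self_mul_const_pow_of_lt_one hx0.le hx1)
      refine Tendsto.const_div_atTop ?_ _
      exact Real.tendsto_sqrt_atTop.comp (tendsto_natCast_atTop_atTop.comp (tendsto_add_atTop_nat 1))
    simp only [add_zero] at t1
    refine ge_of_tendsto t1 ?_
    filter_upwards [eventually_ge_atTop ((6*d)^2)] with N hN
    have := B N hN
    have := A (N+1) (by omega)
    linarith
  have bern : 1/2 ≤ x^((6*d)^2) := by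
    have := one_add_mul_le_pow (a := -(1 / (72 * (d:ℝ)^2))) (by
      have : 1 / (72 * (d:ℝ)^2) ≤ 1 / 72 := by
        apply one_div_le_one_div_of_le (by norm_num); nlinarith
      linarith) ((6*d)^2)
    rw [← sub_eq_add_neg, ← hx] at this
    refine le_trans (le_of_eq ?_) this
    push_cast
    field_simp
    norm_num
  have : 1 / (72 * d) ≤ (1 - x) * ((6 * d : ℕ) * x^((6*d)^2) - 2 * d) := by
    rw [h1x]
    push_cast
    calc (1:ℝ) / (72 * d) = 1 / (72 * d^2) * (6 * d * (1/2) - 2 * d) := by field_simp; ring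
      _ ≤ _ := by gcongr
  linarith

end S11


namespace S11
open Finset MeasureTheory Filter Topology

/-- lower bound factor -/
noncomputable def Rr {d : ℕ} (χ : DirichletCharacter ℂ d) : ℝ :=
  open Classical in if χ ^ 2 = 1 then d * 2 ^ d.primeFactors.card else 1

lemma Rr_ge_one {d : ℕ} [NeZero d] (χ : DirichletCharacter ℂ d) : 1 ≤ Rr χ := by
  have hd : (1:ℝ) ≤ d := by exact_mod_cast NeZero.one_le
  unfold Rr; split_ifs
  · have : (1:ℝ) ≤ 2 ^ d.primeFactors.card := one_le_pow₀ (by norm_num)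
    nlinarith
  · exact le_rfl

lemma LS_lower {d : ℕ} [NeZero d] {χ : DirichletCharacter ℂ d} (hχ : χ ≠ 1) {σ : ℝ} (h1 : 1 < σ) (h2 : σ ≤ 2)
    (hq : χ ^ 2 = 1 → σ - 1 ≤ 1 / (10^6 * (Real.log d + 1)^3 * d)) (t : ℝ) :
    1 / (4 * 10^15 * Rr χ * ww d t ^ 13) ≤ ‖LS χ (σ + t * Complex.I)‖ := by
  have hd : (1:ℝ) ≤ d := by exact_mod_cast NeZero.one_le
  have hw := ww_ge_two (d := d) NeZero.one_le t
  have hW0 : 0 ≤ Real.log d := Real.log_natCast_nonneg d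
  set W := Real.log d + 1 with hW
  have hW1 : 1 ≤ W := by linarith
  set w := ww d t with hwd
  by_cases hs : χ ^ 2 = 1
  · have hR : Rr χ = d * 2 ^ d.primeFactors.card := by simp [Rr, hs]
    set τ : ℝ := 1 / (10^6 * W^3 * d) with hτ
    have hW3 : 1 ≤ W^3 := one_le_pow₀ hW1
    have hP : 1 ≤ W^3 * d := by nlinarith
    have hτ0 : 0 < τ := by positivity
    have hτ1 : τ ≤ 1 / 10^6 := by
      rw [hτ]; apply one_div_le_one_div_of_le (by norm_num); nlinarith
    have h2w : (1:ℝ) ≤ 2 ^ d.primeFactors.card := one_le_pow₀ (by norm_num)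
    have hww : W ≤ w := by
      rw [hwd, ww]
      nlinarith [abs_nonneg t]
    by_cases ht : |t| ≤ τ
    · have q := quad_near hχ hs (s := σ + t * Complex.I) (by simpa using h1) (by simpa using h2)
        (by simp; linarith)
      refine le_trans ?_ q
      have n1 : ‖(σ + t * Complex.I : ℂ) - 1‖ ≤ 2 * τ := by
        have : (σ + t * Complex.I : ℂ) - 1 = ((σ - 1 : ℝ):ℂ) + ((t:ℝ):ℂ) * Complex.I := by push_cast; ring
        rw [this]
        refine (norm_add_le _ _).trans ?_
        rw [norm_mul, Complex.norm_real, Complex.norm_real, Complex.norm_I, mul_one, Real.norm_of_nonneg (by linarith),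
          Real.norm_eq_abs]
        linarith [hq hs]
      have n2 : ww d 1 = 3 * W := by unfold ww; norm_num; ring
      have n3 : 100 * ww d 1 ^ 3 * ‖(σ + t * Complex.I : ℂ) - 1‖ ≤ 5400 / (10^6 * d) := by
        rw [n2]
        calc _ ≤ 100 * (3 * W)^3 * (2 * τ) := by gcongr
          _ = 5400 / (10^6 * d) := by rw [hτ]; field_simp; ring
      have n4 : 1 / (144 * (d:ℝ)) ≤ 1 / (72 * d) - 5400 / (10^6 * d) := by
        have : 1 / (72 * (d:ℝ)) - 5400 / (10^6 * d) - 1 / (144 * (d:ℝ)) = (1/72 - 5400/10^6 - 1/144) / d := by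
          field_simp
        have : 0 ≤ (1/72 - 5400/10^6 - 1/144) / (d:ℝ) := by norm_num; positivity
        linarith
      have n5 : 1 / (4 * 10^15 * Rr χ * w ^ 13) ≤ 1 / (144 * (d:ℝ)) := by
        apply one_div_le_one_div_of_le (by positivity)
        rw [hR]
        have : (1:ℝ) ≤ w ^ 13 := one_le_pow₀ (by linarith)
        have : (d:ℝ) ≤ d * 2 ^ d.primeFactors.card * w^13 := by
          have : 1 ≤ 2 ^ d.primeFactors.card * w^13 := by nlinarith
          nlinarith
        nlinarith
      linarith
    · push Not at ht
      have := low341 hχ (Y := 2 ^ d.primeFactors.card * (2 * (|t| + 2) / τ)) ?_ t ?_ h1 h2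
      · refine le_trans ?_ this
        apply one_div_le_one_div_of_le
        · positivity
        · rw [hR, hτ]
          have : 2 * 10 ^ 9 * (2 ^ d.primeFactors.card * (2 * (|t| + 2) / (1 / (10^6 * W^3 * d)))) * w^9 
            = 4 * 10^15 * (d * 2 ^ d.primeFactors.card) * (W^2 * (W * (|t| + 2)) * w^9) := by
            field_simp
            ring
          rw [this]
          have e : W * (|t| + 2) = w := rfl
          rw [e]
          have : W^2 * w * w^9 ≤ w^13 := by
            calc W^2 * w * w^9 ≤ w^2 * w * w^9 := by gcongr
              _ = w^12 := by ring
              _ ≤ w^13 := pow_le_pow_right₀ (by linarith) (by norm_num)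
          gcongr
      · have : 1 ≤ 2 * (|t| + 2) / τ := by
          rw [le_div_iff₀ hτ0]; linarith [abs_nonneg t]
        nlinarith
      · intro σ' h1' h2'
        have hre : 1 < (σ' + 2 * t * Complex.I : ℂ).re := by simpa using h1'
        rw [hs]
        refine (triv_bd hre).trans ?_
        have him : |(σ' + 2 * t * Complex.I - 1 : ℂ).im| ≤ ‖(σ' + 2 * t * Complex.I - 1 : ℂ)‖ := Complex.abs_im_le_norm _
        have him2 : (σ' + 2 * t * Complex.I - 1 : ℂ).im = 2 * t := by simp
        rw [him2, abs_mul, abs_two] at him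
        have hn : ‖(σ' + 2 * t * Complex.I : ℂ)‖ ≤ 2 + 2 * |t| := by
          refine (norm_add_le _ _).trans ?_
          rw [norm_mul, norm_mul, Complex.norm_real, Complex.norm_real, Complex.norm_I, mul_one, Real.norm_of_nonneg (by linarith),
          Real.norm_eq_abs]
          simp; linarith
        have h3 : 1 / ‖(σ' + 2 * t * Complex.I - 1 : ℂ)‖ ≤ 1 / (2 * τ) := by
          apply one_div_le_one_div_of_le (by positivity); linarith
        have h4 : 1 ≤ 1 / (2 * τ) := by
          rw [le_div_iff₀ (by positivity)]; linarith
        gcongr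
        calc _ ≤ (2 + 2 * |t|) * (1 / (2 * τ) + 1 / (2 * τ)) := by gcongr
          _ = (2 + 2 * |t|) / τ := by field_simp; ring
          _ ≤ _ := by gcongr; linarith
  · have hR : Rr χ = 1 := by simp [Rr, hs]
    have := low341 hχ (Y := 100 * ww d (2*t) ^ 3) ?_ t ?_ h1 h2
    · refine le_trans ?_ this
      have hb : ww d (2*t) ≤ 2 * w := by
        rw [hwd]; unfold ww
        rw [abs_mul, abs_two]; nlinarith
      have h0 := ww_ge_two (d := d) NeZero.one_le (2*t)
      apply one_div_le_one_div_of_le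
      · positivity
      · rw [hR]
        calc _ ≤ 2 * 10^9 * (100 * (2 * w)^3) * w^9 := by gcongr
          _ = 1.6 * 10^12 * w^12 := by ring
          _ ≤ 4 * 10^15 * 1 * w^13 := by
            have : w^12 ≤ w^13 := pow_le_pow_right₀ (by linarith) (by norm_num)
            nlinarith [show 0 ≤ w^12 by positivity]
    · have h0 := ww_ge_two (d := d) NeZero.one_le (2*t)
      have : 1 ≤ ww d (2*t)^3 := one_le_pow₀ (by linarith)
      linarith
    · intro σ' h1' h2'
      have hre : 1 < (σ' + 2 * t * Complex.I : ℂ).re := by simpa using h1'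
      rw [LS_eq _ hre]
      have := L_bd hs (j := 0) (by norm_num) hre (by simpa using h2')
      simpa using this

open ArithmeticFunction in
noncomputable abbrev cL {d : ℕ} (χ : DirichletCharacter ℂ d) : ℕ → ℂ := (fun n : ℕ => χ n) * (fun n : ℕ => (vonMangoldt n : ℂ))

lemma abscissa_cL {d : ℕ} (χ : DirichletCharacter ℂ d) {s : ℂ} (hs : 1 < s.re) :
    LSeries.abscissaOfAbsConv (cL χ) < s.re := by
  have : LSeries.abscissaOfAbsConv (cL χ) ≤ (1:ℝ) := by
    apply LSeries.abscissaOfAbsConv_le_of_forall_lt_LSeriesSummable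
    intro y hy
    exact DirichletCharacter.LSeriesSummable_twist_vonMangoldt χ (by simpa using hy)
  refine this.trans_lt ?_
  exact_mod_cast hs

lemma D_formula {d : ℕ} [NeZero d] (χ : DirichletCharacter ℂ d) {s : ℂ} (hs : 1 < s.re) :
    LSeries (LSeries.logMul (cL χ)) s = LSeries (LSeries.logMul^[2] (fun n => χ n)) s / LS χ s
      - (LSeries (LSeries.logMul^[1] (fun n => χ n)) s / LS χ s)^2 := by
  have hf := LSeries_hasDerivAt (abscissa_lt χ hs)
  have hg := LSeries_hasDerivAt (abscissa_cL χ hs)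
  have hf' : HasDerivAt (LSeries (LSeries.logMul (fun n => χ n))) (-LSeries (LSeries.logMul^[2] (fun n => χ n)) s) s := by
    apply LSeries_hasDerivAt
    rw [LSeries.abscissaOfAbsConv_logMul]
    exact abscissa_lt χ hs
  have key : ∀ z : ℂ, 1 < z.re → LSeries (cL χ) z * LS χ z = LSeries (LSeries.logMul (fun n => χ n)) z := by
    intro z hz
    rw [DirichletCharacter.LSeries_twist_vonMangoldt_eq χ hz, div_mul_cancel₀ _ (DirichletCharacter.LSeries_ne_zero_of_one_lt_re χ hz),
      LSeries_deriv (abscissa_lt χ hz), neg_neg]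
  have hev : (fun z => LSeries (cL χ) z * LS χ z) =ᶠ[𝓝 s] LSeries (LSeries.logMul (fun n => χ n)) := by
    have : {z : ℂ | 1 < z.re} ∈ 𝓝 s := (isOpen_lt continuous_const Complex.continuous_re).mem_nhds hs
    filter_upwards [this] with z hz using key z hz
  have e := (hg.mul hf).unique (hf'.congr_of_eventuallyEq hev)
  have h0 : LS χ s ≠ 0 := DirichletCharacter.LSeries_ne_zero_of_one_lt_re χ hs
  have k := key s hs
  have k2 : LSeries (cL χ) s = LSeries (LSeries.logMul (fun n => χ n)) s / LS χ s := by
    rw [eq_div_iff h0]; exact k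
  rw [k2] at e
  simp only [Function.iterate_one]
  field_simp
  field_simp at e
  linear_combination -e

lemma D_bd {d : ℕ} [NeZero d] {χ : DirichletCharacter ℂ d} (hχ : χ ≠ 1) {σ : ℝ} (h1 : 1 < σ) (h2 : σ ≤ 2)
    (hq : χ ^ 2 = 1 → σ - 1 ≤ 1 / (10^6 * (Real.log d + 1)^3 * d)) (t : ℝ) :
    ‖LSeries (LSeries.logMul (cL χ)) (σ + t * Complex.I)‖ ≤ 10^36 * Rr χ ^ 2 * ww d t ^ 32 := by
  have hs : 1 < (σ + t * Complex.I : ℂ).re := by simpa using h1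
  have hs2 : (σ + t * Complex.I : ℂ).re ≤ 2 := by simpa using h2
  rw [D_formula χ hs]
  have lo := LS_lower hχ h1 h2 hq t
  have a1 := L_bd hχ (j := 1) (by norm_num) hs hs2
  have a2 := L_bd hχ (j := 2) (by norm_num) hs hs2
  rw [← LSeries_logpow χ _ hs] at a1 a2
  have him : (σ + t * Complex.I : ℂ).im = t := by simp
  rw [him] at a1 a2
  have hw := ww_ge_two (d := d) NeZero.one_le t
  set w := ww d t with hwd
  have hR := Rr_ge_one χ
  set R := Rr χ
  have hw1 : 1 ≤ w := by linarith
  have q : ∀ z : ℂ, ‖z‖ ≤ 100 * w^3 → ‖z / LS χ (σ + t * Complex.I)‖ ≤ 4 * 10^17 * R * w^16 := by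
    intro z hz
    rw [norm_div]
    have hpos : 0 < 1 / (4 * 10 ^ 15 * R * w ^ 13) := by positivity
    calc _ ≤ (100 * w^3) / (1 / (4 * 10 ^ 15 * R * w ^ 13)) := by gcongr
      _ = _ := by rw [div_div_eq_mul_div]; ring
  refine (norm_sub_le _ _).trans ?_
  rw [norm_pow]
  have q1 := q _ a1
  have q2 := q _ a2
  have h16 : 1 ≤ R * w^16 := by
    have : 1 ≤ w^16 := one_le_pow₀ hw1
    nlinarith
  calc _ ≤ 4 * 10^17 * R * w^16 + (4 * 10^17 * R * w^16)^2 := by gcongr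
    _ = 4 * 10^17 * (R * w^16) + 16 * 10^34 * (R * w^16)^2 := by ring
    _ ≤ 10^36 * (R * w^16)^2 := by nlinarith
    _ = _ := by ring

end S11


namespace S11
open Finset MeasureTheory Filter Topology

open ArithmeticFunction in
noncomputable def wt (l : ℝ) (n : ℕ) : ℝ :=
  vonMangoldt n * Real.log n * (n:ℝ) ^ (-(1 + 1/l)) * Real.exp (-(Real.log n - l)^2/2)

lemma wt_nonneg (l : ℝ) (n : ℕ) : 0 ≤ wt l n := by
  unfold wt
  have := ArithmeticFunction.vonMangoldt_nonneg (n := n)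
  have := Real.log_natCast_nonneg n
  positivity

lemma term_norm {d : ℕ} (χ : DirichletCharacter ℂ d) (σ : ℝ) (t : ℝ) (n : ℕ) :
    ‖LSeries.term (LSeries.logMul (cL χ)) (σ + t * Complex.I) n‖ = ‖LSeries.term (LSeries.logMul (cL χ)) σ n‖ := by
  rw [LSeries.norm_term_eq, LSeries.norm_term_eq]; simp

lemma summable_term {d : ℕ} [NeZero d] (χ : DirichletCharacter ℂ d) {s : ℂ} (h : 1 < s.re) :
    Summable (LSeries.term (LSeries.logMul (cL χ)) s) := by
  apply LSeriesSummable_of_abscissaOfAbsConv_lt_re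
  rw [LSeries.abscissaOfAbsConv_logMul]
  exact abscissa_cL χ h

lemma term_int {d : ℕ} (χ : DirichletCharacter ℂ d) {l : ℝ} (n : ℕ) :
    ∫ t : ℝ, Complex.exp (-(1/2) * (t:ℂ)^2) * Complex.exp (Complex.I * l * t) *
      LSeries.term (LSeries.logMul (cL χ)) ((1 + 1/l : ℝ) + t * Complex.I) n = 
      (Real.pi / (1/2) : ℂ) ^ (1/2:ℂ) * (χ n * wt l n) := by
  rcases eq_or_ne n 0 with rfl | hn
  · simp [wt]
  have hn0 : (n:ℂ) ≠ 0 := by exact_mod_cast hn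
  have hn1 : (0:ℝ) < n := by positivity
  have e : ∀ t : ℝ, Complex.exp (-(1/2) * (t:ℂ)^2) * Complex.exp (Complex.I * l * t) *
      LSeries.term (LSeries.logMul (cL χ)) ((1 + 1/l : ℝ) + t * Complex.I) n = 
      (χ n * ((ArithmeticFunction.vonMangoldt n * Real.log n * (n:ℝ) ^ (-(1 + 1/l)) : ℝ) : ℂ)) *
       (Complex.exp (Complex.I * ((l - Real.log n : ℝ) : ℂ) * t) * Complex.exp (-(1/2) * (t:ℂ)^2)) := by
    intro t
    rw [LSeries.term_of_ne_zero hn, div_eq_mul_inv (LSeries.logMul (cL χ) n), ← Complex.cpow_neg, neg_add, Complex.cpow_add _ _ hn0]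
    have e1 : (n:ℂ) ^ (-(t * Complex.I)) = Complex.exp (-(Complex.I * Real.log n * t)) := by
      rw [Complex.cpow_def_of_ne_zero hn0, ← Complex.natCast_log]
      congr 1; ring
    have e2 : (n:ℂ) ^ (-((1 + 1/l : ℝ):ℂ)) = (((n:ℝ) ^ (-(1 + 1/l)) : ℝ) : ℂ) := by
      rw [Complex.ofReal_cpow hn1.le]; push_cast; rfl
    have e3 : Complex.exp (Complex.I * ((l - Real.log n : ℝ) : ℂ) * t) = Complex.exp (Complex.I * l * t) * Complex.exp (-(Complex.I * Real.log n * t)) := by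
      rw [← Complex.exp_add]; congr 1; push_cast; ring
    rw [e1, e2, e3]
    simp only [LSeries.logMul, Pi.mul_apply, ← Complex.natCast_log]
    push_cast
    ring
  simp_rw [e]
  rw [integral_const_mul]
  rw [fourierIntegral_gaussian (by norm_num)]
  unfold wt
  push_cast
  have : Complex.exp (-((l:ℂ) - Complex.log n)^2 / (4 * (1/2))) = Complex.exp (-(Complex.log n - l)^2/2) := by
    congr 1; ring
  rw [this]
  ring

lemma exp_pow_bd (t : ℝ) : Real.exp (-(1/2) * t^2) * (|t| + 2)^32 ≤ (Nat.factorial 32 * Real.exp 3) * Real.exp (-(1/4) * t^2) := by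
  have h1 := Real.pow_div_factorial_le_exp (|t| + 2) (by positivity) 32
  rw [div_le_iff₀ (by positivity)] at h1
  calc _ ≤ Real.exp (-(1/2) * t^2) * (Real.exp (|t| + 2) * Nat.factorial 32) := by gcongr
    _ = Nat.factorial 32 * (Real.exp (-(1/2) * t^2 + (|t| + 2))) := by rw [Real.exp_add (-(1/2) * t^2)]; ring
    _ ≤ Nat.factorial 32 * (Real.exp (3 + -(1/4) * t^2)) := by
      apply mul_le_mul_of_nonneg_left _ (by positivity)
      apply Real.exp_le_exp.mpr
      nlinarith [sq_nonneg (|t| - 2), sq_abs t]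
    _ = _ := by rw [Real.exp_add]; ring

noncomputable def CT : ℝ := ∫ t : ℝ, 10^36 * ((Nat.factorial 32 * Real.exp 3) * Real.exp (-(1/4) * t^2))

lemma T_bd {d : ℕ} [NeZero d] {χ : DirichletCharacter ℂ d} (hχ : χ ≠ 1) {l : ℝ} (hl : 1 ≤ l)
    (hq : χ ^ 2 = 1 → 1/l ≤ 1 / (10^6 * (Real.log d + 1)^3 * d)) :
    ‖∑' n : ℕ, χ n * (wt l n : ℂ)‖ ≤ CT * Rr χ ^ 2 * (Real.log d + 1)^32 := by
  have hl0 : 0 < 1/l := by positivity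
  have hl1 : 1/l ≤ 1 := by rw [div_le_one (by linarith)]; exact hl
  set σ : ℝ := 1 + 1/l with hσ
  have h1 : 1 < σ := by linarith
  have h2 : σ ≤ 2 := by linarith
  set F : ℕ → ℝ → ℂ := fun n t => Complex.exp (-(1/2) * (t:ℂ)^2) * Complex.exp (Complex.I * l * t) *
      LSeries.term (LSeries.logMul (cL χ)) (σ + t * Complex.I) n with hF
  have nG : ∀ t : ℝ, ‖Complex.exp (-(1/2) * (t:ℂ)^2) * Complex.exp (Complex.I * l * t)‖ = Real.exp (-(1/2) * t^2) := by
    intro t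
    rw [norm_mul, Complex.norm_exp, Complex.norm_exp]
    have : (-(1/2) * (t:ℂ)^2).re = -(1/2) * t^2 := by
      have : (-(1/2) * (t:ℂ)^2) = ((-(1/2) * t^2 : ℝ) : ℂ) := by push_cast; ring
      rw [this, Complex.ofReal_re]
    rw [this]
    simp
  have nF : ∀ n t, ‖F n t‖ = Real.exp (-(1/2) * t^2) * ‖LSeries.term (LSeries.logMul (cL χ)) σ n‖ := by
    intro n t
    rw [hF]; simp only
    rw [norm_mul, nG, term_norm]
  have iG : Integrable (fun t : ℝ => Real.exp (-(1/2) * t^2)) := integrable_exp_neg_mul_sq (by norm_num)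
  have cF : ∀ n, Continuous (F n) := by
    intro n
    rw [hF]; simp only
    refine Continuous.mul (by fun_prop) ?_
    rcases eq_or_ne n 0 with rfl | hn
    · simp; exact continuous_const
    · simp_rw [LSeries.term_of_ne_zero hn]
      refine continuous_const.div ?_ ?_
      · refine Continuous.const_cpow (by fun_prop) (Or.inl (by exact_mod_cast hn))
      · intro t
        exact (Complex.cpow_ne_zero_iff_of_exponent_ne_zero (by
          intro h; have := congrArg Complex.re h; simp at this; linarith)).mpr (by exact_mod_cast hn)
  have iF : ∀ n, Integrable (F n) := by
    intro n
    refine (iG.mul_const ‖LSeries.term (LSeries.logMul (cL χ)) σ n‖).mono' (cF n).aestronglyMeasurable ?_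
    exact Eventually.of_forall fun t => (nF n t).le
  have sF : Summable fun n => ∫ t, ‖F n t‖ := by
    simp_rw [nF, integral_mul_const]
    exact ((summable_term χ (s := σ) (by simpa using h1)).norm).mul_left _
  have hs := hasSum_integral_of_summable_integral_norm iF sF
  have e := hs.tsum_eq
  simp_rw [hF] at e
  rw [hσ] at e
  simp_rw [term_int] at e
  rw [tsum_mul_left] at e
  rw [← hσ] at e
  have nb : ‖(Real.pi / (1/2) : ℂ) ^ (1/2:ℂ)‖ ≥ 1 := by
    have : (Real.pi / (1/2) : ℂ) = ((Real.pi / (1/2) : ℝ) : ℂ) := by push_cast; ring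
    rw [this, Complex.norm_cpow_eq_rpow_re_of_pos (by positivity)]
    apply Real.one_le_rpow
    · have := Real.pi_gt_three; rw [le_div_iff₀ (by norm_num)]; linarith
    · simp
  have step : ‖∑' n : ℕ, χ n * (wt l n : ℂ)‖ ≤ ‖∫ (a : ℝ), ∑' (i : ℕ), F i a‖ := by
    rw [hF, ← e, norm_mul]
    nlinarith [norm_nonneg (∑' n : ℕ, χ n * (wt l n : ℂ))]
  refine step.trans ?_
  have fin : ‖∫ (a : ℝ), ∑' (i : ℕ), F i a‖ ≤ ∫ t : ℝ, Rr χ ^ 2 * (Real.log d + 1)^32 * (10^36 * ((Nat.factorial 32 * Real.exp 3) * Real.exp (-(1/4) * t^2))) := by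
    refine norm_integral_le_of_norm_le ?_ (Eventually.of_forall fun t => ?_)
    · exact (((integrable_exp_neg_mul_sq (by norm_num)).const_mul _).const_mul _).const_mul _
    · rw [hF]; simp only
      rw [tsum_mul_left, norm_mul, nG]
      have := D_bd hχ h1 h2 (by intro h; have := hq h; linarith) t
      unfold LSeries at this
      refine (mul_le_mul_of_nonneg_left this (Real.exp_nonneg _)).trans ?_
      unfold ww
      rw [mul_pow]
      have b := exp_pow_bd t
      calc _ = Rr χ ^ 2 * (Real.log d + 1)^32 * (10^36 * (Real.exp (-(1/2) * t^2) * (|t| + 2)^32)) := by ring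
        _ ≤ _ := by
          have : 0 ≤ Real.log d := Real.log_natCast_nonneg d
          gcongr
  refine fin.trans (le_of_eq ?_)
  rw [integral_const_mul, CT]
  ring

lemma CT_nonneg : 0 ≤ CT := integral_nonneg fun t => by positivity

end S11


namespace S11
open Finset MeasureTheory Filter Topology
open ArithmeticFunction (vonMangoldt)

lemma abel_ineq (a b h : ℕ → ℝ) (hab : ∀ N, ∑ n ∈ Icc 1 N, a n ≤ ∑ n ∈ Icc 1 N, b n)
    (h0 : ∀ n, 1 ≤ n → 0 ≤ h n) (ha : ∀ n, 1 ≤ n → h (n+1) ≤ h n) (N : ℕ) :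
    ∑ n ∈ Icc 1 N, a n * h n ≤ ∑ n ∈ Icc 1 N, b n * h n := by
  have key : ∀ N, 1 ≤ N → h N * (∑ n ∈ Icc 1 N, (b n - a n)) ≤ ∑ n ∈ Icc 1 N, (b n - a n) * h n := by
    intro N hN
    induction N, hN using Nat.le_induction with
    | base => simp [mul_comm]
    | succ N hN ih =>
      rw [Finset.sum_Icc_succ_top (by omega), Finset.sum_Icc_succ_top (by omega)]
      have c0 : 0 ≤ ∑ n ∈ Icc 1 N, (b n - a n) := by
        rw [Finset.sum_sub_distrib]; linarith [hab N]
      have := mul_le_mul_of_nonneg_right (ha N hN) c0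
      linarith
  rcases Nat.eq_zero_or_pos N with rfl | hN
  · simp
  have := key N hN
  have c0 : 0 ≤ ∑ n ∈ Icc 1 N, (b n - a n) := by
    rw [Finset.sum_sub_distrib]; linarith [hab N]
  have := mul_nonneg (h0 N hN) c0
  have e : ∑ n ∈ Icc 1 N, (b n - a n) * h n = ∑ n ∈ Icc 1 N, b n * h n - ∑ n ∈ Icc 1 N, a n * h n := by
    rw [← Finset.sum_sub_distrib]; exact Finset.sum_congr rfl fun _ _ => by ring
  linarith

lemma log4_le : Real.log 4 + 4 ≤ 6 := by
  have : Real.log 4 = 2 * Real.log 2 := by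
    rw [show (4:ℝ) = 2^2 by norm_num, Real.log_pow]; norm_num
  have := Real.log_two_lt_d9
  linarith

lemma psi_le6 (N : ℕ) : ∑ n ∈ Icc 1 N, vonMangoldt n ≤ 6 * N := by
  have h := Chebyshev.psi_le_const_mul_self (x := N) (by positivity)
  unfold Chebyshev.psi at h
  rw [Nat.floor_natCast] at h
  have := mul_le_mul_of_nonneg_right log4_le (show (0:ℝ) ≤ N by positivity)
  exact h.trans this

lemma sum_vM_le (h : ℕ → ℝ) 
    (h0 : ∀ n, 1 ≤ n → 0 ≤ h n) (ha : ∀ n, 1 ≤ n → h (n+1) ≤ h n) (N : ℕ) :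
    ∑ n ∈ Icc 1 N, vonMangoldt n * h n ≤ 6 * ∑ n ∈ Icc 1 N, h n := by
  have := abel_ineq (fun n => vonMangoldt n) (fun _ => 6) h (fun N => by
    simp only [Finset.sum_const, Nat.card_Icc]
    have := psi_le6 N
    simp; linarith) h0 ha N
  rw [Finset.mul_sum]; exact this

lemma sum_inv_sqrt (M N : ℕ) : ∑ n ∈ Ioc M N, 1 / ((n:ℝ) * √n) ≤ 4 / √((M+1:ℕ):ℝ) := by
  rcases le_total M N with h | h
  · have : ∑ n ∈ Ioc M N, 1 / ((n:ℝ) * √n) ≤ 4 * (1 / √((M+1:ℕ):ℝ) - 1 / √((N+1:ℕ):ℝ)) := by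
      induction N, h using Nat.le_induction with
      | base => simp
      | succ N h ih =>
        rw [Finset.sum_Ioc_succ_top (by omega)]
        have := inv_pow_le_tel (n := N+1) (by omega)
        linarith
    refine this.trans ?_
    have : 0 ≤ 1 / √((N+1:ℕ):ℝ) := by positivity
    have e : 4 / √((M+1:ℕ):ℝ) = 4 * (1 / √((M+1:ℕ):ℝ)) := by ring
    linarith
  · rw [Finset.Ioc_eq_empty (by omega)]; simp; positivity

noncomputable def hh (l : ℝ) (n : ℕ) : ℝ := (l+2) * min (Real.exp (-l)) (Real.exp (l/2) * (1 / ((n:ℝ) * √n)))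

lemma hh_sum {l : ℝ} (hl : 0 ≤ l) (N : ℕ) : ∑ n ∈ Icc 1 N, hh l n ≤ 5 * (l+2) := by
  set M := ⌊Real.exp l⌋₊
  have hM : (M:ℝ) ≤ Real.exp l := Nat.floor_le (Real.exp_nonneg _)
  have hM2 : Real.exp l < ((M+1:ℕ):ℝ) := by push_cast; exact Nat.lt_floor_add_one _
  unfold hh
  rw [← Finset.mul_sum, mul_comm]
  refine mul_le_mul_of_nonneg_right ?_ (by linarith)
  have sub : Icc 1 N ⊆ Icc 1 M ∪ Ioc M N := by
    intro n hn; simp at hn ⊢; omega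
  have nn : ∀ n : ℕ, 0 ≤ min (Real.exp (-l)) (Real.exp (l/2) * (1 / ((n:ℝ) * √n))) := fun n => le_min (by positivity) (by positivity)
  calc _ ≤ ∑ n ∈ Icc 1 M ∪ Ioc M N, min (Real.exp (-l)) (Real.exp (l/2) * (1 / ((n:ℝ) * √n))) :=
        Finset.sum_le_sum_of_subset_of_nonneg sub (fun n _ _ => nn n)
    _ ≤ ∑ n ∈ Icc 1 M, min (Real.exp (-l)) (Real.exp (l/2) * (1 / ((n:ℝ) * √n))) + ∑ n ∈ Ioc M N, min (Real.exp (-l)) (Real.exp (l/2) * (1 / ((n:ℝ) * √n))) := by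
        rw [← Finset.sum_union_inter]
        have := Finset.sum_nonneg (s := Icc 1 M ∩ Ioc M N) (fun n _ => nn n)
        linarith
    _ ≤ ∑ n ∈ Icc 1 M, Real.exp (-l) + ∑ n ∈ Ioc M N, Real.exp (l/2) * (1 / ((n:ℝ) * √n)) := by
        gcongr
        · exact min_le_left _ _
        · exact min_le_right _ _
    _ ≤ 1 + 4 := by
        gcongr
        · simp
          calc M * Real.exp (-l) ≤ Real.exp l * Real.exp (-l) := by gcongr
            _ = 1 := by rw [← Real.exp_add]; simp
        · rw [← Finset.mul_sum]
          have := sum_inv_sqrt M N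
          have e : Real.exp (l/2) = √(Real.exp l) := by
            rw [Real.exp_half]
          have h2 : √(Real.exp l) ≤ √((M+1:ℕ):ℝ) := Real.sqrt_le_sqrt hM2.le
          have h3 : 0 < √(Real.exp l) := Real.sqrt_pos.mpr (Real.exp_pos _)
          rw [e]
          calc _ ≤ √(Real.exp l) * (4 / √((M+1:ℕ):ℝ)) := by gcongr
            _ ≤ √(Real.exp l) * (4 / √(Real.exp l)) := by gcongr
            _ = 4 := by field_simp
    _ = 5 := by norm_num

lemma hh_pt {l : ℝ} (hl : 0 ≤ l) {n : ℕ} (hn : 1 ≤ n) :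
    Real.log n / n * Real.exp (-|Real.log n - l|) ≤ hh l n := by
  have hn0 : (0:ℝ) < n := by exact_mod_cast hn
  set u := Real.log n with hu
  have hu0 : 0 ≤ u := Real.log_natCast_nonneg n
  have e1 : (n:ℝ) = Real.exp u := (Real.exp_log hn0).symm
  have e2 : 1 / ((n:ℝ) * √n) = Real.exp (-(3/2) * u) := by
    rw [e1, ← Real.exp_half, ← Real.exp_add, one_div, ← Real.exp_neg]; congr 1; ring
  unfold hh
  rw [e2, ← Real.exp_add]
  have e3 : u / n * Real.exp (-|u - l|) = u * Real.exp (-u - |u - l|) := by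
    rw [e1, div_eq_mul_inv, ← Real.exp_neg, mul_assoc, ← Real.exp_add]; congr 1
  rw [e3]
  rcases le_total u l with h | h
  · rw [abs_of_nonpos (by linarith), min_eq_left (Real.exp_le_exp.mpr (by linarith))]
    have : -u - -(u - l) = -l := by ring
    rw [this]
    gcongr; linarith
  · rw [abs_of_nonneg (by linarith), min_eq_right (Real.exp_le_exp.mpr (by linarith))]
    have e4 : Real.exp (l/2 + -(3/2)*u) = Real.exp (-u - (u - l)) * Real.exp ((u-l)/2) := by
      rw [← Real.exp_add]; congr 1; ring
    rw [e4]
    have := Real.add_one_le_exp ((u-l)/2)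
    have h5 : u ≤ (l+2) * Real.exp ((u-l)/2) := by nlinarith
    nlinarith [Real.exp_pos (-u - (u - l))]

lemma hh_nonneg {l : ℝ} (hl : 0 ≤ l) (n : ℕ) : 0 ≤ hh l n :=
  mul_nonneg (by linarith) (le_min (by positivity) (by positivity))

lemma vexp_sum {l : ℝ} (hl : 0 ≤ l) (N : ℕ) :
    ∑ n ∈ Icc 1 N, vonMangoldt n * (Real.log n / n * Real.exp (-|Real.log n - l|)) ≤ 30 * (l+2) := by
  calc _ ≤ ∑ n ∈ Icc 1 N, vonMangoldt n * hh l n := by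
        refine Finset.sum_le_sum fun n hn => ?_
        exact mul_le_mul_of_nonneg_left (hh_pt hl (Finset.mem_Icc.mp hn).1) ArithmeticFunction.vonMangoldt_nonneg
    _ ≤ 6 * ∑ n ∈ Icc 1 N, hh l n := by
        refine sum_vM_le _ (fun n _ => hh_nonneg hl n) (fun n hn => ?_) N
        unfold hh
        have : (0:ℝ) < n := by exact_mod_cast hn
        refine mul_le_mul_of_nonneg_left ?_ (by linarith)
        gcongr <;> simp
    _ ≤ 6 * (5 * (l+2)) := by gcongr; exact hh_sum hl N
    _ = _ := by ring

lemma wt_le {l : ℝ} (hl : 0 < l) {n : ℕ} (hn : 1 ≤ n) {B : ℝ} (hB : 0 ≤ B) (hu : B ≤ |Real.log n - l|) :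
    wt l n ≤ 3 * Real.exp (-B^2/4) * (vonMangoldt n * (Real.log n / n * Real.exp (-|Real.log n - l|))) := by
  have hn0 : (1:ℝ) ≤ n := by exact_mod_cast hn
  have hL := Real.log_natCast_nonneg n
  have hv := ArithmeticFunction.vonMangoldt_nonneg (n := n)
  unfold wt
  set u := Real.log n - l with hu'
  have g : Real.exp (-u^2/2) ≤ 3 * Real.exp (-B^2/4) * Real.exp (-|u|) := by
    have e : (3:ℝ) ≥ Real.exp 1 := by have := Real.exp_one_lt_d9; linarith
    calc Real.exp (-u^2/2) ≤ Real.exp (1 + -B^2/4 + -|u|) := by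
          apply Real.exp_le_exp.mpr
          have : B^2 ≤ |u|^2 := by gcongr
          have h2 : |u|^2 = u^2 := sq_abs u
          nlinarith [sq_nonneg (|u| - 2)]
      _ = Real.exp 1 * Real.exp (-B^2/4) * Real.exp (-|u|) := by rw [Real.exp_add, Real.exp_add]
      _ ≤ _ := by gcongr
  have p : (n:ℝ) ^ (-(1 + 1/l)) ≤ 1 / n := by
    have e : (1:ℝ)/n = (n:ℝ)^(-1:ℝ) := by rw [Real.rpow_neg_one, one_div]
    rw [e]
    apply Real.rpow_le_rpow_of_exponent_le hn0
    have : 0 < 1/l := by positivity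
    linarith
  calc _ ≤ vonMangoldt n * Real.log n * (1/n) * (3 * Real.exp (-B^2/4) * Real.exp (-|u|)) := by gcongr
    _ = _ := by ring

lemma summable_wt {l : ℝ} (hl : 0 < l) : Summable (wt l) := by
  refine summable_of_sum_range_le (c := 3 * (30 * (l+2))) (wt_nonneg l) fun N => ?_
  have : ∑ n ∈ range N, wt l n ≤ ∑ n ∈ Icc 1 N, wt l n := by
    have z : wt l 0 = 0 := by simp [wt]
    rw [← Finset.sum_filter_of_ne (p := fun n => n ≠ 0)]
    · refine Finset.sum_le_sum_of_subset_of_nonneg ?_ (fun n _ _ => wt_nonneg l n)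
      intro n hn; simp at hn ⊢; omega
    · intro n _ h h0; exact h (h0 ▸ z)
  refine this.trans ?_
  calc _ ≤ ∑ n ∈ Icc 1 N, 3 * (vonMangoldt n * (Real.log n / n * Real.exp (-|Real.log n - l|))) := by
        refine Finset.sum_le_sum fun n hn => ?_
        have := wt_le hl (Finset.mem_Icc.mp hn).1 le_rfl (abs_nonneg _)
        simpa using this
    _ ≤ _ := by rw [← Finset.mul_sum]; gcongr; exact vexp_sum hl.le N

lemma window {a : ℕ → ℝ} (ha0 : ∀ n, 0 ≤ a n) (ha1 : ∀ n, a n ≤ 1) {l B : ℝ} (hl : 1 ≤ l) (hB : 0 ≤ B) (hBl : B ≤ l) :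
    ∑' n, a n * wt l n ≤ 4 * l^2 * (∑ p ∈ (Icc 1 ⌊Real.exp (l+B)⌋₊).filter (fun p : ℕ => p.Prime ∧ |Real.log p - l| ≤ B), a p / (p:ℝ)) +
      90 * Real.exp (-B^2/4) * (l+2) + 8 * l^2 * Real.exp (-l/2 + 3*B/2) := by
  have hl0 : 0 < l := by linarith
  refine Real.tsum_le_of_sum_range_le (fun n => mul_nonneg (ha0 n) (wt_nonneg l n)) fun N => ?_
  have s0 : ∑ n ∈ range N, a n * wt l n ≤ ∑ n ∈ Icc 1 N, a n * wt l n := by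
    have z : wt l 0 = 0 := by simp [wt]
    rw [← Finset.sum_filter_of_ne (p := fun n => n ≠ 0)]
    · refine Finset.sum_le_sum_of_subset_of_nonneg ?_ (fun n _ _ => mul_nonneg (ha0 n) (wt_nonneg l n))
      intro n hn; simp at hn ⊢; omega
    · intro n _ h h0; exact h (by rw [h0, z, mul_zero])
  refine s0.trans ?_
  rw [← Finset.sum_filter_add_sum_filter_not (Icc 1 N) (fun n : ℕ => |Real.log n - l| ≤ B),
    ← Finset.sum_filter_add_sum_filter_not ((Icc 1 N).filter (fun n : ℕ => |Real.log n - l| ≤ B)) (fun n : ℕ => n.Prime)]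
  have wb : ∀ n : ℕ, 1 ≤ n → |Real.log n - l| ≤ B → (n:ℝ) ≤ Real.exp (l+B) ∧ Real.log n ≤ 2 * l ∧ Real.exp (l-B) ≤ n := by
    intro n hn h
    have hn0 : (0:ℝ) < n := by exact_mod_cast hn
    have := abs_le.mp h
    refine ⟨?_, by linarith, ?_⟩
    · rw [← Real.log_le_iff_le_exp hn0]; linarith
    · rw [← Real.le_log_iff_exp_le hn0]; linarith
  have wl : ∀ n : ℕ, 1 ≤ n → |Real.log n - l| ≤ B → wt l n ≤ vonMangoldt n * (2*l) * (1/n) := by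
    intro n hn h
    have hn0 : (1:ℝ) ≤ n := by exact_mod_cast hn
    have hv := ArithmeticFunction.vonMangoldt_nonneg (n := n)
    have p : (n:ℝ) ^ (-(1 + 1/l)) ≤ 1 / n := by
      have e : (1:ℝ)/n = (n:ℝ)^(-1:ℝ) := by rw [Real.rpow_neg_one, one_div]
      rw [e]
      apply Real.rpow_le_rpow_of_exponent_le hn0
      have : 0 < 1/l := by positivity
      linarith
    have g : Real.exp (-(Real.log n - l)^2/2) ≤ 1 := by
      rw [Real.exp_le_one_iff]; nlinarith [sq_nonneg (Real.log n - l)]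
    have := (wb n hn h).2.1
    have hL := Real.log_natCast_nonneg n
    unfold wt
    calc _ ≤ vonMangoldt n * (2*l) * (1/n) * 1 := by gcongr
      _ = _ := mul_one _
  have mem : ∀ n : ℕ, 1 ≤ n → |Real.log n - l| ≤ B → n ≤ ⌊Real.exp (l+B)⌋₊ := fun n hn h =>
    Nat.le_floor (wb n hn h).1
  have p1 : ∑ n ∈ ((Icc 1 N).filter (fun n : ℕ => |Real.log n - l| ≤ B)).filter (fun n : ℕ => n.Prime), a n * wt l n ≤ 
      4 * l^2 * (∑ p ∈ (Icc 1 ⌊Real.exp (l+B)⌋₊).filter (fun p : ℕ => p.Prime ∧ |Real.log p - l| ≤ B), a p / (p:ℝ)) := by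
    rw [Finset.mul_sum]
    calc _ ≤ ∑ n ∈ ((Icc 1 N).filter (fun n : ℕ => |Real.log n - l| ≤ B)).filter (fun n : ℕ => n.Prime), 4 * l^2 * (a n / n) := by
          refine Finset.sum_le_sum fun n hn => ?_
          simp only [Finset.mem_filter, Finset.mem_Icc] at hn
          have h1 := wl n hn.1.1.1 hn.1.2
          rw [ArithmeticFunction.vonMangoldt_apply_prime hn.2] at h1
          have h2 := (wb n hn.1.1.1 hn.1.2).2.1
          have h0 := ha0 n
          calc a n * wt l n ≤ a n * ((2*l) * (2*l) * (1/n)) := by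
                apply mul_le_mul_of_nonneg_left _ h0
                refine h1.trans ?_
                gcongr
            _ = _ := by ring
      _ ≤ _ := by
          refine Finset.sum_le_sum_of_subset_of_nonneg ?_ (fun n _ _ => by have := ha0 n; positivity)
          intro n hn
          simp only [Finset.mem_filter, Finset.mem_Icc] at hn ⊢
          exact ⟨⟨hn.1.1.1, mem n hn.1.1.1 hn.1.2⟩, hn.2, hn.1.2⟩
  have p2 : ∑ n ∈ ((Icc 1 N).filter (fun n : ℕ => |Real.log n - l| ≤ B)).filter (fun n : ℕ => ¬ n.Prime), a n * wt l n ≤ 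
      8 * l^2 * Real.exp (-l/2 + 3*B/2) := by
    calc _ ≤ ∑ n ∈ ((Icc 1 N).filter (fun n : ℕ => |Real.log n - l| ≤ B)).filter (fun n : ℕ => ¬ n.Prime), 
            vonMangoldt n * (2 * l * Real.exp (-(l-B))) := by
          refine Finset.sum_le_sum fun n hn => ?_
          simp only [Finset.mem_filter, Finset.mem_Icc] at hn
          have h1 := wl n hn.1.1.1 hn.1.2
          have h2 := (wb n hn.1.1.1 hn.1.2).2.2
          have hv := ArithmeticFunction.vonMangoldt_nonneg (n := n)
          calc a n * wt l n ≤ 1 * wt l n := by gcongr; exacts [wt_nonneg _ _, ha1 n]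
            _ ≤ vonMangoldt n * (2*l) * (1/n) := by rw [one_mul]; exact h1
            _ ≤ vonMangoldt n * (2*l) * (1/Real.exp (l-B)) := by gcongr
            _ = _ := by rw [Real.exp_neg]; ring
      _ ≤ ∑ n ∈ (Ioc 0 ⌊Real.exp (l+B)⌋₊).filter (fun n : ℕ => ¬ n.Prime), vonMangoldt n * (2 * l * Real.exp (-(l-B))) := by
          refine Finset.sum_le_sum_of_subset_of_nonneg ?_ (fun n _ _ => by 
            have := ArithmeticFunction.vonMangoldt_nonneg (n := n); positivity)
          intro n hn
          simp only [Finset.mem_filter, Finset.mem_Icc, Finset.mem_Ioc] at hn ⊢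
          exact ⟨⟨hn.1.1.1, mem n hn.1.1.1 hn.1.2⟩, hn.2⟩
      _ = (Chebyshev.psi (Real.exp (l+B)) - Chebyshev.theta (Real.exp (l+B))) * (2 * l * Real.exp (-(l-B))) := by
          rw [← Finset.sum_mul, Chebyshev.psi_sub_theta_eq_sum_not_prime]
      _ ≤ (2 * √(Real.exp (l+B)) * (l+B)) * (2 * l * Real.exp (-(l-B))) := by
          gcongr
          have := Chebyshev.abs_psi_sub_theta_le_sqrt_mul_log (x := Real.exp (l+B)) (Real.one_le_exp (by linarith))
          rw [Real.log_exp] at this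
          exact (le_abs_self _).trans this
      _ ≤ (2 * √(Real.exp (l+B)) * (2*l)) * (2 * l * Real.exp (-(l-B))) := by
          gcongr; linarith
      _ = 8 * l^2 * (Real.exp ((l+B)/2) * Real.exp (-(l-B))) := by rw [Real.exp_half]; ring
      _ = _ := by rw [← Real.exp_add]; congr 2; ring
  have p3 : ∑ n ∈ (Icc 1 N).filter (fun n : ℕ => ¬ |Real.log n - l| ≤ B), a n * wt l n ≤ 90 * Real.exp (-B^2/4) * (l+2) := by
    calc _ ≤ ∑ n ∈ (Icc 1 N).filter (fun n : ℕ => ¬ |Real.log n - l| ≤ B), 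
            3 * Real.exp (-B^2/4) * (vonMangoldt n * (Real.log n / n * Real.exp (-|Real.log n - l|))) := by
          refine Finset.sum_le_sum fun n hn => ?_
          simp only [Finset.mem_filter, Finset.mem_Icc, not_le] at hn
          calc a n * wt l n ≤ 1 * wt l n := by gcongr; exacts [wt_nonneg _ _, ha1 n]
            _ ≤ _ := by rw [one_mul]; exact wt_le hl0 hn.1.1 hB hn.2.le
      _ ≤ ∑ n ∈ Icc 1 N, 3 * Real.exp (-B^2/4) * (vonMangoldt n * (Real.log n / n * Real.exp (-|Real.log n - l|))) := by
          refine Finset.sum_le_sum_of_subset_of_nonneg (Finset.filter_subset _ _) (fun n _ _ => ?_)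
          have := ArithmeticFunction.vonMangoldt_nonneg (n := n)
          have := Real.log_natCast_nonneg n
          positivity
      _ ≤ 3 * Real.exp (-B^2/4) * (30 * (l+2)) := by
          rw [← Finset.mul_sum]; gcongr; exact vexp_sum hl0.le N
      _ = _ := by ring
  linarith

lemma T0_upper {l : ℝ} (hl : 1 ≤ l) : ∑' n, wt l n ≤ 90 * (l+2) := by
  have hl0 : 0 < l := by linarith
  refine Real.tsum_le_of_sum_range_le (wt_nonneg l) fun N => ?_
  have : ∑ n ∈ range N, wt l n ≤ ∑ n ∈ Icc 1 N, wt l n := by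
    have z : wt l 0 = 0 := by simp [wt]
    rw [← Finset.sum_filter_of_ne (p := fun n => n ≠ 0)]
    · refine Finset.sum_le_sum_of_subset_of_nonneg ?_ (fun n _ _ => wt_nonneg l n)
      intro n hn; simp at hn ⊢; omega
    · intro n _ h h0; exact h (h0 ▸ z)
  refine this.trans ?_
  calc _ ≤ ∑ n ∈ Icc 1 N, 3 * (vonMangoldt n * (Real.log n / n * Real.exp (-|Real.log n - l|))) := by
        refine Finset.sum_le_sum fun n hn => ?_
        have := wt_le hl0 (Finset.mem_Icc.mp hn).1 le_rfl (abs_nonneg _)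
        simpa using this
    _ ≤ 3 * (30 * (l+2)) := by rw [← Finset.mul_sum]; gcongr; exact vexp_sum hl0.le N
    _ = _ := by ring

lemma T0_lower {l : ℝ} (hl : 10 ≤ l) : Real.exp (-6) / 20 * l ≤ ∑' n, wt l n := by
  have hl0 : 0 < l := by linarith
  set X := Real.exp l with hX
  have hX0 : 0 < X := Real.exp_pos l
  have hX1 : 1000 ≤ X := by
    have e1 : (1000:ℝ) ≤ 2.7 ^ 10 := by norm_num
    have e2 : (2.7:ℝ) ^ 10 ≤ Real.exp 1 ^ 10 := by gcongr; have := Real.exp_one_gt_d9; linarith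
    have e3 : Real.exp 1 ^ 10 = Real.exp 10 := by rw [← Real.exp_nat_mul]; norm_num
    have e4 : Real.exp 10 ≤ X := Real.exp_le_exp.mpr hl
    linarith
  have lo := Chebyshev.psi_ge' hX0.le
  have up := Chebyshev.psi_le_const_mul_self (x := X/16) (by positivity)
  have l4 := log4_le
  have l2 := Real.log_two_gt_d9
  have lX : Real.log (X + 2) ≤ X/10 := by
    have h := Real.log_le_sub_one_of_pos (x := (X+2)/20) (by positivity)
    rw [Real.log_div (by positivity) (by norm_num)] at h
    have : Real.log 20 ≤ 4 := by
      have : Real.log 20 ≤ Real.log (2^5) := Real.log_le_log (by norm_num) (by norm_num)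
      rw [Real.log_pow] at this
      have := Real.log_two_lt_d9
      push_cast at *
      linarith
    linarith
  have diff : X / 5 ≤ Chebyshev.psi X - Chebyshev.psi (X/16) := by
    have : (Real.log 4 + 4) * (X/16) ≤ 6 * (X/16) := by gcongr
    nlinarith
  have e : Chebyshev.psi X - Chebyshev.psi (X/16) = ∑ n ∈ Ioc ⌊X/16⌋₊ ⌊X⌋₊, vonMangoldt n := by
    unfold Chebyshev.psi
    rw [sub_eq_iff_eq_add, add_comm, Finset.sum_Ioc_consecutive _ (Nat.zero_le _)]
    apply Nat.floor_mono; linarith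
  have log16 : Real.log 16 ≤ 3 := by
    rw [show (16:ℝ) = 2^4 by norm_num, Real.log_pow]
    have := Real.log_two_lt_d9
    push_cast; linarith
  calc Real.exp (-6) / 20 * l ≤ (X/5) * (l/2 * (Real.exp (-(l+1)) * Real.exp (-9/2))) := by
        have e5 : (X/5) * (l/2 * (Real.exp (-(l+1)) * Real.exp (-9/2))) = l / 10 * (Real.exp l * (Real.exp (-(l+1)) * Real.exp (-9/2))) := by
          rw [hX]; ring
        rw [e5, ← Real.exp_add, ← Real.exp_add]
        have : Real.exp (-6) ≤ Real.exp (l + (-(l + 1) + -9 / 2)) := Real.exp_le_exp.mpr (by linarith)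
        nlinarith [Real.exp_pos (-6)]
    _ ≤ (∑ n ∈ Ioc ⌊X/16⌋₊ ⌊X⌋₊, vonMangoldt n) * (l/2 * (Real.exp (-(l+1)) * Real.exp (-9/2))) := by
        rw [← e]; gcongr
    _ ≤ ∑ n ∈ Ioc ⌊X/16⌋₊ ⌊X⌋₊, wt l n := by
        rw [Finset.sum_mul]
        refine Finset.sum_le_sum fun n hn => ?_
        have hn' := Finset.mem_Ioc.mp hn
        have n1 : X/16 < n := (Nat.floor_lt (by positivity)).mp hn'.1
        have n2 : (n:ℝ) ≤ X := (Nat.le_floor_iff hX0.le).mp hn'.2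
        have n0 : (0:ℝ) < n := by linarith
        have lg1 : l - 3 ≤ Real.log n := by
          have : Real.log (X/16) ≤ Real.log n := Real.log_le_log (by positivity) n1.le
          rw [Real.log_div hX0.ne' (by norm_num), hX, Real.log_exp] at this
          linarith
        have lg2 : Real.log n ≤ l := by
          have : Real.log n ≤ Real.log X := Real.log_le_log n0 n2
          rwa [hX, Real.log_exp] at this
        have hv := ArithmeticFunction.vonMangoldt_nonneg (n := n)
        unfold wt
        rw [mul_assoc, mul_assoc]
        apply mul_le_mul_of_nonneg_left _ hv
        have q1 : l/2 ≤ Real.log n := by linarith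
        have q2 : Real.exp (-(l+1)) ≤ (n:ℝ) ^ (-(1 + 1/l)) := by
          rw [Real.rpow_def_of_pos n0]
          apply Real.exp_le_exp.mpr
          have : Real.log n * (1 + 1/l) ≤ l * (1 + 1/l) := by gcongr
          have e6 : l * (1 + 1/l) = l + 1 := by field_simp
          linarith
        have q3 : Real.exp (-9/2) ≤ Real.exp (-(Real.log n - l)^2/2) := by
          apply Real.exp_le_exp.mpr
          nlinarith
        gcongr
        
    _ ≤ _ := (summable_wt hl0).sum_le_tsum _ (fun n _ => wt_nonneg l n)

end S11


namespace S11
open Finset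

/-- unit roots of `F` modulo `d` -/
def URoot (F : Polynomial ℤ) (d : ℕ) (x : ZMod d) : Prop :=
  IsUnit x ∧ Polynomial.eval₂ (Int.castRingHom (ZMod d)) x F = 0

noncomputable def rho (F : Polynomial ℤ) (d : ℕ) : ℕ := Nat.card {x : ZMod d // URoot F d x}

lemma URoot_hom {F : Polynomial ℤ} {a b : ℕ} (h : a.Coprime b) (x : ZMod (a*b)) :
    URoot F (a*b) x ↔ URoot F a (ZMod.chineseRemainder h x).1 ∧ URoot F b (ZMod.chineseRemainder h x).2 := by
  set e := ZMod.chineseRemainder h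
  have h1 : IsUnit x ↔ IsUnit (e x).1 ∧ IsUnit (e x).2 := by
    rw [← Prod.isUnit_iff]; exact (MulEquiv.isUnit_map e).symm
  have h2 : Polynomial.eval₂ (Int.castRingHom (ZMod (a*b))) x F = 0 ↔
      Polynomial.eval₂ (Int.castRingHom (ZMod a)) (e x).1 F = 0 ∧ Polynomial.eval₂ (Int.castRingHom (ZMod b)) (e x).2 F = 0 := by
    have f1 := Polynomial.hom_eval₂ F (Int.castRingHom (ZMod (a*b))) ((RingHom.fst (ZMod a) (ZMod b)).comp (e : ZMod (a*b) →+* _)) x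
    have f2 := Polynomial.hom_eval₂ F (Int.castRingHom (ZMod (a*b))) ((RingHom.snd (ZMod a) (ZMod b)).comp (e : ZMod (a*b) →+* _)) x
    rw [RingHom.eq_intCast' (RingHom.comp _ (Int.castRingHom (ZMod (a*b))))] at f1 f2
    simp only [RingHom.comp_apply, RingHom.coe_fst, RingHom.coe_snd, RingHom.coe_coe] at f1 f2
    rw [← f1, ← f2]
    constructor
    · intro h; rw [h]; simp
    · rintro ⟨h, h'⟩
      apply e.injective
      rw [map_zero]
      exact Prod.ext h h'
  unfold URoot
  rw [h1, h2]; tauto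

lemma rho_mul {F : Polynomial ℤ} {a b : ℕ} (h : a.Coprime b) : rho F (a*b) = rho F a * rho F b := by
  unfold rho
  rw [← Nat.card_prod]
  refine Nat.card_congr ((Equiv.subtypeEquiv (q := fun y : ZMod a × ZMod b => URoot F a y.1 ∧ URoot F b y.2) (ZMod.chineseRemainder h).toEquiv fun x => ?_).trans (Equiv.subtypeProdEquivProd (p := URoot F a) (q := URoot F b)))
  exact URoot_hom h x

lemma rho_one {F : Polynomial ℤ} : rho F 1 = 1 := by
  unfold rho
  have : Unique {x : ZMod 1 // URoot F 1 x} := 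
    ⟨⟨⟨0, by constructor <;> [exact isUnit_of_subsingleton _; exact Subsingleton.elim _ _]⟩⟩, fun x => Subtype.ext (Subsingleton.elim _ _)⟩
  exact Nat.card_unique

lemma cop_prod {s : Finset ℕ} {a : ℕ} (ha : a.Prime) (hs : ∀ p ∈ s, p.Prime) (h : a ∉ s) : a.Coprime (∏ p ∈ s, p) := by
  refine Nat.Coprime.prod_right fun p hp => ?_
  rw [Nat.coprime_primes ha (hs p hp)]
  rintro rfl; exact h hp

lemma rho_prod {F : Polynomial ℤ} {s : Finset ℕ} (hs : ∀ p ∈ s, p.Prime) : rho F (∏ p ∈ s, p) = ∏ p ∈ s, rho F p := by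
  induction s using Finset.induction_on with
  | empty => simp [rho_one]
  | insert a s h ih =>
    rw [Finset.prod_insert h, Finset.prod_insert h, rho_mul (cop_prod (hs a (by simp)) (fun p hp => hs p (by simp [hp])) h),
      ih (fun p hp => hs p (by simp [hp]))]

lemma tot_prod {s : Finset ℕ} (hs : ∀ p ∈ s, p.Prime) : Nat.totient (∏ p ∈ s, p) = ∏ p ∈ s, (p-1) := by
  induction s using Finset.induction_on with
  | empty => simp
  | insert a s h ih =>
    rw [Finset.prod_insert h, Finset.prod_insert h, Nat.totient_mul (cop_prod (hs a (by simp)) (fun p hp => hs p (by simp [hp])) h),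
      ih (fun p hp => hs p (by simp [hp])), Nat.totient_prime (hs a (by simp))]

/-- number of roots modulo a prime -/
lemma rho_le_deg {F : Polynomial ℤ} {p : ℕ} (hp : p.Prime) (h : ∃ a : ℤ, ¬ (p:ℤ) ∣ F.eval a) : rho F p ≤ F.natDegree := by
  have := Fact.mk hp
  classical
  set G := F.map (Int.castRingHom (ZMod p)) with hG
  have hG0 : G ≠ 0 := by
    obtain ⟨a, ha⟩ := h
    intro h0
    apply ha
    have := Polynomial.eval_intCast_map (Int.castRingHom (ZMod p)) F a
    rw [← hG, h0, Polynomial.eval_zero] at this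
    rw [← ZMod.intCast_zmod_eq_zero_iff_dvd]
    exact this.symm
  have : rho F p ≤ G.roots.toFinset.card := by
    unfold rho
    rw [← Nat.card_eq_finsetCard]
    refine Nat.card_le_card_of_injective (fun x => ⟨x.1, ?_⟩) ?_
    · rw [Multiset.mem_toFinset, Polynomial.mem_roots hG0, Polynomial.IsRoot.def, hG, Polynomial.eval_map]
      exact x.2.2
    · intro a b h
      exact Subtype.ext (Subtype.mk.inj h)
  calc _ ≤ _ := this
    _ ≤ G.roots.card := Multiset.toFinset_card_le _
    _ ≤ G.natDegree := Polynomial.card_roots' _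
    _ ≤ _ := Polynomial.natDegree_map_le

lemma rho_le_sub_two {F : Polynomial ℤ} {p : ℕ} (hp : p.Prime) (h : ∃ a : ℤ, ¬ (p:ℤ) ∣ a * F.eval a) : rho F p + 2 ≤ p := by
  have := Fact.mk hp
  classical
  obtain ⟨a, ha⟩ := h
  have ha0 : (a : ZMod p) ≠ 0 := by
    rw [Ne, ZMod.intCast_zmod_eq_zero_iff_dvd]; exact fun h => ha (Dvd.dvd.mul_right h _)
  have haF : Polynomial.eval₂ (Int.castRingHom (ZMod p)) (a : ZMod p) F ≠ 0 := by
    have := Polynomial.eval_intCast_map (Int.castRingHom (ZMod p)) F a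
    rw [Polynomial.eval_map] at this
    rw [this]
    simp only [eq_intCast, Ne, ZMod.intCast_zmod_eq_zero_iff_dvd]
    exact fun h => ha (Dvd.dvd.mul_left h _)
  have h1 : rho F p ≤ ((univ : Finset (ZMod p)) \ {0, (a : ZMod p)}).card := by
    unfold rho
    rw [← Nat.card_eq_finsetCard]
    refine Nat.card_le_card_of_injective (fun x => ⟨x.1, ?_⟩) ?_
    · have h1 := x.2.1.ne_zero
      have h2 := x.2.2
      simp only [mem_sdiff, mem_univ, true_and, mem_insert, mem_singleton, not_or]
      refine ⟨h1, fun h => haF ?_⟩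
      rw [← h]; exact h2
    · intro a b h
      exact Subtype.ext (Subtype.mk.inj h)
  rw [Finset.card_sdiff_of_subset (Finset.subset_univ _), Finset.card_univ, ZMod.card, Finset.card_pair ha0.symm] at h1
  have := hp.two_le
  omega

lemma URoot_cast {F : Polynomial ℤ} {s : Finset ℕ} (hs : ∀ p ∈ s, p.Prime) (n : ℕ) :
    URoot F (∏ p ∈ s, p) (n : ZMod (∏ p ∈ s, p)) ↔ ∀ p ∈ s, (¬ p ∣ n ∧ (p:ℤ) ∣ F.eval (n:ℤ)) := by
  have ev : ∀ d : ℕ, Polynomial.eval₂ (Int.castRingHom (ZMod d)) (n : ZMod d) F = ((F.eval (n:ℤ) : ℤ) : ZMod d) := by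
    intro d
    have := Polynomial.eval_intCast_map (Int.castRingHom (ZMod d)) F (n:ℤ)
    rw [Polynomial.eval_map] at this
    simpa using this
  unfold URoot
  rw [ev, ZMod.intCast_zmod_eq_zero_iff_dvd, ZMod.isUnit_iff_coprime]
  rw [Nat.coprime_comm, Nat.coprime_prod_left_iff]
  constructor
  · rintro ⟨h1, h2⟩ p hp
    refine ⟨(Nat.Prime.coprime_iff_not_dvd (hs p hp)).mp (h1 p hp), dvd_trans ?_ h2⟩
    exact_mod_cast Finset.dvd_prod_of_mem (fun p => p) hp
  · intro h
    refine ⟨fun p hp => (Nat.Prime.coprime_iff_not_dvd (hs p hp)).mpr (h p hp).1, ?_⟩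
    rw [Int.natCast_dvd]
    refine Finset.prod_primes_dvd _ (fun p hp => (hs p hp).prime) fun p hp => ?_
    exact Int.natCast_dvd.mp (h p hp).2

lemma quad_count {s : Finset ℕ} (hs : ∀ p ∈ s, p.Prime) [NeZero (∏ p ∈ s, p)] :
    Nat.card {χ : DirichletCharacter ℂ (∏ p ∈ s, p) // χ^2 = 1} ≤ 2 ^ s.card := by
  have h1 : rho (Polynomial.X^2 - 1) (∏ p ∈ s, p) ≤ 2 ^ s.card := by
    rw [rho_prod hs, ← Finset.prod_const]
    refine Finset.prod_le_prod' fun p hp => ?_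
    refine (rho_le_deg (hs p hp) ⟨0, ?_⟩).trans ?_
    · have := (hs p hp).ne_one
      simp [Int.natCast_dvd, this]
    · have : (Polynomial.X^2 - 1 : Polynomial ℤ) = Polynomial.X^2 - Polynomial.C 1 := by simp
      rw [this, Polynomial.natDegree_X_pow_sub_C]
  refine le_trans ?_ h1
  set d := ∏ p ∈ s, p
  obtain ⟨e⟩ := DirichletCharacter.mulEquiv_units ℂ d
  unfold rho
  have : Finite {x : ZMod d // URoot (Polynomial.X^2 - 1) d x} := inferInstance
  refine Nat.card_le_card_of_injective (fun χ => ⟨((e χ.1 : (ZMod d)ˣ) : ZMod d), Units.isUnit _, ?_⟩) ?_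
  · have : (e χ.1)^2 = 1 := by rw [← map_pow, χ.2, map_one]
    have h := congrArg (Units.val) this
    simp at h
    simp [h]
  · intro a b h
    exact Subtype.ext (e.injective (Units.ext (congrArg Subtype.val h)))

lemma tphi_ge {s : Finset ℕ} (hs : ∀ p ∈ s, p.Prime) : ((∏ p ∈ s, p : ℕ):ℝ) ≤ 2 ^ s.card * (Nat.totient (∏ p ∈ s, p) : ℝ) := by
  rw [tot_prod hs, ← Finset.prod_const]
  push_cast
  rw [← Finset.prod_mul_distrib]
  refine Finset.prod_le_prod (fun p _ => by positivity) fun p hp => ?_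
  have := (hs p hp).two_le
  rw [Nat.cast_sub (by omega)]
  have : (2:ℝ) ≤ p := by exact_mod_cast this
  push_cast; linarith

lemma neg_prod {s : Finset ℕ} (g : ℕ → ℝ) : ∏ p ∈ s, (1 - g p) = ∑ t ∈ s.powerset, (-1)^t.card * ∏ p ∈ t, g p := by
  have := Finset.prod_one_add (f := fun p => - g p) s
  simp only [← sub_eq_add_neg] at this
  rw [this]
  refine Finset.sum_congr rfl fun t _ => ?_
  rw [Finset.prod_neg]

open Classical in
/-- one level of the sieve -/
lemma sieve_level {F : Polynomial ℤ} {s : Finset ℕ} (hs : ∀ p ∈ s, p.Prime) {D : ℕ} (hD : ∀ p ∈ s, rho F p ≤ D)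
    {l Mg E : ℝ} (hl : 1 ≤ l) (hE : 0 < E) (hMg : 0 ≤ Mg)
    (hM : ∀ χ : DirichletCharacter ℂ (∏ p ∈ s, p), χ ≠ 1 → (χ^2 = 1 → ((∏ p ∈ s, p : ℕ):ℝ) ≤ E) →
      ‖∑' n : ℕ, χ n * (wt l n : ℂ)‖ ≤ Mg) :
    |∑' n : ℕ, (∏ p ∈ s, if ¬ p ∣ n ∧ (p:ℤ) ∣ F.eval (n:ℤ) then (1:ℝ) else 0) * wt l n -
      ∑' n : ℕ, (∏ p ∈ s, if ¬ p ∣ n then ((rho F p : ℝ)/((p:ℝ)-1)) else 0) * wt l n| ≤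
      (D:ℝ)^s.card * Mg + (4*D:ℝ)^s.card * (∑' n, wt l n) / E := by
  set d := ∏ p ∈ s, p with hd
  have hd0 : d ≠ 0 := Finset.prod_ne_zero_iff.mpr fun p hp => (hs p hp).ne_zero
  have : NeZero d := ⟨hd0⟩
  set T : DirichletCharacter ℂ d → ℂ := fun χ => ∑' n : ℕ, χ n * (wt l n : ℂ) with hT
  have hsw := summable_wt (l := l) (by linarith)
  have hsum : ∀ χ : DirichletCharacter ℂ d, Summable fun n : ℕ => χ n * (wt l n : ℂ) := by
    intro χ
    refine Summable.of_norm_bounded hsw fun n => ?_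
    rw [norm_mul, Complex.norm_real, Real.norm_of_nonneg (wt_nonneg l n)]
    exact mul_le_of_le_one_left (wt_nonneg l n) (DirichletCharacter.norm_le_one χ _)
  have hT0 : ∀ χ, ‖T χ‖ ≤ ∑' n, wt l n := by
    intro χ
    refine tsum_of_norm_bounded hsw.hasSum fun n => ?_
    rw [norm_mul, Complex.norm_real, Real.norm_of_nonneg (wt_nonneg l n)]
    exact mul_le_of_le_one_left (wt_nonneg l n) (DirichletCharacter.norm_le_one χ _)
  have hφ : (0:ℝ) < d.totient := by exact_mod_cast Nat.totient_pos.mpr (Nat.pos_of_ne_zero hd0)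
  set R : Finset (ZMod d) := univ.filter (URoot F d) with hR
  have hRc : R.card = rho F d := by
    rw [hR, rho, Nat.card_eq_fintype_card, Fintype.card_subtype]
  have hRle : (R.card : ℝ) ≤ (D:ℝ)^s.card := by
    rw [hRc, rho_prod hs]
    push_cast
    rw [← Finset.prod_const]
    exact Finset.prod_le_prod (fun _ _ => by positivity) fun p hp => by exact_mod_cast hD p hp
  have g1 : ∀ n : ℕ, (((∏ p ∈ s, if ¬ p ∣ n ∧ (p:ℤ) ∣ F.eval (n:ℤ) then (1:ℝ) else 0) : ℝ) : ℂ) =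
      (1/(d.totient:ℂ)) * ∑ b ∈ R, ∑ χ : DirichletCharacter ℂ d, χ b⁻¹ * χ n := by
    intro n
    have : ∑ b ∈ R, ∑ χ : DirichletCharacter ℂ d, χ b⁻¹ * χ n = ∑ b ∈ R, if b = (n : ZMod d) then (d.totient:ℂ) else 0 := by
      refine Finset.sum_congr rfl fun b hb => ?_
      rw [hR, Finset.mem_filter] at hb
      rw [DirichletCharacter.sum_char_inv_mul_char_eq ℂ hb.2.1]
    rw [this, Finset.sum_ite_eq', Finset.prod_ite_zero]
    have e : (∀ i ∈ s, ¬i ∣ n ∧ (i:ℤ) ∣ F.eval (n:ℤ)) ↔ (n : ZMod d) ∈ R := by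
      rw [hR, Finset.mem_filter, ← URoot_cast hs, ← hd]; simp
    have : (d.totient:ℂ) ≠ 0 := by exact_mod_cast hφ.ne'
    by_cases h : (n : ZMod d) ∈ R
    · rw [if_pos (e.mpr h), if_pos h]; simp [this]
    · rw [if_neg (fun h' => h (e.mp h')), if_neg h]; simp
  have g0 : ∀ n : ℕ, (((∏ p ∈ s, if ¬ p ∣ n then ((rho F p : ℝ)/((p:ℝ)-1)) else 0) : ℝ) : ℂ) =
      (1/(d.totient:ℂ)) * (R.card * (1 : DirichletCharacter ℂ d) n) := by
    intro n
    rw [Finset.prod_ite_zero]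
    have e : (∀ i ∈ s, ¬i ∣ n) ↔ IsUnit (n : ZMod d) := by
      rw [ZMod.isUnit_iff_coprime, Nat.coprime_comm, hd, Nat.coprime_prod_left_iff]
      exact forall₂_congr fun p hp => ((hs p hp).coprime_iff_not_dvd).symm
    have e2 : ∏ p ∈ s, ((rho F p : ℝ)/((p:ℝ)-1)) = R.card / d.totient := by
      rw [hRc, rho_prod hs, hd, tot_prod hs, Finset.prod_div_distrib]
      push_cast
      congr 1
      refine Finset.prod_congr rfl fun p hp => ?_
      rw [Nat.cast_sub (hs p hp).one_le]; simp
    by_cases h : IsUnit (n : ZMod d)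
    · rw [if_pos (e.mpr h), MulChar.one_apply h, e2]; push_cast; ring
    · rw [if_neg (fun h' => h (e.mp h')), MulChar.map_nonunit _ h]; simp
  have key : ((∑' n : ℕ, (∏ p ∈ s, if ¬ p ∣ n ∧ (p:ℤ) ∣ F.eval (n:ℤ) then (1:ℝ) else 0) * wt l n -
      ∑' n : ℕ, (∏ p ∈ s, if ¬ p ∣ n then ((rho F p : ℝ)/((p:ℝ)-1)) else 0) * wt l n : ℝ) : ℂ) = 
      (1/(d.totient:ℂ)) * ∑ b ∈ R, ∑ χ ∈ univ.erase (1 : DirichletCharacter ℂ d), χ b⁻¹ * T χ := by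
    have e1 : ((∑' n : ℕ, (∏ p ∈ s, if ¬ p ∣ n ∧ (p:ℤ) ∣ F.eval (n:ℤ) then (1:ℝ) else 0) * wt l n : ℝ) : ℂ) = 
        (1/(d.totient:ℂ)) * ∑ b ∈ R, ∑ χ : DirichletCharacter ℂ d, χ b⁻¹ * T χ := by
      rw [Complex.ofReal_tsum]
      have : ∀ n : ℕ, (((∏ p ∈ s, if ¬ p ∣ n ∧ (p:ℤ) ∣ F.eval (n:ℤ) then (1:ℝ) else 0) * wt l n : ℝ) : ℂ) =
          (1/(d.totient:ℂ)) * ∑ b ∈ R, ∑ χ : DirichletCharacter ℂ d, χ b⁻¹ * (χ n * (wt l n : ℂ)) := by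
        intro n
        rw [Complex.ofReal_mul, g1 n, mul_assoc, Finset.sum_mul]
        simp_rw [Finset.sum_mul, mul_assoc]
      simp_rw [this]
      rw [tsum_mul_left, Summable.tsum_finsetSum]
      · congr 1
        refine Finset.sum_congr rfl fun b _ => ?_
        rw [Summable.tsum_finsetSum]
        · refine Finset.sum_congr rfl fun χ _ => ?_
          rw [tsum_mul_left]
        · intro χ _; exact (hsum χ).mul_left _
      · intro b _
        exact summable_sum fun χ _ => (hsum χ).mul_left _
    have e0 : ((∑' n : ℕ, (∏ p ∈ s, if ¬ p ∣ n then ((rho F p : ℝ)/((p:ℝ)-1)) else 0) * wt l n : ℝ) : ℂ) = 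
        (1/(d.totient:ℂ)) * ∑ b ∈ R, (1 : DirichletCharacter ℂ d) b⁻¹ * T 1 := by
      have : ∀ b ∈ R, (1 : DirichletCharacter ℂ d) b⁻¹ * T 1 = T 1 := by
        intro b hb
        rw [hR, Finset.mem_filter] at hb
        have hu : IsUnit b⁻¹ := by
          obtain ⟨u, rfl⟩ := hb.2.1
          rw [ZMod.inv_coe_unit]; exact Units.isUnit _
        rw [MulChar.one_apply hu, one_mul]
      rw [Finset.sum_congr rfl this, Finset.sum_const, nsmul_eq_mul, Complex.ofReal_tsum]
      have : ∀ n : ℕ, (((∏ p ∈ s, if ¬ p ∣ n then ((rho F p : ℝ)/((p:ℝ)-1)) else 0) * wt l n : ℝ) : ℂ) =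
          (1/(d.totient:ℂ)) * (R.card * ((1 : DirichletCharacter ℂ d) n * (wt l n : ℂ))) := by
        intro n
        rw [Complex.ofReal_mul, g0 n]; ring
      simp_rw [this]
      rw [tsum_mul_left, tsum_mul_left]
    rw [Complex.ofReal_sub, e1, e0, ← mul_sub, ← Finset.sum_sub_distrib]
    congr 1
    refine Finset.sum_congr rfl fun b _ => ?_
    rw [← Finset.add_sum_erase univ _ (Finset.mem_univ (1 : DirichletCharacter ℂ d))]
    ring
  have inner : ∑ χ ∈ univ.erase (1 : DirichletCharacter ℂ d), ‖T χ‖ ≤ d.totient * Mg + 4^s.card * d.totient * (∑' n, wt l n) / E := by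
    have hT00 : 0 ≤ ∑' n, wt l n := tsum_nonneg (wt_nonneg l)
    have hc1 : (Fintype.card (DirichletCharacter ℂ d) : ℝ) = d.totient := by
      rw [← DirichletCharacter.card_eq_totient_of_hasEnoughRootsOfUnity ℂ d, Nat.card_eq_fintype_card]
    have hc2 : ((univ.filter (fun χ : DirichletCharacter ℂ d => χ^2 = 1)).card : ℝ) ≤ 2^s.card := by
      have h := quad_count hs
      rw [Nat.card_eq_fintype_card, Fintype.card_subtype] at h
      exact_mod_cast h
    have hphi := tphi_ge hs
    rw [← hd] at hphi
    calc _ ≤ ∑ χ ∈ univ.erase (1 : DirichletCharacter ℂ d), (Mg + if χ^2 = 1 then d / E * ∑' n, wt l n else 0) := by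
          refine Finset.sum_le_sum fun χ hχ => ?_
          have hχ1 := Finset.ne_of_mem_erase hχ
          by_cases h2 : χ^2 = 1
          · rw [if_pos h2]
            by_cases hdE : (d:ℝ) ≤ E
            · have := hM χ hχ1 (fun _ => hdE)
              have : 0 ≤ d / E * ∑' n, wt l n := by positivity
              linarith
            · have h1 : 1 ≤ d / E := by rw [le_div_iff₀ hE]; linarith
              have := hT0 χ
              nlinarith
          · rw [if_neg h2, add_zero]
            exact hM χ hχ1 (fun h => absurd h h2)
      _ ≤ ∑ χ : DirichletCharacter ℂ d, (Mg + if χ^2 = 1 then d / E * ∑' n, wt l n else 0) := by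
          refine Finset.sum_le_sum_of_subset_of_nonneg (Finset.erase_subset _ _) fun χ _ _ => ?_
          split_ifs <;> positivity
      _ = d.totient * Mg + (univ.filter (fun χ : DirichletCharacter ℂ d => χ^2 = 1)).card * (d / E * ∑' n, wt l n) := by
          rw [Finset.sum_add_distrib, ← Finset.sum_filter, Finset.sum_const, Finset.sum_const, nsmul_eq_mul, nsmul_eq_mul,
            Finset.card_univ, hc1]
      _ ≤ d.totient * Mg + 2^s.card * ((2^s.card * d.totient) / E * ∑' n, wt l n) := by gcongr
      _ = _ := by
          have : (4:ℝ)^s.card = 2^s.card * 2^s.card := by rw [← mul_pow]; norm_num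
          rw [this]; ring
  rw [← Real.norm_eq_abs, ← Complex.norm_real, key, norm_mul]
  have hT00 : 0 ≤ ∑' n, wt l n := tsum_nonneg (wt_nonneg l)
  have hn : ‖(1/(d.totient:ℂ))‖ = 1/d.totient := by simp
  rw [hn]
  calc _ ≤ 1/(d.totient:ℝ) * ∑ b ∈ R, ∑ χ ∈ univ.erase (1 : DirichletCharacter ℂ d), ‖T χ‖ := by
        gcongr
        refine (norm_sum_le _ _).trans (Finset.sum_le_sum fun b _ => (norm_sum_le _ _).trans (Finset.sum_le_sum fun χ _ => ?_))
        rw [norm_mul]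
        exact mul_le_of_le_one_left (norm_nonneg _) (DirichletCharacter.norm_le_one χ _)
    _ = 1/(d.totient:ℝ) * (R.card * ∑ χ ∈ univ.erase (1 : DirichletCharacter ℂ d), ‖T χ‖) := by
        rw [Finset.sum_const, nsmul_eq_mul]
    _ ≤ 1/(d.totient:ℝ) * (D^s.card * (d.totient * Mg + 4^s.card * d.totient * (∑' n, wt l n) / E)) := by gcongr
    _ = _ := by
        rw [mul_pow]; field_simp

open Classical in
lemma sieve_main {F : Polynomial ℤ} {S : Finset ℕ} (hs : ∀ p ∈ S, p.Prime) {D : ℕ} (hD : ∀ p ∈ S, rho F p ≤ D)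
    (hD2 : ∀ p ∈ S, rho F p + 2 ≤ p)
    {l Mg E : ℝ} (hl : 1 ≤ l) (hE : 0 < E) (hMg : 0 ≤ Mg)
    (hM : ∀ s ⊆ S, ∀ χ : DirichletCharacter ℂ (∏ p ∈ s, p), χ ≠ 1 → (χ^2 = 1 → ((∏ p ∈ s, p : ℕ):ℝ) ≤ E) →
      ‖∑' n : ℕ, χ n * (wt l n : ℂ)‖ ≤ Mg) :
    (∏ p ∈ S, (1 - (rho F p : ℝ)/((p:ℝ)-1))) * ∑' n, wt l n ≤
    ∑' n : ℕ, (if ∀ p ∈ S, ¬ (¬ p ∣ n ∧ (p:ℤ) ∣ F.eval (n:ℤ)) then (1:ℝ) else 0) * wt l n + 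
      ((D + 1:ℝ)^S.card * Mg + (4*D + 1:ℝ)^S.card * (∑' n, wt l n) / E) := by
  have hsw := summable_wt (l := l) (by linarith)
  have hr : ∀ p ∈ S, 0 ≤ (rho F p : ℝ)/((p:ℝ)-1) ∧ (rho F p : ℝ)/((p:ℝ)-1) ≤ 1 := by
    intro p hp
    have h1 : ((rho F p : ℕ):ℝ) + 2 ≤ p := by exact_mod_cast hD2 p hp
    have h0 : (0:ℝ) ≤ rho F p := by positivity
    constructor
    · apply div_nonneg h0; linarith
    · rw [div_le_one (by linarith)]; linarith
  -- generic expansion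
  have exp : ∀ g : ℕ → ℕ → ℝ, (∀ p ∈ S, ∀ n, 0 ≤ g p n ∧ g p n ≤ 1) →
      (∀ s ⊆ S, Summable fun n => (∏ p ∈ s, g p n) * wt l n) ∧ 
      ∑' n : ℕ, (∏ p ∈ S, (1 - g p n)) * wt l n = ∑ s ∈ S.powerset, (-1)^s.card * ∑' n : ℕ, (∏ p ∈ s, g p n) * wt l n := by
    intro g hg
    have hsm : ∀ s ⊆ S, Summable fun n => (∏ p ∈ s, g p n) * wt l n := by
      intro s hsS
      refine Summable.of_nonneg_of_le (fun n => mul_nonneg (Finset.prod_nonneg fun p hp => (hg p (hsS hp) n).1) (wt_nonneg l n)) (fun n => ?_) hsw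
      exact mul_le_of_le_one_left (wt_nonneg l n) (Finset.prod_le_one (fun p hp => (hg p (hsS hp) n).1) fun p hp => (hg p (hsS hp) n).2)
    refine ⟨hsm, ?_⟩
    have : ∀ n : ℕ, (∏ p ∈ S, (1 - g p n)) * wt l n = ∑ s ∈ S.powerset, (-1)^s.card * ((∏ p ∈ s, g p n) * wt l n) := by
      intro n
      rw [neg_prod, Finset.sum_mul]
      refine Finset.sum_congr rfl fun s _ => by ring
    simp_rw [this]
    rw [Summable.tsum_finsetSum]
    · refine Finset.sum_congr rfl fun s _ => tsum_mul_left
    · intro s hs'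
      exact (hsm s (Finset.mem_powerset.mp hs')).mul_left _
  set g1 : ℕ → ℕ → ℝ := fun p n => if ¬ p ∣ n ∧ (p:ℤ) ∣ F.eval (n:ℤ) then (1:ℝ) else 0 with hg1
  set g0 : ℕ → ℕ → ℝ := fun p n => if ¬ p ∣ n then ((rho F p : ℝ)/((p:ℝ)-1)) else 0 with hg0
  have b1 : ∀ p ∈ S, ∀ n, 0 ≤ g1 p n ∧ g1 p n ≤ 1 := by
    intro p _ n; simp only [hg1]; split_ifs <;> norm_num
  have b0 : ∀ p ∈ S, ∀ n, 0 ≤ g0 p n ∧ g0 p n ≤ 1 := by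
    intro p hp n; simp only [hg0]; split_ifs
    · norm_num
    · exact hr p hp
  have x1 := (exp g1 b1).2
  have x0 := (exp g0 b0).2
  have lhs : (∏ p ∈ S, (1 - (rho F p : ℝ)/((p:ℝ)-1))) * ∑' n, wt l n ≤ ∑' n : ℕ, (∏ p ∈ S, (1 - g0 p n)) * wt l n := by
    rw [← tsum_mul_left]
    refine Summable.tsum_le_tsum (fun n => ?_) (hsw.mul_left _) ?_
    · refine mul_le_mul_of_nonneg_right (Finset.prod_le_prod (fun p hp => by linarith [(hr p hp).2]) fun p hp => ?_) (wt_nonneg l n)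
      simp only [hg0]; split_ifs
      · linarith [(hr p hp).1]
      · exact le_rfl
    · refine Summable.of_nonneg_of_le (fun n => mul_nonneg (Finset.prod_nonneg fun p hp => by linarith [(b0 p hp n).2]) (wt_nonneg l n)) (fun n => ?_) hsw
      exact mul_le_of_le_one_left (wt_nonneg l n) (Finset.prod_le_one (fun p hp => by linarith [(b0 p hp n).2]) fun p hp => by linarith [(b0 p hp n).1])
  have rhs : ∑' n : ℕ, (∏ p ∈ S, (1 - g1 p n)) * wt l n = 
      ∑' n : ℕ, (if ∀ p ∈ S, ¬ (¬ p ∣ n ∧ (p:ℤ) ∣ F.eval (n:ℤ)) then (1:ℝ) else 0) * wt l n := by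
    refine tsum_congr fun n => ?_
    congr 1
    have : ∀ p ∈ S, 1 - g1 p n = if ¬ (¬ p ∣ n ∧ (p:ℤ) ∣ F.eval (n:ℤ)) then (1:ℝ) else 0 := by
      intro p _
      simp only [hg1]
      by_cases h : ¬ p ∣ n ∧ (p:ℤ) ∣ F.eval (n:ℤ)
      · rw [if_pos h, if_neg (not_not.mpr h)]; simp
      · rw [if_neg h, if_pos h]; simp
    rw [Finset.prod_congr rfl this, Finset.prod_ite_zero]
    simp
  rw [← rhs]
  refine lhs.trans ?_
  rw [x0, x1]
  have err : ∑ s ∈ S.powerset, ((D:ℝ)^s.card * Mg + (4*D:ℝ)^s.card * (∑' n, wt l n) / E) = 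
      (D + 1:ℝ)^S.card * Mg + (4*D + 1:ℝ)^S.card * (∑' n, wt l n) / E := by
    have h : ∀ a : ℝ, ∑ s ∈ S.powerset, a^s.card = (a+1)^S.card := by
      intro a
      have := Finset.prod_add_one (f := fun _ : ℕ => a) S
      simp only [Finset.prod_const] at this
      exact this.symm
    rw [Finset.sum_add_distrib, ← Finset.sum_mul, ← Finset.sum_div, ← Finset.sum_mul, h, h]
  rw [← err, ← Finset.sum_add_distrib]
  refine Finset.sum_le_sum fun s hsS => ?_
  have hsS := Finset.mem_powerset.mp hsS
  have := sieve_level (F := F) (fun p hp => hs p (hsS hp)) (fun p hp => hD p (hsS hp)) hl hE hMg (hM s hsS)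
  have h2 := abs_le.mp this
  rcases neg_one_pow_eq_or ℝ s.card with h | h <;> rw [h] <;> linarith [h2.1, h2.2]

end S11


namespace S11
open Finset Filter Topology

lemma pow_omega {C a : ℝ} (hC : 1 ≤ C) (ha : 0 < a) : ∃ A : ℝ, 0 < A ∧ ∀ q : ℕ, q ≠ 0 → C ^ q.primeFactors.card ≤ A * (q:ℝ)^a := by
  obtain ⟨M, hM⟩ := exists_nat_gt (C ^ (1/a))
  have hMC : C ≤ (M:ℝ)^a := by
    calc C = (C ^ (1/a))^a := by rw [← Real.rpow_mul (by linarith)]; field_simp; simp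
      _ ≤ _ := by gcongr
  refine ⟨C^M, by positivity, fun q hq => ?_⟩
  calc C ^ q.primeFactors.card = ∏ p ∈ q.primeFactors, C := by rw [Finset.prod_const]
    _ ≤ ∏ p ∈ q.primeFactors, ((if p < M then C else 1) * (p:ℝ)^a) := by
        refine Finset.prod_le_prod (fun _ _ => by linarith) fun p hp => ?_
        have hp1 : (1:ℝ) ≤ p := by exact_mod_cast (Nat.prime_of_mem_primeFactors hp).one_le
        split_ifs with h
        · have : 1 ≤ (p:ℝ)^a := Real.one_le_rpow hp1 ha.le
          nlinarith
        · rw [one_mul]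
          refine hMC.trans ?_
          gcongr
          omega
    _ = C ^ (q.primeFactors.filter (fun p => p < M)).card * ((∏ p ∈ q.primeFactors, p : ℕ):ℝ)^a := by
        rw [Finset.prod_mul_distrib, Real.finset_prod_rpow _ _ (fun _ _ => by positivity), Finset.prod_ite]
        push_cast; simp
    _ ≤ _ := by
        have h1 : (q.primeFactors.filter (fun p => p < M)).card ≤ M := by
          calc _ ≤ (range M).card := Finset.card_le_card (fun p hp => by simp at hp ⊢; exact hp.2)
            _ = M := by simp
        have h2 : ∏ p ∈ q.primeFactors, p ≤ q := Nat.le_of_dvd (Nat.pos_of_ne_zero hq) (Nat.prod_primeFactors_dvd q)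
        gcongr

lemma inv_prime_sum {η : ℝ} (hη : 0 < η) : ∃ C : ℝ, 0 ≤ C ∧ ∀ N : ℕ, 1 ≤ N →
    ∑ p ∈ (Icc 1 N).filter Nat.Prime, (1:ℝ)/p ≤ η * Real.log N + C := by
  obtain ⟨M, hM⟩ := exists_nat_gt (Real.exp (6/η))
  have hM1 : (1:ℝ) < M := lt_of_le_of_lt (Real.one_le_exp (by positivity)) hM
  have hlM : 6/η < Real.log M := by rw [Real.lt_log_iff_exp_lt (by linarith)]; exact hM
  have h6 : 0 < 6/η := by positivity
  refine ⟨M + η, by positivity, fun N hN => ?_⟩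
  have s1 := sum_vM_le (h := fun n : ℕ => (1:ℝ)/n) (fun n hn => by positivity) (fun n hn => by
    have : (0:ℝ) < n := by exact_mod_cast hn
    push_cast
    gcongr; linarith) N
  have s2 : ∑ n ∈ Icc 1 N, (1:ℝ)/n ≤ 1 + Real.log N := by
    have := harmonic_le_one_add_log N
    rw [harmonic_eq_sum_Icc] at this
    push_cast at this
    simpa [one_div] using this
  calc _ ≤ ∑ p ∈ Icc 1 N, ((if p ≤ M then (1:ℝ) else 0) + (1/Real.log M) * (ArithmeticFunction.vonMangoldt p * (1/p))) := by
        rw [Finset.sum_filter]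
        refine Finset.sum_le_sum fun p hp => ?_
        have hp1 : (1:ℝ) ≤ p := by exact_mod_cast (Finset.mem_Icc.mp hp).1
        have hv := ArithmeticFunction.vonMangoldt_nonneg (n := p)
        have hl0 : 0 < Real.log M := by linarith
        have hnn : 0 ≤ (1/Real.log M) * (ArithmeticFunction.vonMangoldt p * (1/(p:ℝ))) := by positivity
        by_cases hpp : p.Prime
        · rw [if_pos hpp]
          by_cases h : p ≤ M
          · rw [if_pos h]
            have : (1:ℝ)/p ≤ 1 := by rw [div_le_one (by linarith)]; exact hp1
            linarith
          · rw [if_neg h, zero_add, ArithmeticFunction.vonMangoldt_apply_prime hpp]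
            have : Real.log M ≤ Real.log p := Real.log_le_log (by linarith) (by exact_mod_cast (not_le.mp h).le)
            rw [← mul_assoc]
            apply le_mul_of_one_le_left (by positivity)
            rw [one_div, inv_mul_eq_div, one_le_div hl0]; exact this
        · rw [if_neg hpp]
          split_ifs <;> linarith
    _ = ((Icc 1 N).filter (fun p => p ≤ M)).card + (1/Real.log M) * ∑ p ∈ Icc 1 N, ArithmeticFunction.vonMangoldt p * (1/(p:ℝ)) := by
        rw [Finset.sum_add_distrib, ← Finset.mul_sum]; simp
    _ ≤ M + (η/6) * (6 * (1 + Real.log N)) := by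
        have hc : ((Icc 1 N).filter (fun p => p ≤ M)).card ≤ M := by
          calc _ ≤ (Icc 1 M).card := Finset.card_le_card (fun p hp => by simp at hp ⊢; omega)
            _ = M := by simp
        have hc' : (((Icc 1 N).filter (fun p => p ≤ M)).card : ℝ) ≤ M := by exact_mod_cast hc
        have h1 : 1/Real.log M ≤ η/6 := by
          rw [div_le_div_iff₀ (by linarith) (by norm_num)]
          rw [div_lt_iff₀ hη] at hlM; linarith
        have h2 : ∑ p ∈ Icc 1 N, ArithmeticFunction.vonMangoldt p * (1/(p:ℝ)) ≤ 6 * (1 + Real.log N) := by linarith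
        have h3 : 0 ≤ ∑ p ∈ Icc 1 N, ArithmeticFunction.vonMangoldt p * (1/(p:ℝ)) :=
          Finset.sum_nonneg fun p _ => mul_nonneg ArithmeticFunction.vonMangoldt_nonneg (by positivity)
        gcongr
    _ = _ := by ring

lemma omega_le {q : ℕ} (hq : q ≠ 0) : (q.primeFactors.card : ℝ) ≤ 2 * Real.log q := by
  have h1 : 2 ^ q.primeFactors.card ≤ q := by
    calc 2 ^ q.primeFactors.card = ∏ p ∈ q.primeFactors, 2 := by rw [Finset.prod_const]
      _ ≤ ∏ p ∈ q.primeFactors, p := Finset.prod_le_prod' fun p hp => (Nat.prime_of_mem_primeFactors hp).two_le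
      _ ≤ q := Nat.le_of_dvd (Nat.pos_of_ne_zero hq) (Nat.prod_primeFactors_dvd q)
  have h2 : Real.log ((2:ℝ) ^ q.primeFactors.card) ≤ Real.log q := Real.log_le_log (by positivity) (by exact_mod_cast h1)
  rw [Real.log_pow] at h2
  have := Real.log_two_gt_d9
  have : (0:ℝ) ≤ q.primeFactors.card := by positivity
  nlinarith

lemma inv_prime_dvd {η : ℝ} (hη : 0 < η) : ∃ C : ℝ, 0 ≤ C ∧ ∀ q : ℕ, q ≠ 0 →
    ∑ p ∈ q.primeFactors, (1:ℝ)/p ≤ η * Real.log (Real.log q + 2) + C := by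
  obtain ⟨C, hC, h⟩ := inv_prime_sum hη
  refine ⟨C + 2, by linarith, fun q hq => ?_⟩
  have hl : 0 ≤ Real.log q := Real.log_natCast_nonneg q
  set N := ⌊Real.log q⌋₊ + 1 with hN
  have hN1 : Real.log q < N := by rw [hN]; push_cast; exact Nat.lt_floor_add_one _
  have hN2 : (N:ℝ) ≤ Real.log q + 2 := by rw [hN]; push_cast; linarith [Nat.floor_le hl]
  have hN0 : (0:ℝ) < N := by linarith
  calc _ ≤ ∑ p ∈ q.primeFactors, ((if p ≤ N then (1:ℝ)/p else 0) + 1/N) := by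
        refine Finset.sum_le_sum fun p hp => ?_
        split_ifs with h
        · have : 0 ≤ 1/(N:ℝ) := by positivity
          linarith
        · rw [zero_add]; gcongr; omega
    _ = ∑ p ∈ q.primeFactors.filter (fun p => p ≤ N), (1:ℝ)/p + q.primeFactors.card * (1/N) := by
        rw [Finset.sum_add_distrib, ← Finset.sum_filter, Finset.sum_const, nsmul_eq_mul]
    _ ≤ ∑ p ∈ (Icc 1 N).filter Nat.Prime, (1:ℝ)/p + (2 * N) * (1/N) := by
        have h1 := omega_le hq
        have h2 : (q.primeFactors.card : ℝ) ≤ 2 * N := by linarith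
        have h3 : ∑ p ∈ q.primeFactors.filter (fun p => p ≤ N), (1:ℝ)/p ≤ ∑ p ∈ (Icc 1 N).filter Nat.Prime, (1:ℝ)/p := by
          refine Finset.sum_le_sum_of_subset_of_nonneg ?_ (fun _ _ _ => by positivity)
          intro p hp
          rw [Finset.mem_filter] at hp ⊢
          have := Nat.prime_of_mem_primeFactors hp.1
          exact ⟨Finset.mem_Icc.mpr ⟨this.one_le, hp.2⟩, this⟩
        gcongr
    _ ≤ (η * Real.log N + C) + 2 := by
        have := h N (by omega)
        have e : (2 * N) * (1/(N:ℝ)) = 2 := by field_simp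
        rw [e]; linarith
    _ ≤ _ := by
        have : Real.log N ≤ Real.log (Real.log q + 2) := Real.log_le_log hN0 hN2
        nlinarith

lemma alpha_lb (F : Polynomial ℤ) (D : ℕ) {η : ℝ} (hη : 0 < η) : ∃ c : ℝ, 0 < c ∧ ∀ q : ℕ, q ≠ 0 →
    (∀ p ∈ q.primeFactors, rho F p ≤ D) → (∀ p ∈ q.primeFactors, rho F p + 2 ≤ p) →
    c * (Real.log q + 2) ^ (-η) ≤ ∏ p ∈ q.primeFactors, (1 - (rho F p : ℝ)/((p:ℝ)-1)) := by
  obtain ⟨C, hC, h⟩ := inv_prime_dvd (η := η / (4*(D+1))) (by positivity)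
  refine ⟨(1/(2*D+1:ℝ))^(2*D+2) * Real.exp (-(4*(D+1)) * C), by positivity, fun q hq h1 h2 => ?_⟩
  have hl : 0 ≤ Real.log q := Real.log_natCast_nonneg q
  calc _ = (1/(2*D+1:ℝ))^(2*D+2) * Real.exp (-(4*(D+1)) * (η / (4*(D+1)) * Real.log (Real.log q + 2) + C)) := by
        rw [Real.rpow_def_of_pos (by linarith), mul_assoc, ← Real.exp_add]
        congr 2
        field_simp; ring
    _ ≤ (1/(2*D+1:ℝ))^(2*D+2) * Real.exp (-(4*(D+1)) * ∑ p ∈ q.primeFactors, (1:ℝ)/p) := by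
        have := h q hq
        gcongr ?_ * Real.exp ?_
        have h4 : (0:ℝ) ≤ 4*(D+1) := by positivity
        nlinarith
    _ ≤ (1/(2*D+1:ℝ))^(q.primeFactors.filter (fun p => p ≤ 2*D+1)).card * Real.exp (-(4*(D+1)) * ∑ p ∈ q.primeFactors, (1:ℝ)/p) := by
        gcongr ?_ * _
        apply pow_le_pow_of_le_one (by positivity)
        · rw [div_le_one (by positivity)]; linarith [(Nat.cast_nonneg D : (0:ℝ) ≤ D)]
        · calc _ ≤ (range (2*D+2)).card := Finset.card_le_card (fun p hp => by simp at hp ⊢; omega)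
            _ = 2*D+2 := by simp
    _ = ∏ p ∈ q.primeFactors, ((if p ≤ 2*D+1 then (1/(2*D+1:ℝ)) else 1) * Real.exp (-(4*(D+1)) * (1/p))) := by
        rw [Finset.prod_mul_distrib, ← Real.exp_sum, ← Finset.mul_sum, Finset.prod_ite]
        simp
    _ ≤ _ := by
        refine Finset.prod_le_prod (fun p _ => by split_ifs <;> positivity) fun p hp => ?_
        have a1 : ((rho F p : ℕ):ℝ) ≤ D := by exact_mod_cast h1 p hp
        have a2 : ((rho F p : ℕ):ℝ) + 2 ≤ p := by exact_mod_cast h2 p hp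
        have a3 := (Nat.cast_nonneg (rho F p) : (0:ℝ) ≤ rho F p)
        have a4 := (Nat.cast_nonneg D : (0:ℝ) ≤ D)
        have hp0 : (0:ℝ) < (p:ℝ) - 1 := by linarith
        have e : 1 - (rho F p : ℝ)/((p:ℝ)-1) = ((p:ℝ) - 1 - rho F p)/(p-1) := by field_simp
        split_ifs with hpD
        · have hx : Real.exp (-(4*(D+1)) * (1/(p:ℝ))) ≤ 1 := by
            rw [Real.exp_le_one_iff]; have : 0 ≤ 1/(p:ℝ) := by positivity
            nlinarith
          have hpD' : (p:ℝ) ≤ 2*D+1 := by exact_mod_cast hpD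
          calc _ ≤ (1/(2*D+1:ℝ)) * 1 := by gcongr
            _ ≤ 1/((p:ℝ)-1) := by rw [mul_one]; gcongr; linarith
            _ ≤ _ := by rw [e]; gcongr; linarith
        · rw [one_mul]
          have hpD' : (2*D+2:ℝ) ≤ p := by exact_mod_cast (not_le.mp hpD)
          set t := (rho F p : ℝ)/((p:ℝ)-1) with ht
          have t0 : 0 ≤ t := by positivity
          have t1 : t ≤ 1/2 := by rw [ht, div_le_iff₀ hp0]; linarith
          have t2 : 2*t ≤ 4*(D+1) * (1/(p:ℝ)) := by
            rw [ht, ← mul_div_assoc, mul_one_div, div_le_div_iff₀ hp0 (by linarith)]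
            nlinarith
          have key : Real.exp (-(2*t)) ≤ 1 - t := by
            have b1 : 1 + 2*t ≤ Real.exp (2*t) := by linarith [Real.add_one_le_exp (2*t)]
            rw [Real.exp_neg]
            calc _ ≤ (1+2*t)⁻¹ := by gcongr
              _ ≤ 1 - t := by rw [inv_le_iff_one_le_mul₀ (by linarith)]; nlinarith
          refine le_trans ?_ key
          apply Real.exp_le_exp.mpr
          linarith

end S11


namespace S11
open Finset Filter Topology

lemma ev_pow {a : ℝ} (ha : 0 < a) (C K m : ℝ) (hK : 0 ≤ K) (hm : 0 ≤ m) (k : ℕ) :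
    ∀ᶠ L : ℝ in atTop, C * (K * Real.log L + m)^k ≤ L^a := by
  have h := isLittleO_log_rpow_rpow_atTop (s := a) (r := (k:ℝ)) ha
  set c : ℝ := (|C|+1) * (K+m+1)^k with hc
  have hc0 : 0 < c := by positivity
  have h2 := h.bound (c := 1/c) (by positivity)
  filter_upwards [h2, eventually_ge_atTop (Real.exp 1)] with L hL h1
  have hL1 : 1 ≤ Real.log L := by rw [Real.le_log_iff_exp_le (lt_of_lt_of_le (Real.exp_pos _) h1)]; exact h1
  have hLp : 0 < L := lt_of_lt_of_le (Real.exp_pos _) h1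
  rw [Real.rpow_natCast, Real.norm_of_nonneg (by positivity), Real.norm_of_nonneg (by positivity), one_div, inv_mul_eq_div,
    le_div_iff₀ hc0] at hL
  calc C * (K * Real.log L + m)^k ≤ (|C|+1) * ((K+m+1) * Real.log L)^k := by
        have : C ≤ |C|+1 := by linarith [le_abs_self C]
        gcongr
        nlinarith
    _ = Real.log L ^ k * c := by rw [hc, mul_pow]; ring
    _ ≤ _ := hL

lemma ev_B : ∀ᶠ L : ℝ in atTop, 8 ≤ Real.log (Real.log L) :=
  (Real.tendsto_log_atTop.comp Real.tendsto_log_atTop).eventually_ge_atTop 8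

lemma Rr_le {d q : ℕ} [NeZero d] (hq : q ≠ 0) (hdq : d ∣ q) (χ : DirichletCharacter ℂ d) {E : ℝ} (hE : 1 ≤ E)
    (h : χ^2 = 1 → (d:ℝ) ≤ E) : Rr χ ≤ E * 2^q.primeFactors.card := by
  unfold Rr
  have h2 : (1:ℝ) ≤ 2^q.primeFactors.card := one_le_pow₀ (by norm_num)
  split_ifs with h1
  · have hc : d.primeFactors.card ≤ q.primeFactors.card := Finset.card_le_card (Nat.primeFactors_mono hdq hq)
    have := h h1
    gcongr
    norm_num
  · nlinarith

lemma T_unif {d q : ℕ} (hq : q ≠ 0) (hdq : d ∣ q) {χ : DirichletCharacter ℂ d} (hχ1 : χ ≠ 1) {L θ K l v : ℝ} (hL1 : 1 ≤ L)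
    (hθ : 0 < θ) (hl : L^θ ≤ l) (hl1 : 1 ≤ l) (hlogq : Real.log q ≤ K * v) (e4 : 10^6 * (K * v + 1)^3 ≤ L^(θ/2))
    (hχ2 : χ^2 = 1 → (d:ℝ) ≤ L^(θ/8)) :
    ‖∑' n : ℕ, χ n * (wt l n : ℂ)‖ ≤ CT * (L^(θ/8) * 2^q.primeFactors.card)^2 * (K * v + 1)^32 := by
  have : NeZero d := ⟨fun h => hq (by rw [h] at hdq; exact Nat.eq_zero_of_zero_dvd hdq)⟩
  have hLp : 0 < L := by linarith
  have hE1 : 1 ≤ L^(θ/8) := Real.one_le_rpow hL1 (by linarith)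
  have hdle : (d:ℝ) ≤ q := by exact_mod_cast Nat.le_of_dvd (Nat.pos_of_ne_zero hq) hdq
  have hd1 : (1:ℝ) ≤ d := by exact_mod_cast Nat.pos_of_ne_zero (NeZero.ne d)
  have hld : Real.log d ≤ K * v := (Real.log_le_log (by linarith) hdle).trans hlogq
  have hld0 : 0 ≤ Real.log d := Real.log_nonneg hd1
  have hKv : 0 ≤ K * v := hld0.trans hld
  have hR := Rr_le hq hdq χ hE1 hχ2
  have hR1 := Rr_ge_one χ
  have hCT := CT_nonneg
  refine (T_bd hχ1 (by linarith) ?_).trans ?_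
  · intro h2
    have hdE := hχ2 h2
    apply one_div_le_one_div_of_le (by positivity)
    calc 10^6 * (Real.log d+1)^3 * d ≤ 10^6 * (K*v+1)^3 * L^(θ/8) := by gcongr
      _ ≤ L^(θ/2) * L^(θ/8) := by gcongr
      _ = L^(θ/2 + θ/8) := by rw [← Real.rpow_add hLp]
      _ ≤ L^θ := by apply Real.rpow_le_rpow_of_exponent_le hL1; linarith
      _ ≤ l := hl
  · gcongr

set_option maxHeartbeats 2000000 in
theorem propA (F : Polynomial ℤ) {K θ : ℝ} (hK : 0 < K) (hθ : 0 < θ) :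
    ∀ᶠ L : ℝ in atTop, ∀ q : ℕ, q ≠ 0 → (q:ℝ) ≤ L^K → (∀ p ∈ q.primeFactors, ∃ a : ℤ, ¬ (p:ℤ) ∣ a * F.eval a) →
      ∀ l : ℝ, L^θ ≤ l → 1/((Real.log L)^(1/3:ℝ) * l) ≤
        ∑ p ∈ (Icc 1 ⌊Real.exp (l + Real.log (Real.log L))⌋₊).filter (fun p : ℕ => (p.Prime ∧ Int.gcd (F.eval (p:ℤ)) q = 1) ∧
          |Real.log p - l| ≤ Real.log (Real.log L)), (1:ℝ)/p := by
  set D := F.natDegree with hD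
  obtain ⟨c, hc, hα⟩ := alpha_lb F D (η := 1/4) (by norm_num)
  obtain ⟨A1, hA1, hω1⟩ := pow_omega (C := 4*(D+1)) (a := θ/(8*K)) (by linarith [(Nat.cast_nonneg D : (0:ℝ) ≤ D)]) (by positivity)
  obtain ⟨A2, hA2, hω2⟩ := pow_omega (C := 4*D+1) (a := θ/(16*K)) (by linarith [(Nat.cast_nonneg D : (0:ℝ) ≤ D)]) (by positivity)
  set c0 : ℝ := Real.exp (-6)/20 with hc0
  have hc0p : 0 < c0 := by positivity
  have hCT := CT_nonneg
  have e1 := ev_pow (a := 5*θ/8 - θ/8) (by linarith) (CT * A1) K 1 hK.le zero_le_one 32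
  have e2 := ev_pow (a := θ/8) (by linarith) 1 1 0 zero_le_one le_rfl 1
  have e3 := ev_pow (a := θ/16) (by linarith) (A2*270) 1 0 zero_le_one le_rfl 1
  have e4 := ev_pow (a := θ/2) (by linarith) (10^6) K 1 hK.le zero_le_one 3
  have e5 := ev_pow (a := θ) hθ 8 (K+20) 8 (by linarith) (by norm_num) 1
  have e6 : ∀ᶠ L : ℝ in atTop, 8 * (K+2)^(1/4:ℝ)/(c0*c) ≤ (Real.log L)^(1/12:ℝ) :=
    ((tendsto_rpow_atTop (by norm_num : (0:ℝ) < 1/12)).comp Real.tendsto_log_atTop).eventually_ge_atTop _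
  have e7 : ∀ᶠ L : ℝ in atTop, 270 ≤ Real.log L := Real.tendsto_log_atTop.eventually_ge_atTop _
  filter_upwards [e1, e2, e3, e4, e5, e6, e7, ev_B, eventually_ge_atTop 1] with L e1 e2 e3 e4 e5 e6 e7 e8 hL1
  intro q hq hqL hroot l hl
  set v := Real.log L with hv
  set B := Real.log v with hB
  have hv0 : 0 < v := by linarith
  have hLp : 0 < L := by linarith
  have hexpB : Real.exp B = v := Real.exp_log hv0
  have hBv : B ≤ v := by have := Real.log_le_sub_one_of_pos hv0; linarith
  simp only [pow_one, one_mul, add_zero] at e2 e3 e5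
  have hl10 : 8 * ((K+20)*v + 8) ≤ l := e5.trans hl
  have hKv : 0 ≤ K * v := by positivity
  have hl1 : 10 ≤ l := by nlinarith only [hl10, hKv, e7]
  have hl0 : 0 < l := by linarith
  have hDr := (Nat.cast_nonneg D : (0:ℝ) ≤ D)
  -- primes
  have hS : ∀ p ∈ q.primeFactors, p.Prime := fun p hp => Nat.prime_of_mem_primeFactors hp
  have hr1 : ∀ p ∈ q.primeFactors, rho F p ≤ D := fun p hp => by
    obtain ⟨a, ha⟩ := hroot p hp
    exact rho_le_deg (hS p hp) ⟨a, fun h => ha (Dvd.dvd.mul_left h _)⟩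
  have hr2 : ∀ p ∈ q.primeFactors, rho F p + 2 ≤ p := fun p hp => rho_le_sub_two (hS p hp) (hroot p hp)
  have hαq := hα q hq hr1 hr2
  set α := ∏ p ∈ q.primeFactors, (1 - (rho F p : ℝ)/((p:ℝ)-1))
  have hq1 : (1:ℝ) ≤ q := by exact_mod_cast Nat.pos_of_ne_zero hq
  have hlogq : Real.log q ≤ K * v := by
    have := Real.log_le_log (by linarith) hqL
    rwa [Real.log_rpow hLp] at this
  set E : ℝ := L^(θ/8) with hE
  have hE1 : 1 ≤ E := Real.one_le_rpow hL1 (by linarith)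
  set ω := q.primeFactors.card with hω
  set Mg : ℝ := CT * (E * 2^ω)^2 * (K * v + 1)^32 with hMg
  have hMg0 : 0 ≤ Mg := by positivity
  have hM : ∀ s ⊆ q.primeFactors, ∀ χ : DirichletCharacter ℂ (∏ p ∈ s, p), χ ≠ 1 → (χ^2 = 1 → ((∏ p ∈ s, p : ℕ):ℝ) ≤ E) →
      ‖∑' n : ℕ, χ n * (wt l n : ℂ)‖ ≤ Mg := by
    intro s hs χ hχ1 hχ2
    have hdq : ∏ p ∈ s, p ∣ q := (Finset.prod_dvd_prod_of_subset _ _ _ hs).trans (Nat.prod_primeFactors_dvd q)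
    refine T_unif hq hdq hχ1 hL1 hθ hl (by linarith) hlogq e4 hχ2
  have hsv := sieve_main hS hr1 hr2 (by linarith : 1 ≤ l) (by linarith : 0 < E) hMg0 hM
  set T0 := ∑' n, wt l n with hT0
  have hT0u : T0 ≤ 270 * l := by have := T0_upper (l := l) (by linarith); rw [← hT0] at this; linarith
  have hT0l : c0 * l ≤ T0 := T0_lower hl1
  -- error 1
  have hqa : ∀ a : ℝ, 0 ≤ a → (q:ℝ)^a ≤ L^(K*a) := by
    intro a ha
    rw [Real.rpow_mul hLp.le]
    gcongr
  have er1 : (D+1:ℝ)^ω * Mg ≤ l / v := by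
    have h1 := hω1 q hq
    have h2 := hqa (θ/(8*K)) (by positivity)
    have h3 : K * (θ/(8*K)) = θ/8 := by field_simp
    rw [h3] at h2
    calc (D+1:ℝ)^ω * Mg = CT * E^2 * (4*(D+1))^ω * (K * v + 1)^32 := by
          rw [hMg]
          have : (4*(D+1):ℝ)^ω = 2^ω * 2^ω * (D+1)^ω := by rw [← mul_pow, ← mul_pow]; norm_num
          rw [this]; ring
      _ ≤ CT * E^2 * (A1 * L^(θ/8)) * (K * v + 1)^32 := by
          gcongr
          exact h1.trans (by gcongr)
      _ = (CT * A1 * (K * v + 1)^32) * (E^2 * L^(θ/8)) := by ring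
      _ ≤ L^(5*θ/8 - θ/8) * (E^2 * L^(θ/8)) := by gcongr
      _ = L^(7*θ/8) := by
          rw [hE, pow_two, ← Real.rpow_add hLp, ← Real.rpow_add hLp, ← Real.rpow_add hLp]; ring_nf
      _ = L^θ / L^(θ/8) := by rw [← Real.rpow_sub hLp]; ring_nf
      _ ≤ l / v := by gcongr
  have er2 : (4*D + 1:ℝ)^ω * T0 / E ≤ l / v := by
    have h1 := hω2 q hq
    have h2 := hqa (θ/(16*K)) (by positivity)
    have h3 : K * (θ/(16*K)) = θ/16 := by field_simp
    rw [h3] at h2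
    have hT00 : 0 ≤ T0 := by have := mul_pos hc0p hl0; linarith
    calc (4*D + 1:ℝ)^ω * T0 / E ≤ (A2 * L^(θ/16)) * (270*l) / E := by
          gcongr
          exact h1.trans (by gcongr)
      _ = (A2 * 270) * (L^(θ/16)/E) * l := by ring
      _ = (A2 * 270) * l / L^(θ/16) := by
          have : L^(θ/16)/E = 1/L^(θ/16) := by
            rw [div_eq_div_iff (by positivity) (by positivity), one_mul, ← Real.rpow_add hLp, hE]; ring_nf
          rw [this]; ring
      _ ≤ l / v := by
          rw [div_le_div_iff₀ (by positivity) hv0]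
          have := mul_le_mul_of_nonneg_left e3 hl0.le
          linarith only [this]
  have hwin := window (a := fun n => if ∀ p ∈ q.primeFactors, ¬ (¬ p ∣ n ∧ (p:ℤ) ∣ F.eval (n:ℤ)) then (1:ℝ) else 0) (l := l) (B := B)
    (fun n => by split_ifs <;> norm_num) (fun n => by split_ifs <;> norm_num) (by linarith) (by linarith) (by linarith)
  have er3 : 90 * Real.exp (-B^2/4) * (l+2) ≤ l / v := by
    have h1 : Real.exp (-B^2/4) ≤ 1/v^2 := by
      have : (1:ℝ)/v^2 = Real.exp (-(2*B)) := by
        rw [← hexpB, ← Real.exp_nat_mul, Real.exp_neg, one_div]; norm_num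
      rw [this]
      apply Real.exp_le_exp.mpr
      nlinarith only [e8]
    calc 90 * Real.exp (-B^2/4) * (l+2) ≤ 90 * (1/v^2) * (3*l) := by gcongr; linarith
      _ = 270 * l / v^2 := by ring
      _ ≤ l / v := by rw [div_le_div_iff₀ (by positivity) hv0]; nlinarith only [mul_le_mul_of_nonneg_left e7 (mul_pos hl0 hv0).le, mul_pos hl0 hv0]
  have er4 : 8 * l^2 * Real.exp (-l/2 + 3*B/2) ≤ l / v := by
    have h1 : l ≤ 4 * Real.exp (l/4) := by have := Real.add_one_le_exp (l/4); linarith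
    have h2 : Real.exp (-l/2 + 3*B/2) = Real.exp (-(l/4)) * Real.exp (-(l/4) + 3*B/2) := by rw [← Real.exp_add]; ring_nf
    have h3 : Real.exp (-(l/4) + 3*B/2) ≤ 1/v^2 := by
      have : (1:ℝ)/v^2 = Real.exp (-(2*B)) := by
        rw [← hexpB, ← Real.exp_nat_mul, Real.exp_neg, one_div]; norm_num
      rw [this]
      apply Real.exp_le_exp.mpr
      linarith
    have h4 : l * Real.exp (-(l/4)) ≤ 4 := by
      rw [Real.exp_neg, ← div_eq_mul_inv, div_le_iff₀ (Real.exp_pos _)]; exact h1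
    calc 8 * l^2 * Real.exp (-l/2 + 3*B/2) = 8 * l * (l * Real.exp (-(l/4))) * Real.exp (-(l/4) + 3*B/2) := by rw [h2]; ring
      _ ≤ 8 * l * 4 * (1/v^2) := by gcongr
      _ = 32 * l / v^2 := by ring
      _ ≤ l / v := by rw [div_le_div_iff₀ (by positivity) hv0]; nlinarith only [mul_le_mul_of_nonneg_left e7 (mul_pos hl0 hv0).le, mul_pos hl0 hv0]
  -- alpha lower
  have hαl : 8 * v^(-(1/3:ℝ)) ≤ c0 * α := by
    have h1 : (K+2)^(-(1/4:ℝ)) * v^(-(1/4:ℝ)) ≤ (Real.log q + 2)^(-(1/4:ℝ)) := by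
      rw [← Real.mul_rpow (by linarith) hv0.le]
      apply Real.rpow_le_rpow_of_nonpos
      · linarith only [Real.log_nonneg hq1]
      · nlinarith only [hlogq, e7]
      · norm_num
    have h2 : v^(-(1/4:ℝ)) = v^(-(1/3:ℝ)) * v^(1/12:ℝ) := by rw [← Real.rpow_add hv0]; norm_num
    have h3 : 8 ≤ c0 * c * (K+2)^(-(1/4:ℝ)) * v^(1/12:ℝ) := by
      rw [Real.rpow_neg (by linarith)]
      rw [div_le_iff₀ (by positivity)] at e6
      have hp : 0 < (K+2)^(1/4:ℝ) := by positivity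
      rw [mul_assoc, mul_comm (_)⁻¹, ← mul_assoc, ← div_eq_mul_inv, le_div_iff₀ hp]
      linarith
    calc 8 * v^(-(1/3:ℝ)) ≤ (c0 * c * (K+2)^(-(1/4:ℝ)) * v^(1/12:ℝ)) * v^(-(1/3:ℝ)) := by gcongr
      _ = c0 * (c * ((K+2)^(-(1/4:ℝ)) * v^(-(1/4:ℝ)))) := by rw [h2]; ring
      _ ≤ c0 * (c * (Real.log q + 2)^(-(1/4:ℝ))) := by gcongr
      _ ≤ c0 * α := by gcongr
  have hv13 : 1/v ≤ v^(-(1/3:ℝ)) := by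
    rw [one_div, ← Real.rpow_neg_one]
    apply Real.rpow_le_rpow_of_exponent_le (by linarith) (by norm_num)
  have hα0 : 0 ≤ α := by
    have : 0 ≤ c0 * α := le_trans (by positivity) hαl
    exact nonneg_of_mul_nonneg_right this hc0p
  -- combine
  have hfin : ∑ p ∈ (Icc 1 ⌊Real.exp (l+B)⌋₊).filter (fun p : ℕ => p.Prime ∧ |Real.log p - l| ≤ B),
      (if ∀ r ∈ q.primeFactors, ¬ (¬ r ∣ p ∧ (r:ℤ) ∣ F.eval (p:ℤ)) then (1:ℝ) else 0) / (p:ℝ) ≤ 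
      ∑ p ∈ (Icc 1 ⌊Real.exp (l + B)⌋₊).filter (fun p : ℕ => (p.Prime ∧ Int.gcd (F.eval (p:ℤ)) q = 1) ∧ |Real.log p - l| ≤ B), (1:ℝ)/p := by
    rw [Finset.sum_filter, Finset.sum_filter]
    refine Finset.sum_le_sum fun p _ => ?_
    by_cases hp : p.Prime ∧ |Real.log p - l| ≤ B
    · rw [if_pos hp]
      split_ifs with ha hb hb
      · exact le_rfl
      · exfalso
        apply hb
        refine ⟨⟨hp.1, ?_⟩, hp.2⟩
        by_contra hg
        obtain ⟨r, hr, hrd⟩ := Nat.exists_prime_and_dvd hg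
        have hr1 : (r:ℤ) ∣ F.eval (p:ℤ) := (Int.natCast_dvd_natCast.mpr hrd).trans (Int.gcd_dvd_left _ _)
        have hr2 : r ∣ q := Int.natCast_dvd_natCast.mp ((Int.natCast_dvd_natCast.mpr hrd).trans (Int.gcd_dvd_right _ _))
        refine ha r (Nat.mem_primeFactors.mpr ⟨hr, hr2, hq⟩) ⟨fun hrp => ?_, hr1⟩
        have hrp' := (Nat.prime_dvd_prime_iff_eq hr hp.1).mp hrp
        have hple : p ≤ q := by rw [← hrp']; exact Nat.le_of_dvd (Nat.pos_of_ne_zero hq) hr2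
        have : Real.log p ≤ Real.log q := Real.log_le_log (by exact_mod_cast hp.1.pos) (by exact_mod_cast hple)
        have := (abs_le.mp hp.2).1
        nlinarith only [this, hlogq, hl10, hBv, hKv, hv0, (Real.log_le_log (by exact_mod_cast hp.1.pos) (by exact_mod_cast hple) : Real.log (p:ℝ) ≤ Real.log q)]
      · rw [zero_div]; positivity
      · rw [zero_div]
    · rw [if_neg hp]
      split_ifs <;> positivity
  have hab : 4 * l^2 * (v^(-(1/3:ℝ)) / l) ≤ 4 * l^2 * ∑ p ∈ (Icc 1 ⌊Real.exp (l+B)⌋₊).filter (fun p : ℕ => p.Prime ∧ |Real.log p - l| ≤ B),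
      (if ∀ r ∈ q.primeFactors, ¬ (¬ r ∣ p ∧ (r:ℤ) ∣ F.eval (p:ℤ)) then (1:ℝ) else 0) / (p:ℝ) := by
    have h1 : α * (c0 * l) ≤ α * T0 := by gcongr
    have h2 : 8 * v^(-(1/3:ℝ)) * l ≤ c0 * α * l := by gcongr
    have h3 : l / v ≤ v^(-(1/3:ℝ)) * l := by
      rw [div_eq_mul_one_div, mul_comm]; gcongr
    have h4 : 4 * l^2 * (v^(-(1/3:ℝ)) / l) = 4 * (v^(-(1/3:ℝ)) * l) := by field_simp
    rw [h4]
    have hsv' : α * T0 ≤ ∑' n : ℕ, (if ∀ p ∈ q.primeFactors, ¬ (¬ p ∣ n ∧ (p:ℤ) ∣ F.eval (n:ℤ)) then (1:ℝ) else 0) * wt l n +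
      ((D + 1:ℝ)^ω * Mg + (4*D + 1:ℝ)^ω * T0 / E) := by convert hsv
    clear_value T0 α Mg E
    linarith
  have hl2 : (0:ℝ) < 4 * l^2 := by positivity
  have hab2 := le_of_mul_le_mul_left hab hl2
  refine le_trans (le_of_eq ?_) (hab2.trans hfin)
  rw [Real.rpow_neg hv0.le]; field_simp

end S11


namespace S11
open Finset Filter Topology

lemma mertens_up : ∃ C : ℝ, 0 ≤ C ∧ ∀ N : ℕ, 2 ≤ N →
    ∑ p ∈ (Icc 1 N).filter Nat.Prime, (1:ℝ)/p ≤ 6 * Real.log (Real.log N) + C := by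
  have l2 := Real.log_two_gt_d9
  have l2' := Real.log_two_lt_d9
  set h : ℕ → ℝ := fun n => 1/(((max n 2 : ℕ):ℝ) * Real.log ((max n 2 : ℕ):ℝ)) with hh
  have hpos : ∀ n : ℕ, 0 < Real.log ((max n 2 : ℕ):ℝ) := by
    intro n; apply Real.log_pos; exact_mod_cast (by omega : 1 < max n 2)
  have hsum : ∀ N : ℕ, 2 ≤ N → ∑ n ∈ Icc 1 N, h n ≤ Real.log (Real.log N) + (1/Real.log 2 - Real.log (Real.log 2)) := by
    intro N hN
    induction N, hN using Nat.le_induction with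
    | base =>
      rw [show Icc 1 2 = ({1,2} : Finset ℕ) from rfl, Finset.sum_pair (by norm_num)]
      simp only [hh]
      norm_num
      field_simp
      linarith
    | succ N hN ih =>
      rw [Finset.sum_Icc_succ_top (by omega)]
      have hN' : (2:ℝ) ≤ N := by exact_mod_cast hN
      have a0 : 0 < Real.log N := Real.log_pos (by linarith)
      have a1 : 0 < Real.log (N+1:ℝ) := Real.log_pos (by linarith)
      have b1 : 1/((N:ℝ)+1) ≤ Real.log (N+1:ℝ) - Real.log N := by
        have := Real.one_sub_inv_le_log_of_pos (x := ((N:ℝ)+1)/N) (by positivity)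
        rw [Real.log_div (by positivity) (by positivity)] at this
        refine le_trans (le_of_eq ?_) this
        field_simp; ring
      have b2 : 1 - Real.log N / Real.log (N+1:ℝ) ≤ Real.log (Real.log (N+1:ℝ)) - Real.log (Real.log N) := by
        have := Real.one_sub_inv_le_log_of_pos (x := Real.log (N+1:ℝ)/Real.log N) (by positivity)
        rw [Real.log_div (by positivity) (by positivity), inv_div] at this
        exact this
      have b3 : h (N+1) ≤ 1 - Real.log N / Real.log (N+1:ℝ) := by
        simp only [hh]
        rw [max_eq_left (by omega)]
        push_cast
        rw [one_div, mul_inv, ← one_div, ← div_eq_mul_inv, div_le_iff₀ a1]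
        have : (1 - Real.log N / Real.log (N+1:ℝ)) * Real.log (N+1:ℝ) = Real.log (N+1:ℝ) - Real.log N := by field_simp
        linarith
      push_cast
      linarith
  have hsv := sum_vM_le h (fun n _ => by have := hpos n; positivity) (fun n _ => by
    have := hpos n
    have hm : max n 2 ≤ max (n+1) 2 := by omega
    have h0 : (0:ℝ) < ((max n 2 : ℕ):ℝ) := by exact_mod_cast (by omega : 0 < max n 2)
    have hm' : ((max n 2 : ℕ):ℝ) ≤ ((max (n+1) 2 : ℕ):ℝ) := by exact_mod_cast hm
    simp only [hh]
    have := Real.log_le_log h0 hm'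
    gcongr)
  refine ⟨|6 * (1/Real.log 2 - Real.log (Real.log 2))|, abs_nonneg _, fun N hN => ?_⟩
  calc _ ≤ ∑ p ∈ Icc 1 N, ArithmeticFunction.vonMangoldt p * h p := by
        rw [Finset.sum_filter]
        refine Finset.sum_le_sum fun p hp => ?_
        split_ifs with hpp
        · rw [ArithmeticFunction.vonMangoldt_apply_prime hpp]
          simp only [hh]
          rw [max_eq_left hpp.two_le]
          have : 0 < Real.log p := Real.log_pos (by exact_mod_cast hpp.one_lt)
          have : (0:ℝ) < p := by exact_mod_cast hpp.pos
          apply le_of_eq; field_simp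
        · have := hpos p
          have := ArithmeticFunction.vonMangoldt_nonneg (n := p)
          positivity
    _ ≤ 6 * ∑ p ∈ Icc 1 N, h p := hsv N
    _ ≤ _ := by have := hsum N hN; have := le_abs_self (6 * (1/Real.log 2 - Real.log (Real.log 2))); linarith

lemma harm_lower {a b : ℕ} (ha : 1 ≤ a) (hab : a ≤ b) : Real.log (b+1) - Real.log a ≤ ∑ k ∈ Icc a b, (1:ℝ)/k := by
  induction b, hab using Nat.le_induction with
  | base =>
    simp only [Finset.Icc_self, Finset.sum_singleton]
    have h0 : (0:ℝ) < a := by exact_mod_cast ha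
    have := Real.log_le_sub_one_of_pos (x := ((a:ℝ)+1)/a) (by positivity)
    rw [Real.log_div (by positivity) (by positivity)] at this
    refine this.trans (le_of_eq ?_)
    field_simp; ring
  | succ b hb ih =>
    rw [Finset.sum_Icc_succ_top (by omega)]
    have h0 : (0:ℝ) < (b:ℝ)+1 := by positivity
    have := Real.log_le_sub_one_of_pos (x := ((b:ℝ)+1+1)/(b+1)) (by positivity)
    rw [Real.log_div (by positivity) (by positivity)] at this
    have e : ((b:ℝ)+1+1)/(b+1) - 1 = 1/((b:ℝ)+1) := by field_simp; ring
    push_cast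
    linarith

def gp (F : Polynomial ℤ) (q p : ℕ) : Prop := p.Prime ∧ Int.gcd (F.eval (p:ℤ)) q = 1

instance (F : Polynomial ℤ) (q : ℕ) : DecidablePred (gp F q) := fun _ => by unfold gp; infer_instance

/-- conclusion of `propA` -/
def PA (F : Polynomial ℤ) (q : ℕ) (L θ : ℝ) : Prop :=
  ∀ l : ℝ, L^θ ≤ l → 1/((Real.log L)^(1/3:ℝ) * l) ≤
        ∑ p ∈ (Icc 1 ⌊Real.exp (l + Real.log (Real.log L))⌋₊).filter (fun p : ℕ => gp F q p ∧
          |Real.log p - l| ≤ Real.log (Real.log L)), (1:ℝ)/p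

lemma S_lower {θ : ℝ} (hθ : 0 < θ) (hθ2 : θ ≤ 1/2) : ∀ᶠ L : ℝ in atTop, ∀ (F : Polynomial ℤ) (q : ℕ), PA F q L θ →
    (Real.log L)^(1/2:ℝ) ≤ ∑ p ∈ (Icc 1 ⌊Real.exp (L^(9/10:ℝ))⌋₊).filter (fun p : ℕ => gp F q p ∧ ⌊Real.exp (L^θ)⌋₊ < p), (1:ℝ)/p := by
  have e1 := ev_pow (a := 1/10) (by norm_num) 4 1 0 zero_le_one le_rfl 1
  have e2 := (ev_pow (a := 1/6) (by norm_num) 15 1 0 zero_le_one le_rfl 1)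
  have e2' := Real.tendsto_log_atTop.eventually e2
  have e3 : ∀ᶠ L : ℝ in atTop, 1000 ≤ Real.log L := Real.tendsto_log_atTop.eventually_ge_atTop _
  filter_upwards [e1, e2', e3, ev_B, eventually_ge_atTop 1] with L e1 e2 e3 e8 hL1
  intro F q hPA
  simp only [pow_one, one_mul, add_zero] at e1 e2
  set v := Real.log L with hv
  set B := Real.log v with hB
  have hv0 : 0 < v := by linarith
  have hLp : 0 < L := by linarith
  have hBv : B ≤ v := by have := Real.log_le_sub_one_of_pos hv0; linarith
  have hB0 : 0 < B := by linarith
  have hLθ1 : 1 ≤ L^θ := Real.one_le_rpow hL1 hθ.le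
  have hL81 : 1 ≤ L^(8/10:ℝ) := Real.one_le_rpow hL1 (by norm_num)
  set a := ⌈L^θ⌉₊ with ha
  set b := ⌊L^(8/10:ℝ)⌋₊ with hb
  have ha1 : L^θ ≤ a := Nat.le_ceil _
  have ha2 : (a:ℝ) ≤ 2 * L^θ := by have := Nat.ceil_lt_add_one (a := L^θ) (by linarith); linarith
  have hb1 : (b:ℝ) ≤ L^(8/10:ℝ) := Nat.floor_le (by linarith)
  have hb2 : L^(8/10:ℝ) < b + 1 := Nat.lt_floor_add_one _
  have ha0 : 1 ≤ a := by
    have : (1:ℝ) ≤ a := by linarith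
    exact_mod_cast this
  have hlog : v/5 ≤ Real.log (b+1) - Real.log a := by
    have h1 : Real.log (L^(8/10:ℝ)) ≤ Real.log (b+1) := Real.log_le_log (by positivity) hb2.le
    have h2 : Real.log a ≤ Real.log (2 * L^θ) := Real.log_le_log (by linarith) ha2
    rw [Real.log_rpow hLp] at h1
    rw [Real.log_mul (by norm_num) (by positivity), Real.log_rpow hLp] at h2
    have := Real.log_two_lt_d9
    nlinarith
  have hab : a ≤ b := by
    by_contra hcon
    have : (b:ℝ)+1 ≤ a := by exact_mod_cast (by omega : b+1 ≤ a)
    have := Real.log_le_log (by positivity) this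
    linarith
  have hharm := harm_lower ha0 hab
  set W : ℕ → Finset ℕ := fun k => (Icc 1 ⌊Real.exp (3*B*k + B)⌋₊).filter (fun p : ℕ => gp F q p ∧ |Real.log p - 3*B*k| ≤ B) with hW
  have hWl : ∀ k ∈ Icc a b, 1/(v^(1/3:ℝ) * (3*B)) * (1/k) ≤ ∑ p ∈ W k, (1:ℝ)/p := by
    intro k hk
    have hka : (a:ℝ) ≤ k := by exact_mod_cast (Finset.mem_Icc.mp hk).1
    have := hPA (3*B*k) (by nlinarith)
    refine le_trans (le_of_eq ?_) this
    rw [div_mul_div_comm, one_mul, mul_assoc]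
  have hdisj : (↑(Icc a b) : Set ℕ).PairwiseDisjoint W := by
    intro j _ k _ hjk
    rw [Function.onFun, Finset.disjoint_left]
    intro p hj hk
    simp only [hW, Finset.mem_filter] at hj hk
    apply hjk
    have h1 := abs_le.mp hj.2.2
    have h2 := abs_le.mp hk.2.2
    have h3 : ((j:ℝ) - k) * (3*B) ≤ 2 * B := by linarith
    have h4 : ((k:ℝ) - j) * (3*B) ≤ 2 * B := by linarith
    have h5 : (j:ℝ) - k < 1 := by by_contra h; push Not at h; nlinarith
    have h6 : (k:ℝ) - j < 1 := by by_contra h; push Not at h; nlinarith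
    have h7 : (j:ℝ) < k + 1 := by linarith
    have h8 : (k:ℝ) < j + 1 := by linarith
    have h7' : j < k + 1 := by exact_mod_cast h7
    have h8' : k < j + 1 := by exact_mod_cast h8
    omega
  have hsub : (Icc a b).biUnion W ⊆ (Icc 1 ⌊Real.exp (L^(9/10:ℝ))⌋₊).filter (fun p : ℕ => gp F q p ∧ ⌊Real.exp (L^θ)⌋₊ < p) := by
    intro p hp
    rw [Finset.mem_biUnion] at hp
    obtain ⟨k, hk, hp⟩ := hp
    simp only [hW, Finset.mem_filter, Finset.mem_Icc] at hp ⊢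
    have hka : (a:ℝ) ≤ k := by exact_mod_cast (Finset.mem_Icc.mp hk).1
    have hkb : (k:ℝ) ≤ b := by exact_mod_cast (Finset.mem_Icc.mp hk).2
    have h1 := abs_le.mp hp.2.2
    have hp0 : (0:ℝ) < p := by exact_mod_cast hp.1.1
    refine ⟨⟨hp.1.1, Nat.le_floor ?_⟩, hp.2.1, ?_⟩
    · rw [← Real.log_le_iff_le_exp hp0]
      have : L^(9/10:ℝ) = L^(1/10:ℝ) * L^(8/10:ℝ) := by rw [← Real.rpow_add hLp]; norm_num
      rw [this]
      have h2 : (4 * B) * L^(8/10:ℝ) ≤ L^(1/10:ℝ) * L^(8/10:ℝ) := by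
        apply mul_le_mul_of_nonneg_right _ (by linarith); linarith
      have h3 : 3*B*k ≤ 3*B*L^(8/10:ℝ) := by apply mul_le_mul_of_nonneg_left _ (by linarith); linarith
      have h4 : B * 1 ≤ B * L^(8/10:ℝ) := by gcongr
      linarith
    · rw [Nat.floor_lt (Real.exp_nonneg _), ← Real.lt_log_iff_exp_lt hp0]
      have h3 : 3*B*L^θ ≤ 3*B*k := by apply mul_le_mul_of_nonneg_left _ (by linarith); linarith
      nlinarith
  calc v^(1/2:ℝ) ≤ 1/(v^(1/3:ℝ) * (3*B)) * (v/5) := by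
        have : v = v^(1/2:ℝ) * v^(1/3:ℝ) * v^(1/6:ℝ) := by
          rw [← Real.rpow_add hv0, ← Real.rpow_add hv0]; norm_num
        rw [div_mul_eq_mul_div, one_mul, le_div_iff₀ (by positivity)]
        calc v^(1/2:ℝ) * (v^(1/3:ℝ) * (3*B)) = v^(1/2:ℝ) * v^(1/3:ℝ) * (15 * B)/5 := by ring
          _ ≤ v^(1/2:ℝ) * v^(1/3:ℝ) * (v^(1/6:ℝ))/5 := by gcongr
          _ = v/5 := by rw [← this]
    _ ≤ 1/(v^(1/3:ℝ) * (3*B)) * ∑ k ∈ Icc a b, (1:ℝ)/k := by gcongr; linarith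
    _ ≤ ∑ k ∈ Icc a b, ∑ p ∈ W k, (1:ℝ)/p := by rw [Finset.mul_sum]; exact Finset.sum_le_sum hWl
    _ = ∑ p ∈ (Icc a b).biUnion W, (1:ℝ)/p := (Finset.sum_biUnion hdisj).symm
    _ ≤ _ := Finset.sum_le_sum_of_subset_of_nonneg hsub fun _ _ _ => by positivity

lemma pi_lower {θ : ℝ} (hθ : 0 < θ) (hθ2 : θ ≤ 1/2) : ∀ᶠ L : ℝ in atTop, ∀ (F : Polynomial ℤ) (q : ℕ), PA F q L θ →
    ∀ Z : ℝ, 0 < Z → L/4 ≤ Real.log Z → Real.log Z ≤ L → Z/((Real.log L)^3 * L) ≤ 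
      (((Icc 1 ⌊Z⌋₊).filter (fun p : ℕ => gp F q p ∧ ⌊Real.exp (L^(9/10:ℝ))⌋₊ < p)).card : ℝ) := by
  have e1 := ev_pow (a := 1/10) (by norm_num) 32 1 0 zero_le_one le_rfl 1
  have e3 : ∀ᶠ L : ℝ in atTop, 1000 ≤ Real.log L := Real.tendsto_log_atTop.eventually_ge_atTop _
  filter_upwards [e1, e3, ev_B, eventually_ge_atTop 1] with L e1 e3 e8 hL1
  intro F q hPA Z hZ hZ1 hZ2
  simp only [pow_one, one_mul, add_zero] at e1
  set v := Real.log L with hv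
  set B := Real.log v with hB
  have hv0 : 0 < v := by linarith
  have hLp : 0 < L := by linarith
  have hBv : B ≤ v := by have := Real.log_le_sub_one_of_pos hv0; linarith
  have hvL : v ≤ L := by have := Real.log_le_sub_one_of_pos hLp; linarith
  have hB0 : 0 < B := by linarith
  have hexpB : Real.exp B = v := Real.exp_log hv0
  have h9 : L = L^(1/10:ℝ) * L^(9/10:ℝ) := by rw [← Real.rpow_add hLp]; norm_num
  have h91 : 1 ≤ L^(9/10:ℝ) := Real.one_le_rpow hL1 (by norm_num)
  have h9θ : L^θ ≤ L^(9/10:ℝ) := Real.rpow_le_rpow_of_exponent_le hL1 (by linarith)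
  have h16 : 32 * v * L^(9/10:ℝ) ≤ L := by
    nth_rewrite 2 [h9]; gcongr
  have hbig : 4 * B + 2 * L^(9/10:ℝ) ≤ L/4 := by
    have h17 : v*1 ≤ v*L^(9/10:ℝ) := by gcongr
    have h18 : 1000*L^(9/10:ℝ) ≤ v*L^(9/10:ℝ) := by gcongr
    linarith
  set l := Real.log Z - B with hl
  have hPl := hPA l (by linarith)
  have hlB : l + B = Real.log Z := by rw [hl]; ring
  have hl0 : 0 < l := by linarith
  rw [← hB, hlB, Real.exp_log hZ] at hPl
  set U := (Icc 1 ⌊Z⌋₊).filter (fun p : ℕ => gp F q p ∧ |Real.log p - l| ≤ B) with hU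
  have h1 : ∑ p ∈ U, (1:ℝ)/p ≤ U.card * (v^2/Z) := by
    rw [← nsmul_eq_mul]
    refine Finset.sum_le_card_nsmul _ _ _ fun p hp => ?_
    simp only [hU, Finset.mem_filter, Finset.mem_Icc] at hp
    have hp0 : (0:ℝ) < p := by exact_mod_cast hp.1.1
    have h := abs_le.mp hp.2.2
    rw [div_le_div_iff₀ hp0 hZ, one_mul]
    have : Z = Real.exp (Real.log Z - 2*B) * v^2 := by
      rw [← hexpB, ← Real.exp_nat_mul, ← Real.exp_add]
      push_cast
      rw [sub_add_cancel, Real.exp_log hZ]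
    rw [this, mul_comm]
    gcongr
    rw [← Real.le_log_iff_exp_le hp0]; linarith
  have h2 : (U.card:ℝ) ≤ (((Icc 1 ⌊Z⌋₊).filter (fun p : ℕ => gp F q p ∧ ⌊Real.exp (L^(9/10:ℝ))⌋₊ < p)).card : ℝ) := by
    have : U ⊆ (Icc 1 ⌊Z⌋₊).filter (fun p : ℕ => gp F q p ∧ ⌊Real.exp (L^(9/10:ℝ))⌋₊ < p) := by
      intro p hp
      simp only [hU, Finset.mem_filter, Finset.mem_Icc] at hp ⊢
      refine ⟨hp.1, hp.2.1, ?_⟩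
      have hp0 : (0:ℝ) < p := by exact_mod_cast hp.1.1
      have h := abs_le.mp hp.2.2
      rw [Nat.floor_lt (Real.exp_nonneg _), ← Real.lt_log_iff_exp_lt hp0]
      linarith
    exact_mod_cast Finset.card_le_card this
  refine le_trans ?_ h2
  have h3 : 1/(v^(1/3:ℝ) * l) ≤ U.card * (v^2/Z) := hPl.trans h1
  have h4 : v^(1/3:ℝ) ≤ v := by
    calc v^(1/3:ℝ) ≤ v^(1:ℝ) := Real.rpow_le_rpow_of_exponent_le (by linarith) (by norm_num)
      _ = v := Real.rpow_one v
  have h5 : 1/(v * L) ≤ 1/(v^(1/3:ℝ) * l) := by gcongr; linarith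
  have h6 : 1/(v*L) ≤ U.card * (v^2/Z) := h5.trans h3
  calc Z/(v^3*L) = (1/(v*L)) * (Z/v^2) := by rw [div_mul_div_comm, one_mul]; congr 1; ring
    _ ≤ (U.card * (v^2/Z)) * (Z/v^2) := by gcongr
    _ = U.card := by
      rw [mul_assoc, div_mul_div_comm, mul_comm Z, div_self (by positivity), mul_one]

end S11


namespace S11
open Finset Filter Topology

lemma decomp (Y n : ℕ) (hn : 0 < n) (hsq : ∀ p : ℕ, p.Prime → Y < p → ¬ p^2 ∣ n) :
    ∃ (m : ℕ) (R : Finset ℕ), 0 < m ∧ (∀ p : ℕ, p.Prime → p ∣ m → p ≤ Y) ∧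
      (∀ p ∈ R, p.Prime ∧ Y < p) ∧ n = m * ∏ p ∈ R, p := by
  set R := n.primeFactors.filter (Y < ·) with hR
  have hRp : ∀ p ∈ R, p.Prime ∧ Y < p := by
    intro p hp
    simp only [hR, Finset.mem_filter] at hp
    exact ⟨Nat.prime_of_mem_primeFactors hp.1, hp.2⟩
  have hdvd : ∏ p ∈ R, p ∣ n :=
    (Finset.prod_dvd_prod_of_subset _ _ _ (Finset.filter_subset _ _)).trans (Nat.prod_primeFactors_dvd n)
  obtain ⟨m, hm⟩ := hdvd
  have hm' : n = m * ∏ p ∈ R, p := by rw [hm, mul_comm]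
  refine ⟨m, R, Nat.pos_of_ne_zero (by rintro rfl; simp at hm'; omega), ?_, hRp, hm'⟩
  intro p hp hpm
  by_contra hY
  push Not at hY
  apply hsq p hp hY
  have hpR : p ∈ R := by
    simp only [hR, Finset.mem_filter]
    exact ⟨Nat.mem_primeFactors.mpr ⟨hp, hpm.trans ⟨_, hm'⟩, hn.ne'⟩, hY⟩
  rw [hm', pow_two]
  exact mul_dvd_mul hpm (Finset.dvd_prod_of_mem (fun p => p) hpR)

lemma lpf_cases (m : ℕ) : largestPrimeFactor m = 1 ∨ ((largestPrimeFactor m).Prime ∧ largestPrimeFactor m ∣ m) := by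
  unfold largestPrimeFactor
  by_cases h : 0 < (m.primeFactorsList).reverse.length
  · right
    rw [List.getD_eq_getElem _ _ h]
    have := List.getElem_mem h
    rw [List.mem_reverse] at this
    exact ⟨Nat.prime_of_mem_primeFactorsList this, Nat.dvd_of_mem_primeFactorsList this⟩
  · left
    rw [List.getD_eq_default _ _ (by omega)]

lemma conv_of (δ x : ℝ) (n m : ℕ) (R : Finset ℕ) (hm : 0 < m) (hnx : (n:ℝ) ≤ x)
    (hmY : ∀ p : ℕ, p.Prime → p ∣ m → p ≤ ⌊Real.exp (Real.log x ^ (δ / 2))⌋₊)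
    (hR : ∀ p ∈ R, p.Prime ∧ ⌊Real.exp (Real.log x ^ (δ / 2))⌋₊ < p)
    (hn : n = m * ∏ p ∈ R, p) (hJ : ⌊Real.log (Real.log (Real.log x))⌋₊ ≤ R.card) :
    convenient δ x n := by
  set Y := ⌊Real.exp (Real.log x ^ (δ / 2))⌋₊ with hY
  unfold convenient
  set J := ⌊Real.log (Real.log (Real.log x))⌋₊ with hJd
  have hRpos : 0 < ∏ p ∈ R, p := Finset.prod_pos fun p hp => (hR p hp).1.pos
  have hnpos : 0 < n := by rw [hn]; positivity
  refine ⟨hnpos, hnx, ?_⟩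
  set e := R.orderEmbOfFin rfl with he
  set Ps : Fin J → ℕ := fun i => e ⟨R.card - 1 - i, by have := i.2; omega⟩ with hPs
  have hPsR : ∀ i, Ps i ∈ R := fun i => Finset.orderEmbOfFin_mem R rfl _
  have hanti : StrictAnti Ps := by
    intro i j hij
    simp only [hPs]
    apply e.strictMono
    rw [Fin.lt_def]
    have := j.2
    have : (i:ℕ) < j := hij
    simp only
    omega
  set T := Finset.univ.image Ps with hT
  have hTR : T ⊆ R := by
    intro t ht
    rw [hT, Finset.mem_image] at ht
    obtain ⟨i, _, rfl⟩ := ht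
    exact hPsR i
  have hprodT : ∏ p ∈ T, p = ∏ i, Ps i := Finset.prod_image (fun i _ j _ h => hanti.injective h)
  have hprod : ∏ p ∈ R, p = (∏ p ∈ R \ T, p) * ∏ i, Ps i := by
    rw [← hprodT, Finset.prod_sdiff hTR]
  have hlt : ∀ r ∈ R \ T, ∀ i, r < Ps i := by
    intro r hr i
    rw [Finset.mem_sdiff] at hr
    have hrange : r ∈ Set.range e := by rw [he, Finset.range_orderEmbOfFin]; exact hr.1
    obtain ⟨k, rfl⟩ := hrange
    simp only [hPs]
    apply e.strictMono
    rw [Fin.lt_def]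
    simp only
    by_contra hcon
    push Not at hcon
    apply hr.2
    rw [hT, Finset.mem_image]
    have hi := i.2
    have hk := k.2
    refine ⟨⟨R.card - 1 - k, by omega⟩, Finset.mem_univ _, ?_⟩
    simp only [hPs]
    congr 1
    ext
    simp only
    omega
  have hn' : n = (m * ∏ p ∈ R \ T, p) * ∏ i, Ps i := by rw [hn, hprod, mul_assoc]
  have hm'pos : 0 < m * ∏ p ∈ R \ T, p :=
    Nat.mul_pos hm (Finset.prod_pos fun p hp => (hR p (Finset.sdiff_subset hp)).1.pos)
  refine ⟨m * ∏ p ∈ R \ T, p, Ps, hm'pos, fun i => (hR _ (hPsR i)).1, hanti, ?_, ?_, hn'⟩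
  · intro i
    refine ⟨?_, ?_⟩
    · rcases lpf_cases (m * ∏ p ∈ R \ T, p) with h | ⟨h1, h2⟩
      · rw [h]; exact_mod_cast (hR _ (hPsR i)).1.one_lt
      · rcases (Nat.Prime.dvd_mul h1).mp h2 with h3 | h3
        · have := hmY _ h1 h3
          exact_mod_cast lt_of_le_of_lt this (hR _ (hPsR i)).2
        · obtain ⟨r, hr, h4⟩ := (Prime.dvd_finset_prod_iff h1.prime _).mp h3
          rw [(Nat.prime_dvd_prime_iff_eq h1 (hR r (Finset.sdiff_subset hr)).1).mp h4]
          exact_mod_cast hlt r hr i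
    · exact (Nat.floor_lt (Real.exp_nonneg _)).mp (hR _ (hPsR i)).2
  · rw [le_div_iff₀ (by exact_mod_cast hm'pos), mul_comm]
    refine le_trans (le_of_eq ?_) hnx
    rw [hn']
    push_cast
    ring

/-- multiplicativity on products with distinct primes. -/
lemma f_prod {f : ℕ → ℤ} {F : Polynomial ℤ} (hf1 : f 1 = 1)
    (hfm : ∀ m n : ℕ, Nat.Coprime m n → f (m * n) = f m * f n)
    (hfp : ∀ p : ℕ, p.Prime → f p = F.eval (p : ℤ)) (T : Finset ℕ) (hT : ∀ p ∈ T, p.Prime) :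
    f (∏ p ∈ T, p) = ∏ p ∈ T, F.eval (p:ℤ) := by
  induction T using Finset.induction_on with
  | empty => simp [hf1]
  | insert a s ha ih =>
    rw [Finset.prod_insert ha, Finset.prod_insert ha, hfm, ih (fun p hp => hT p (Finset.mem_insert_of_mem hp)),
      hfp a (hT a (Finset.mem_insert_self _ _))]
    apply Nat.Coprime.prod_right
    intro i hi
    apply (Nat.coprime_primes (hT a (Finset.mem_insert_self _ _)) (hT i (Finset.mem_insert_of_mem hi))).mpr
    rintro rfl; exact ha hi

lemma cop_sm {Y m : ℕ} (hmY : ∀ p : ℕ, p.Prime → p ∣ m → p ≤ Y) (T : Finset ℕ)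
    (hT : ∀ p ∈ T, p.Prime ∧ Y < p) : Nat.Coprime m (∏ p ∈ T, p) := by
  apply Nat.Coprime.prod_right
  intro p hp
  apply Nat.Coprime.symm
  rw [Nat.Prime.coprime_iff_not_dvd (hT p hp).1]
  intro h
  have := hmY p (hT p hp).1 h
  have := (hT p hp).2
  omega

lemma gcd_mul_one_left {a b : ℤ} {q : ℕ} (h : Int.gcd (a*b) q = 1) : Int.gcd a q = 1 := by
  rw [← Int.isCoprime_iff_gcd_eq_one] at h ⊢
  exact h.of_mul_left_left

lemma gcd_mul_one {a b : ℤ} {q : ℕ} (h : Int.gcd a q = 1) (h' : Int.gcd b q = 1) : Int.gcd (a*b) q = 1 := by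
  rw [← Int.isCoprime_iff_gcd_eq_one] at h h' ⊢
  exact h.mul_left h'

lemma gcd_prod_one {F : Polynomial ℤ} {q : ℕ} (T : Finset ℕ) (hT : ∀ p ∈ T, gp F q p) :
    Int.gcd (∏ p ∈ T, F.eval (p:ℤ)) q = 1 := by
  rw [← Int.isCoprime_iff_gcd_eq_one]
  apply IsCoprime.prod_left
  intro p hp
  rw [Int.isCoprime_iff_gcd_eq_one]
  exact (hT p hp).2

lemma alpha_local {F : Polynomial ℤ} {q : ℕ} (h : alpha F q ≠ 0) :
    ∀ p ∈ q.primeFactors, ∃ a : ℤ, ¬ (p:ℤ) ∣ a * F.eval a := by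
  intro p hp
  have : ({a : ℕ | a < q ∧ Int.gcd ((a : ℤ) * F.eval (a : ℤ)) (q : ℤ) = 1}).Nonempty := by
    by_contra hcon
    rw [Set.not_nonempty_iff_eq_empty] at hcon
    apply h
    unfold alpha
    rw [hcon]; simp
  obtain ⟨a, _, ha⟩ := this
  refine ⟨a, fun hd => ?_⟩
  have hq : (p:ℤ) ∣ q := by exact_mod_cast Nat.dvd_of_mem_primeFactors hp
  have := Int.dvd_coe_gcd hd hq
  rw [ha] at this
  have h1 : p ∣ 1 := by exact_mod_cast this
  exact (Nat.prime_of_mem_primeFactors hp).one_lt.ne' (Nat.dvd_one.mp h1)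

/-- The set of small parts. -/
noncomputable def MM (f : ℕ → ℤ) (q Y : ℕ) (x : ℝ) : Finset ℕ := by
  classical
  exact (Icc 1 ⌊√x⌋₊).filter (fun m => (∀ p : ℕ, p.Prime → p ∣ m → p ≤ Y) ∧ Int.gcd (f m) q = 1)

lemma mem_MM {f : ℕ → ℤ} {q Y : ℕ} {x : ℝ} {m : ℕ} : m ∈ MM f q Y x ↔
    (1 ≤ m ∧ m ≤ ⌊√x⌋₊) ∧ (∀ p : ℕ, p.Prime → p ∣ m → p ≤ Y) ∧ Int.gcd (f m) q = 1 := by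
  classical
  unfold MM
  rw [Finset.mem_filter, Finset.mem_Icc]

lemma one_le_SM {f : ℕ → ℤ} (hf1 : f 1 = 1) {q Y : ℕ} {x : ℝ} (hx : 1 ≤ x) :
    1 ≤ ∑ m ∈ MM f q Y x, (1:ℝ)/m := by
  have h1 : 1 ∈ MM f q Y x := by
    rw [mem_MM]
    refine ⟨⟨le_rfl, Nat.le_floor ?_⟩, ?_, ?_⟩
    · push_cast; exact Real.one_le_sqrt.mpr hx
    · intro p hp h; exact absurd (Nat.dvd_one.mp h) hp.one_lt.ne'
    · rw [hf1]; simp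
  have := Finset.single_le_sum (f := fun m : ℕ => (1:ℝ)/m) (fun _ _ => by positivity) h1
  simpa using this

lemma cnt_eq (x : ℝ) (P : ℕ → Prop) [DecidablePred P] : cnt x P = ((Icc 1 ⌊x⌋₊).filter P).card := by
  unfold cnt
  rw [← Set.ncard_coe_finset]
  congr 1
  ext n
  simp only [Set.mem_setOf_eq, Finset.coe_filter, Finset.mem_Icc]
  constructor
  · rintro ⟨h0, h1, h2⟩; exact ⟨⟨h0, Nat.le_floor h1⟩, h2⟩
  · rintro ⟨⟨h0, h1⟩, h2⟩; exact ⟨h0, (Nat.le_floor_iff' (by omega)).mp h1, h2⟩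

end S11


namespace S11
open Finset Filter Topology

lemma dvd_triple {m p r : ℕ} {T : Finset ℕ} (hT : ∀ p ∈ T, p.Prime) (hp : p.Prime) (hr : r.Prime)
    (h : r ∣ m * (∏ t ∈ T, t) * p) : r ∣ m ∨ r ∈ T ∨ r = p := by
  rcases (Nat.Prime.dvd_mul hr).mp h with h | h
  · rcases (Nat.Prime.dvd_mul hr).mp h with h | h
    · exact Or.inl h
    · obtain ⟨t, ht, h4⟩ := (Prime.dvd_finsetProd_iff hr.prime _).mp h
      rw [(Nat.prime_dvd_prime_iff_eq hr (hT t ht)).mp h4]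
      exact Or.inr (Or.inl ht)
  · exact Or.inr (Or.inr ((Nat.prime_dvd_prime_iff_eq hr hp).mp h))

lemma triple_sub {Y Z m p m' p' : ℕ} {T T' : Finset ℕ}
    (hYZ : Y ≤ Z)
    (hT : ∀ p ∈ T, p.Prime ∧ Y < p ∧ p ≤ Z) (hp : p.Prime ∧ Z < p)
    (hm' : ∀ p : ℕ, p.Prime → p ∣ m' → p ≤ Y)
    (hT' : ∀ p ∈ T', p.Prime ∧ Y < p ∧ p ≤ Z) (hp' : p'.Prime ∧ Z < p')
    (h : m * (∏ t ∈ T, t) * p = m' * (∏ t ∈ T', t) * p') : p = p' ∧ T ⊆ T' := by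
  constructor
  · have hd : p ∣ m' * (∏ t ∈ T', t) * p' := h ▸ Dvd.intro_left _ rfl
    rcases dvd_triple (fun t ht => (hT' t ht).1) hp'.1 hp.1 hd with h1 | h1 | h1
    · have := hm' p hp.1 h1; omega
    · have := (hT' p h1).2.2; omega
    · exact h1
  · intro r hr
    have hd : r ∣ m' * (∏ t ∈ T', t) * p' := by
      rw [← h]
      exact Dvd.dvd.mul_right (Dvd.dvd.mul_left (Finset.dvd_prod_of_mem (fun t => t) hr) _) _
    have hr' := hT r hr
    rcases dvd_triple (fun t ht => (hT' t ht).1) hp'.1 hr'.1 hd with h1 | h1 | h1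
    · have := hm' r hr'.1 h1; omega
    · exact h1
    · omega

lemma triple_inj {Y Z m p m' p' : ℕ} {T T' : Finset ℕ}
    (hYZ : Y ≤ Z) (hm : ∀ p : ℕ, p.Prime → p ∣ m → p ≤ Y)
    (hT : ∀ p ∈ T, p.Prime ∧ Y < p ∧ p ≤ Z) (hp : p.Prime ∧ Z < p)
    (hm' : ∀ p : ℕ, p.Prime → p ∣ m' → p ≤ Y)
    (hT' : ∀ p ∈ T', p.Prime ∧ Y < p ∧ p ≤ Z) (hp' : p'.Prime ∧ Z < p')
    (h : m * (∏ t ∈ T, t) * p = m' * (∏ t ∈ T', t) * p') : m = m' ∧ T = T' ∧ p = p' := by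
  have h1 := triple_sub hYZ hT hp hm' hT' hp' h
  have h2 := triple_sub hYZ hT' hp' hm hT hp h.symm
  have e1 : T = T' := h1.2.antisymm h2.2
  have e2 := h1.1
  subst e1 e2
  refine ⟨?_, rfl, rfl⟩
  have h3 := Nat.eq_of_mul_eq_mul_right hp.1.pos h
  exact Nat.eq_of_mul_eq_mul_right (Finset.prod_pos fun t ht => (hT t ht).1.pos) h3

/-- large-prime product sets used in the lower bound. -/
noncomputable def TT (F : Polynomial ℤ) (q Y Z : ℕ) (X : ℝ) : Finset (Finset ℕ) := by
  classical
  exact ((Icc 1 Z).filter (fun p => gp F q p ∧ Y < p)).powerset.filter (fun T => ((∏ p ∈ T, p : ℕ) : ℝ) ≤ X)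

lemma mem_TT {F : Polynomial ℤ} {q Y Z : ℕ} {X : ℝ} {T : Finset ℕ} (h : T ∈ TT F q Y Z X) :
    (∀ p ∈ T, gp F q p ∧ Y < p ∧ p ≤ Z) ∧ ((∏ p ∈ T, p : ℕ) : ℝ) ≤ X := by
  classical
  unfold TT at h
  rw [Finset.mem_filter, Finset.mem_powerset] at h
  refine ⟨fun p hp => ?_, h.2⟩
  have := h.1 hp
  rw [Finset.mem_filter, Finset.mem_Icc] at this
  exact ⟨this.2.1, this.2.2, this.1.2⟩

lemma lower_count {f : ℕ → ℤ} {F : Polynomial ℤ} (hf1 : f 1 = 1)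
    (hfm : ∀ m n : ℕ, Nat.Coprime m n → f (m * n) = f m * f n)
    (hfp : ∀ p : ℕ, p.Prime → f p = F.eval (p : ℤ)) {q Y Z : ℕ} {L c : ℝ} (hL : 0 ≤ L) (hYZ : Y ≤ Z)
    (hpi : ∀ u : ℝ, 0 < u → L/4 ≤ Real.log u → Real.log u ≤ L →
      c * u ≤ (((Icc 1 ⌊u⌋₊).filter (fun p : ℕ => gp F q p ∧ Z < p)).card : ℝ)) :
    c * Real.exp L * (∑ m ∈ MM f q Y (Real.exp L), (1:ℝ)/m) *
      (∑ T ∈ TT F q Y Z (Real.exp (L/4)), 1/((∏ p ∈ T, p : ℕ):ℝ)) ≤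
    (cnt (Real.exp L) (fun n => Int.gcd (f n) (q : ℤ) = 1) : ℝ) := by
  classical
  rw [cnt_eq]
  set M := MM f q Y (Real.exp L) with hM
  set TS := TT F q Y Z (Real.exp (L/4)) with hTS
  set U : ℕ × Finset ℕ → Finset ℕ := fun mt => (Icc 1 ⌊Real.exp L/((mt.1:ℝ) * ((∏ p ∈ mt.2, p : ℕ):ℝ))⌋₊).filter
    (fun p : ℕ => gp F q p ∧ Z < p) with hU
  have hposT : ∀ T ∈ TS, (1:ℝ) ≤ ((∏ p ∈ T, p : ℕ):ℝ) := by
    intro T hT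
    have := (mem_TT hT).1
    exact_mod_cast Finset.prod_pos fun p hp => (this p hp).1.1.pos
  have hmb : ∀ m ∈ M, (1:ℝ) ≤ m ∧ (m:ℝ) ≤ Real.exp (L/2) := by
    intro m hm
    have h := (mem_MM.mp hm).1
    refine ⟨by exact_mod_cast h.1, ?_⟩
    have h2 := (Nat.le_floor_iff' (by omega)).mp h.2
    rwa [← Real.exp_half] at h2
  have hUl : ∀ mt ∈ M ×ˢ TS, c * Real.exp L * ((1/(mt.1:ℝ)) * (1/((∏ p ∈ mt.2, p : ℕ):ℝ))) ≤ ((U mt).card : ℝ) := by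
    rintro ⟨m, T⟩ hmt
    rw [Finset.mem_product] at hmt
    have h1 := hmb m hmt.1
    have h2 := hposT T hmt.2
    have h3 := (mem_TT hmt.2).2
    simp only at h1 h2 h3 ⊢
    have hm0 : (0:ℝ) < m := by linarith
    have hT0 : (0:ℝ) < ((∏ p ∈ T, p : ℕ):ℝ) := by linarith
    have hlog : Real.log (Real.exp L/((m:ℝ) * ((∏ p ∈ T, p : ℕ):ℝ))) = L - (Real.log m + Real.log ((∏ p ∈ T, p : ℕ):ℝ)) := by
      rw [Real.log_div (by positivity) (by positivity), Real.log_exp, Real.log_mul hm0.ne' hT0.ne']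
    have a1 := Real.log_nonneg h1.1
    have a2 := Real.log_nonneg h2
    have a3 := (Real.log_le_iff_le_exp hm0).mpr h1.2
    have a4 := (Real.log_le_iff_le_exp hT0).mpr h3
    have := hpi (Real.exp L/((m:ℝ) * ((∏ p ∈ T, p : ℕ):ℝ))) (by positivity) (by rw [hlog]; linarith) (by rw [hlog]; linarith)
    refine le_trans (le_of_eq ?_) this
    rw [one_div_mul_one_div, mul_assoc, mul_one_div]
  calc _ = ∑ mt ∈ M ×ˢ TS, c * Real.exp L * ((1/(mt.1:ℝ)) * (1/((∏ p ∈ mt.2, p : ℕ):ℝ))) := by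
        rw [← Finset.mul_sum, mul_assoc, Finset.sum_mul_sum, ← Finset.sum_product']
    _ ≤ ∑ mt ∈ M ×ˢ TS, ((U mt).card : ℝ) := Finset.sum_le_sum hUl
    _ = (((M ×ˢ TS).sigma U).card : ℝ) := by rw [Finset.card_sigma]; push_cast; rfl
    _ ≤ _ := by
        have : ((M ×ˢ TS).sigma U).card ≤ ((Icc 1 ⌊Real.exp L⌋₊).filter (fun n => Int.gcd (f n) (q : ℤ) = 1)).card := by
          apply Finset.card_le_card_of_injOn (fun s => s.1.1 * (∏ t ∈ s.1.2, t) * s.2)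
          · rintro ⟨⟨m, T⟩, p⟩ hs
            rw [Finset.mem_coe, Finset.mem_sigma, Finset.mem_product] at hs
            obtain ⟨⟨hm, hT⟩, hp⟩ := hs
            simp only [hU, Finset.mem_filter, Finset.mem_Icc] at hm hT hp
            rw [Finset.mem_coe, Finset.mem_filter, Finset.mem_Icc]
            simp only
            have h1 := hmb m hm
            have h2 := hposT T hT
            have hm0 : (0:ℝ) < m := by linarith
            have hT0 : (0:ℝ) < ((∏ p ∈ T, p : ℕ):ℝ) := by linarith
            have hm' := mem_MM.mp hm
            have hT' := (mem_TT hT).1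
            have hT0' : 0 < ∏ p ∈ T, p := by exact_mod_cast hT0
            refine ⟨⟨?_, ?_⟩, ?_⟩
            · exact Nat.mul_pos (Nat.mul_pos hm'.1.1 hT0') hp.1.1
            · apply Nat.le_floor
              have := (Nat.le_floor_iff' (by omega)).mp hp.1.2
              rw [le_div_iff₀ (by positivity)] at this
              push_cast at this ⊢
              linarith
            · have hpT : p ∉ T := fun h => by have := (hT' p h).2.2; omega
              have e : m * (∏ t ∈ T, t) * p = m * ∏ t ∈ insert p T, t := by
                rw [Finset.prod_insert hpT]; ring
              have hins : ∀ t ∈ insert p T, gp F q t ∧ Y < t := by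
                intro t ht
                rw [Finset.mem_insert] at ht
                rcases ht with rfl | ht
                · exact ⟨hp.2.1, by omega⟩
                · exact ⟨(hT' t ht).1, (hT' t ht).2.1⟩
              rw [e, hfm _ _ (cop_sm hm'.2.1 _ fun t ht => ⟨(hins t ht).1.1, (hins t ht).2⟩),
                f_prod hf1 hfm hfp _ (fun t ht => (hins t ht).1.1)]
              exact gcd_mul_one hm'.2.2 (gcd_prod_one _ fun t ht => (hins t ht).1)
          · rintro ⟨⟨m, T⟩, p⟩ hs ⟨⟨m', T'⟩, p'⟩ hs' heq
            rw [Finset.mem_coe, Finset.mem_sigma, Finset.mem_product] at hs hs'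
            obtain ⟨⟨hm, hT⟩, hp⟩ := hs
            obtain ⟨⟨hm', hT'⟩, hp'⟩ := hs'
            simp only [hU, Finset.mem_filter, Finset.mem_Icc] at hm hT hp hm' hT' hp' heq
            obtain ⟨r1, r2, r3⟩ := triple_inj hYZ (mem_MM.mp hm).2.1
              (fun t ht => by have := (mem_TT hT).1 t ht; exact ⟨this.1.1, this.2⟩) ⟨hp.2.1.1, hp.2.2⟩
              (mem_MM.mp hm').2.1
              (fun t ht => by have := (mem_TT hT').1 t ht; exact ⟨this.1.1, this.2⟩) ⟨hp'.2.1.1, hp'.2.2⟩ heq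
            subst r1 r2 r3
            rfl
        exact_mod_cast this

/-- lower bound for the sum over `TT`. -/
lemma TT_lower {F : Polynomial ℤ} {q Y Z : ℕ} {X ℓ S : ℝ} (hX : 0 < X) (hℓ : 0 < ℓ) (hZ : (Z:ℝ) ≤ Real.exp ℓ)
    (hS : S = ∑ p ∈ (Icc 1 Z).filter (fun p => gp F q p ∧ Y < p), (1:ℝ)/p) :
    Real.exp (S/2) - Real.exp (3*S - Real.log X/ℓ) ≤ ∑ T ∈ TT F q Y Z X, 1/((∏ p ∈ T, p : ℕ):ℝ) := by
  classical
  set PS := (Icc 1 Z).filter (fun p => gp F q p ∧ Y < p) with hPS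
  have hPSp : ∀ p ∈ PS, gp F q p ∧ p ≤ Z := by
    intro p hp
    simp only [hPS, Finset.mem_filter, Finset.mem_Icc] at hp
    exact ⟨hp.2.1, hp.1.2⟩
  have hall : ∑ T ∈ PS.powerset, 1/((∏ p ∈ T, p : ℕ):ℝ) = ∏ p ∈ PS, (1 + (1:ℝ)/p) := by
    rw [Finset.prod_one_add]
    refine Finset.sum_congr rfl fun T _ => ?_
    push_cast
    simp
  have hE : ∑ T ∈ PS.powerset, Real.exp 1 ^ T.card /((∏ p ∈ T, p : ℕ):ℝ) = ∏ p ∈ PS, (1 + Real.exp 1/p) := by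
    rw [Finset.prod_one_add]
    refine Finset.sum_congr rfl fun T _ => ?_
    push_cast
    rw [Finset.prod_div_distrib, Finset.prod_const]
  have h1 : Real.exp (S/2) ≤ ∏ p ∈ PS, (1 + (1:ℝ)/p) := by
    rw [hS, Finset.sum_div, Real.exp_sum]
    refine Finset.prod_le_prod (fun _ _ => (Real.exp_pos _).le) fun p hp => ?_
    have h2 : (1:ℝ) ≤ p := by exact_mod_cast (hPSp p hp).1.1.one_lt.le
    have h3 : (1:ℝ)/p ≤ 1 := by rw [div_le_one (by linarith)]; exact h2
    have h4 : (0:ℝ) < (1:ℝ)/p := by positivity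
    set t := (1:ℝ)/p with ht
    have h5 : 1 - t/2 ≤ Real.exp (-(t/2)) := by have := Real.add_one_le_exp (-(t/2)); linarith
    rw [Real.exp_neg] at h5
    have h6 := Real.exp_pos (t/2)
    have h7 : (1 - t/2) * Real.exp (t/2) ≤ 1 := by
      calc _ ≤ (Real.exp (t/2))⁻¹ * Real.exp (t/2) := by gcongr
        _ = 1 := by field_simp
    have h8 : 1 ≤ (1 - t/2) * (1 + t) := by nlinarith
    by_contra hcon
    push Not at hcon
    have : (1 - t/2) * (1 + t) < (1 - t/2) * Real.exp (t/2) := by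
      apply mul_lt_mul_of_pos_left hcon; linarith
    linarith
  have h2 : ∏ p ∈ PS, (1 + Real.exp 1/p) ≤ Real.exp (3*S) := by
    rw [hS, Finset.mul_sum, Real.exp_sum]
    refine Finset.prod_le_prod (fun p _ => by positivity) fun p hp => ?_
    have h3 : Real.exp 1 ≤ 3 := by have := Real.exp_one_lt_d9; linarith
    have h4 := Real.add_one_le_exp (3 * ((1:ℝ)/p))
    have h5 : Real.exp 1 / p ≤ 3/p := by gcongr
    have h6 : (3:ℝ)/p = 3 * (1/p) := by ring
    linarith
  have hsplit := Finset.sum_filter_add_sum_filter_not PS.powerset (fun T => ((∏ p ∈ T, p : ℕ) : ℝ) ≤ X)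
    (fun T => 1/((∏ p ∈ T, p : ℕ):ℝ))
  have htail : ∑ T ∈ PS.powerset.filter (fun T => ¬ ((∏ p ∈ T, p : ℕ) : ℝ) ≤ X), 1/((∏ p ∈ T, p : ℕ):ℝ)
      ≤ Real.exp (3*S - Real.log X/ℓ) := by
    calc _ ≤ ∑ T ∈ PS.powerset.filter (fun T => ¬ ((∏ p ∈ T, p : ℕ) : ℝ) ≤ X),
          Real.exp (-(Real.log X/ℓ)) * (Real.exp 1 ^ T.card /((∏ p ∈ T, p : ℕ):ℝ)) := by
          refine Finset.sum_le_sum fun T hT => ?_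
          rw [Finset.mem_filter, Finset.mem_powerset] at hT
          have hlt := not_le.mp hT.2
          have hle : ((∏ p ∈ T, p : ℕ):ℝ) ≤ Real.exp ℓ ^ T.card := by
            push_cast
            rw [← Finset.prod_const]
            apply Finset.prod_le_prod (fun _ _ => by positivity)
            intro p hp
            refine le_trans ?_ hZ
            exact_mod_cast (hPSp p (hT.1 hp)).2
          have hlog : Real.log X/ℓ ≤ T.card := by
            rw [div_le_iff₀ hℓ]
            have := Real.log_le_log hX (hlt.le.trans hle)
            rwa [Real.log_pow, Real.log_exp] at this
          have hpos : (0:ℝ) < ((∏ p ∈ T, p : ℕ):ℝ) := by linarith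
          rw [← mul_div_assoc, ← Real.exp_nat_mul, ← Real.exp_add]
          gcongr
          rw [Real.one_le_exp_iff]
          linarith
      _ ≤ ∑ T ∈ PS.powerset, Real.exp (-(Real.log X/ℓ)) * (Real.exp 1 ^ T.card /((∏ p ∈ T, p : ℕ):ℝ)) :=
          Finset.sum_le_sum_of_subset_of_nonneg (Finset.filter_subset _ _) fun _ _ _ => by positivity
      _ = Real.exp (-(Real.log X/ℓ)) * ∏ p ∈ PS, (1 + Real.exp 1/p) := by rw [← Finset.mul_sum, hE]
      _ ≤ Real.exp (-(Real.log X/ℓ)) * Real.exp (3*S) := by gcongr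
      _ = _ := by rw [← Real.exp_add]; congr 1; ring
  have hTT : TT F q Y Z X = PS.powerset.filter (fun T => ((∏ p ∈ T, p : ℕ) : ℝ) ≤ X) := by
    unfold TT
    ext T; simp only [Finset.mem_filter, hPS]
  rw [hTT]
  linarith

end S11


namespace S11
open Finset Filter Topology

noncomputable def powHom (s : ℝ) : ℕ →* ℝ where
  toFun n := (n:ℝ)^s
  map_one' := by simp
  map_mul' a b := by push_cast; exact Real.mul_rpow (Nat.cast_nonneg _) (Nat.cast_nonneg _)

lemma powHom_apply (s : ℝ) (n : ℕ) : powHom s n = (n:ℝ)^s := rfl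

lemma smooth_sum {Y : ℕ} {X ℓ : ℝ} (hX : 0 < X) (hℓ : 2 ≤ ℓ) (hY : (Y:ℝ) ≤ Real.exp ℓ) (A : Finset ℕ)
    (hA : ∀ m ∈ A, 0 < m ∧ X < m ∧ ∀ p : ℕ, p.Prime → p ∣ m → p ≤ Y) :
    ∑ m ∈ A, (1:ℝ)/m ≤ Real.exp (-(Real.log X/ℓ)) * Real.exp (12 * ∑ p ∈ (Icc 1 Y).filter Nat.Prime, (1:ℝ)/p) := by
  set β := 1/ℓ with hβ
  have hℓ0 : 0 < ℓ := by linarith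
  have hβ0 : 0 < β := by positivity
  have hβ1 : β ≤ 1/2 := by rw [hβ]; gcongr
  have ht1 : ∀ p : ℕ, p.Prime → (p:ℝ)^(β-1) ≤ 3/4 := by
    intro p hp
    have h2 : (2:ℝ) ≤ p := by exact_mod_cast hp.two_le
    calc (p:ℝ)^(β-1) ≤ (p:ℝ)^(-(1/2):ℝ) := Real.rpow_le_rpow_of_exponent_le (by linarith) (by linarith)
      _ ≤ (2:ℝ)^(-(1/2):ℝ) := Real.rpow_le_rpow_of_nonpos (by norm_num) h2 (by norm_num)
      _ = (√2)⁻¹ := by rw [Real.rpow_neg (by norm_num), ← Real.sqrt_eq_rpow]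
      _ ≤ ((4:ℝ)/3)⁻¹ := by
          gcongr
          apply Real.le_sqrt_of_sq_le; norm_num
      _ = 3/4 := by norm_num
  have ht0 : ∀ p : ℕ, p.Prime → 0 < (p:ℝ)^(β-1) := by
    intro p hp
    have h2 : (0:ℝ) < p := by exact_mod_cast hp.pos
    positivity
  obtain ⟨hs, hsum⟩ := EulerProduct.summable_and_hasSum_smoothNumbers_prod_primesBelow_geometric (f := powHom (β-1))
    (fun {p} hp => by
      rw [powHom_apply, Real.norm_of_nonneg (ht0 p hp).le]; have := ht1 p hp; linarith) (Y+1)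
  have hind := (hasSum_subtype_iff_indicator (f := fun n : ℕ => powHom (β-1) n) (s := (Y+1).smoothNumbers)).mp hsum
  have h1 : ∑ m ∈ A, (m:ℝ)^(β-1) ≤ ∏ p ∈ (Y+1).primesBelow, (1 - powHom (β-1) p)⁻¹ := by
    have := sum_le_hasSum A (fun i _ => Set.indicator_nonneg (fun n _ => by rw [powHom_apply]; positivity) i) hind
    refine le_trans (le_of_eq ?_) this
    refine Finset.sum_congr rfl fun m hm => ?_
    rw [Set.indicator_of_mem, powHom_apply]
    rw [Nat.mem_smoothNumbers']
    intro p hp hpm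
    have := (hA m hm).2.2 p hp hpm
    omega
  have h2 : ∏ p ∈ (Y+1).primesBelow, (1 - powHom (β-1) p)⁻¹ ≤ Real.exp (12 * ∑ p ∈ (Icc 1 Y).filter Nat.Prime, (1:ℝ)/p) := by
    have hset : (Y+1).primesBelow = (Icc 1 Y).filter Nat.Prime := by
      ext p
      rw [Nat.mem_primesBelow, Finset.mem_filter, Finset.mem_Icc]
      constructor
      · rintro ⟨a, b⟩; exact ⟨⟨b.pos, by omega⟩, b⟩
      · rintro ⟨⟨a, b⟩, c⟩; exact ⟨by omega, c⟩
    rw [hset, Finset.mul_sum, Real.exp_sum]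
    refine Finset.prod_le_prod (fun p hp => ?_) fun p hp => ?_
    · have hp' := (Finset.mem_filter.mp hp).2
      have := ht1 p hp'
      rw [powHom_apply]
      exact inv_nonneg.mpr (by linarith)
    · rw [Finset.mem_filter, Finset.mem_Icc] at hp
      have hp0 : (0:ℝ) < p := by exact_mod_cast hp.2.pos
      have a1 := ht1 p hp.2
      have a0 := ht0 p hp.2
      rw [powHom_apply]
      set t := (p:ℝ)^(β-1) with htd
      have hpe : t ≤ 3 * (1/p) := by
        have e1 : t = (p:ℝ)^β * (1/p) := by rw [htd, Real.rpow_sub_one hp0.ne']; ring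
        rw [e1]
        gcongr
        calc (p:ℝ)^β ≤ (Real.exp ℓ)^β := by
              gcongr
              exact le_trans (by exact_mod_cast hp.1.2) hY
          _ = Real.exp 1 := by rw [← Real.exp_mul, hβ]; congr 1; field_simp
          _ ≤ 3 := by have := Real.exp_one_lt_d9; linarith
      have h4 : (1 - t)⁻¹ ≤ Real.exp (4*t) := by
        rw [inv_le_comm₀ (by linarith) (Real.exp_pos _), ← Real.exp_neg]
        have h5 : Real.exp (-(4*t)) * (1 + 4*t) ≤ 1 := by
          have := Real.add_one_le_exp (4*t)
          calc _ ≤ Real.exp (-(4*t)) * Real.exp (4*t) := by gcongr; linarith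
            _ = 1 := by rw [← Real.exp_add]; simp
        have h6 : 1 ≤ (1-t)*(1+4*t) := by nlinarith
        by_contra hcon
        push Not at hcon
        have : (1-t)*(1+4*t) < Real.exp (-(4*t)) * (1 + 4*t) := by
          apply mul_lt_mul_of_pos_right hcon; linarith
        linarith
      refine h4.trans (Real.exp_le_exp.mpr ?_)
      linarith
  calc ∑ m ∈ A, (1:ℝ)/m ≤ ∑ m ∈ A, Real.exp (-(Real.log X/ℓ)) * (m:ℝ)^(β-1) := by
        refine Finset.sum_le_sum fun m hm => ?_
        have hm := hA m hm
        have hm0 : (0:ℝ) < m := by exact_mod_cast hm.1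
        rw [Real.rpow_sub_one hm0.ne', ← mul_div_assoc]
        gcongr
        rw [Real.rpow_def_of_pos hm0, ← Real.exp_add, Real.one_le_exp_iff]
        have := Real.log_le_log hX hm.2.1.le
        have e : -(Real.log X/ℓ) + Real.log m * β = (Real.log m - Real.log X)/ℓ := by rw [hβ]; ring
        rw [e]
        exact div_nonneg (by linarith) hℓ0.le
    _ = Real.exp (-(Real.log X/ℓ)) * ∑ m ∈ A, (m:ℝ)^(β-1) := by rw [Finset.mul_sum]
    _ ≤ _ := by gcongr; exact h1.trans h2

lemma mult_card (N k : ℕ) : ((Icc 1 N).filter (fun n => k ∣ n)).card = N/k := by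
  have := Nat.Ioc_filter_dvd_card_eq_div N k
  rw [← this]
  rfl

lemma B1_card {x : ℝ} (hx : 0 ≤ x) {Y : ℕ} (hY : 0 < Y) (A : Finset ℕ)
    (hA : ∀ n ∈ A, n ∈ Icc 1 ⌊x⌋₊ ∧ ∃ p : ℕ, p.Prime ∧ Y < p ∧ p^2 ∣ n) : (A.card:ℝ) ≤ x/Y := by
  have hNx : ((⌊x⌋₊:ℕ):ℝ) ≤ x := Nat.floor_le hx
  set N := ⌊x⌋₊ with hN
  have hsub : A ⊆ (Ioc Y N).biUnion (fun k => (Icc 1 N).filter (fun n => k^2 ∣ n)) := by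
    intro n hn
    obtain ⟨h1, p, hp, hYp, hd⟩ := hA n hn
    rw [Finset.mem_biUnion]
    refine ⟨p, ?_, Finset.mem_filter.mpr ⟨h1, hd⟩⟩
    rw [Finset.mem_Icc] at h1
    have h2 := Nat.le_of_dvd (by omega) hd
    rw [Finset.mem_Ioc]
    refine ⟨hYp, ?_⟩
    have := hp.pos
    nlinarith
  have h1 : (A.card:ℝ) ≤ ∑ k ∈ Ioc Y N, x * ((k:ℝ)^2)⁻¹ := by
    have := (Finset.card_le_card hsub).trans Finset.card_biUnion_le
    calc (A.card:ℝ) ≤ ∑ k ∈ Ioc Y N, (((Icc 1 N).filter (fun n => k^2 ∣ n)).card : ℝ) := by exact_mod_cast this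
      _ ≤ _ := by
        refine Finset.sum_le_sum fun k _ => ?_
        rw [mult_card]
        refine Nat.cast_div_le.trans ?_
        push_cast
        rw [div_eq_mul_inv]
        gcongr
  rw [← Finset.mul_sum] at h1
  have h2 : ∑ k ∈ Ioc Y N, ((k:ℝ)^2)⁻¹ ≤ (Y:ℝ)⁻¹ := by
    by_cases hYN : Y ≤ N
    · have := sum_Ioc_inv_sq_le_sub (α := ℝ) hY.ne' hYN
      have h3 : (0:ℝ) ≤ (N:ℝ)⁻¹ := by positivity
      linarith
    · rw [Finset.Ioc_eq_empty (by omega), Finset.sum_empty]; positivity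
  rw [div_eq_mul_inv]
  exact h1.trans (by gcongr)

lemma B2_card {x : ℝ} (hx : 0 ≤ x) (D A : Finset ℕ)
    (hA : ∀ n ∈ A, n ∈ Icc 1 ⌊x⌋₊ ∧ ∃ m ∈ D, m ∣ n) : (A.card:ℝ) ≤ x * ∑ m ∈ D, (1:ℝ)/m := by
  have hNx : ((⌊x⌋₊:ℕ):ℝ) ≤ x := Nat.floor_le hx
  set N := ⌊x⌋₊ with hN
  have hsub : A ⊆ D.biUnion (fun k => (Icc 1 N).filter (fun n => k ∣ n)) := by
    intro n hn
    obtain ⟨h1, m, hm, hd⟩ := hA n hn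
    rw [Finset.mem_biUnion]
    exact ⟨m, hm, Finset.mem_filter.mpr ⟨h1, hd⟩⟩
  have := (Finset.card_le_card hsub).trans Finset.card_biUnion_le
  calc (A.card:ℝ) ≤ ∑ k ∈ D, (((Icc 1 N).filter (fun n => k ∣ n)).card : ℝ) := by exact_mod_cast this
    _ ≤ ∑ k ∈ D, x * ((1:ℝ)/k) := by
      refine Finset.sum_le_sum fun k _ => ?_
      rw [mult_card]
      refine Nat.cast_div_le.trans ?_
      rw [mul_one_div]
      gcongr
    _ = _ := by rw [Finset.mul_sum]

lemma prime_card {u w : ℝ} (hu : 0 ≤ u) (hw : 1 < w) :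
    (((Icc 1 ⌊u⌋₊).filter (fun p : ℕ => p.Prime ∧ w < p)).card : ℝ) ≤ 2 * u / Real.log w := by
  have hlw : 0 < Real.log w := Real.log_pos hw
  rw [le_div_iff₀ hlw]
  have h1 := Chebyshev.theta_le_log4_mul_x hu
  have h2 : (((Icc 1 ⌊u⌋₊).filter (fun p : ℕ => p.Prime ∧ w < p)).card : ℝ) * Real.log w ≤ Chebyshev.theta u := by
    rw [Chebyshev.theta, ← nsmul_eq_mul]
    calc _ ≤ ∑ p ∈ (Icc 1 ⌊u⌋₊).filter (fun p : ℕ => p.Prime ∧ w < p), Real.log p := by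
          refine Finset.card_nsmul_le_sum _ _ _ fun p hp => ?_
          exact Real.log_le_log (by linarith) (Finset.mem_filter.mp hp).2.2.le
      _ ≤ _ := by
          refine Finset.sum_le_sum_of_subset_of_nonneg ?_ fun p _ _ => Real.log_natCast_nonneg p
          intro p hp
          rw [Finset.mem_filter, Finset.mem_Icc] at hp
          rw [Finset.mem_filter, Finset.mem_Ioc]
          exact ⟨⟨by omega, hp.1.2⟩, hp.2.1⟩
  have h3 : Real.log 4 ≤ 2 := by
    rw [show (4:ℝ) = 2^2 by norm_num, Real.log_pow]
    have := Real.log_two_lt_d9; push_cast; linarith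
  nlinarith

lemma B3_card {x w : ℝ} (hx : 0 ≤ x) (hw : 1 < w) (M : Finset ℕ) (TS : Finset (Finset ℕ)) (A : Finset ℕ)
    (hM : ∀ m ∈ M, 0 < m) (hTS : ∀ T ∈ TS, 0 < ∏ p ∈ T, p)
    (hA : ∀ n ∈ A, n ∈ Icc 1 ⌊x⌋₊ ∧ ∃ m ∈ M, ∃ T ∈ TS, ∃ P : ℕ, P.Prime ∧ w < P ∧ n = m * (∏ p ∈ T, p) * P) :
    (A.card:ℝ) ≤ 2 * x / Real.log w * (∑ m ∈ M, (1:ℝ)/m) * ∑ T ∈ TS, 1/((∏ p ∈ T, p : ℕ):ℝ) := by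
  classical
  set U : ℕ × Finset ℕ → Finset ℕ := fun mt => ((Icc 1 ⌊x/((mt.1:ℝ) * ((∏ p ∈ mt.2, p : ℕ):ℝ))⌋₊).filter
    (fun p : ℕ => p.Prime ∧ w < p)).image (fun p => mt.1 * (∏ p ∈ mt.2, p) * p) with hU
  have hsub : A ⊆ (M ×ˢ TS).biUnion U := by
    intro n hn
    obtain ⟨h1, m, hm, T, hT, P, hP, hwP, hn'⟩ := hA n hn
    rw [Finset.mem_biUnion]
    refine ⟨(m, T), Finset.mem_product.mpr ⟨hm, hT⟩, ?_⟩
    simp only [hU]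
    rw [Finset.mem_image]
    refine ⟨P, ?_, hn'.symm⟩
    rw [Finset.mem_filter, Finset.mem_Icc]
    refine ⟨⟨hP.pos, ?_⟩, hP, hwP⟩
    rw [Finset.mem_Icc] at h1
    have h2 := (Nat.le_floor_iff' (by omega)).mp h1.2
    have hm0 : (0:ℝ) < m := by exact_mod_cast hM m hm
    have hT0 : (0:ℝ) < ((∏ p ∈ T, p : ℕ):ℝ) := by exact_mod_cast hTS T hT
    apply Nat.le_floor
    rw [le_div_iff₀ (by positivity)]
    refine le_trans (le_of_eq ?_) h2
    rw [hn']; push_cast; ring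
  have := (Finset.card_le_card hsub).trans Finset.card_biUnion_le
  calc (A.card:ℝ) ≤ ∑ mt ∈ M ×ˢ TS, ((U mt).card : ℝ) := by exact_mod_cast this
    _ ≤ ∑ mt ∈ M ×ˢ TS, 2 * x / Real.log w * ((1/(mt.1:ℝ)) * (1/((∏ p ∈ mt.2, p : ℕ):ℝ))) := by
        refine Finset.sum_le_sum fun mt hmt => ?_
        simp only [hU]
        have h1 := prime_card (u := x/((mt.1:ℝ) * ((∏ p ∈ mt.2, p : ℕ):ℝ))) (by positivity) hw
        refine le_trans ?_ (h1.trans (le_of_eq ?_))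
        · exact_mod_cast Finset.card_image_le
        · rw [one_div_mul_one_div]; ring
    _ = _ := by rw [← Finset.mul_sum, mul_assoc, Finset.sum_mul_sum, ← Finset.sum_product']

end S11


namespace S11
open Finset Filter Topology

/-- small sets of primes -/
def TSm (J N : ℕ) : Finset (Finset ℕ) := ((Icc 1 N).filter Nat.Prime).powerset.filter (fun T => T.card < J)

lemma mem_TSm {J N : ℕ} {T : Finset ℕ} : T ∈ TSm J N ↔ (∀ p ∈ T, p.Prime ∧ p ≤ N) ∧ T.card < J := by
  unfold TSm
  rw [Finset.mem_filter, Finset.mem_powerset]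
  constructor
  · rintro ⟨h1, h2⟩
    refine ⟨fun p hp => ?_, h2⟩
    have := h1 hp
    rw [Finset.mem_filter, Finset.mem_Icc] at this
    exact ⟨this.2, this.1.2⟩
  · rintro ⟨h1, h2⟩
    refine ⟨fun p hp => ?_, h2⟩
    rw [Finset.mem_filter, Finset.mem_Icc]
    exact ⟨⟨(h1 p hp).1.pos, (h1 p hp).2⟩, (h1 p hp).1⟩

lemma TSm_sum {J N : ℕ} {v : ℝ} (hv : 1 ≤ v) :
    ∑ T ∈ TSm J N, 1/((∏ p ∈ T, p : ℕ):ℝ) ≤ v^J * Real.exp ((∑ p ∈ (Icc 1 N).filter Nat.Prime, (1:ℝ)/p)/v) := by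
  set PS := (Icc 1 N).filter Nat.Prime with hPS
  have hv0 : 0 < v := by linarith
  have hall : ∑ T ∈ PS.powerset, (1/v)^T.card * (1/((∏ p ∈ T, p : ℕ):ℝ)) = ∏ p ∈ PS, (1 + 1/v * ((1:ℝ)/p)) := by
    rw [Finset.prod_one_add]
    refine Finset.sum_congr rfl fun T _ => ?_
    rw [Finset.prod_mul_distrib, Finset.prod_const]
    push_cast
    rw [one_div (∏ i ∈ T, (i:ℝ)), ← Finset.prod_inv_distrib]
    simp only [one_div]
  calc ∑ T ∈ TSm J N, 1/((∏ p ∈ T, p : ℕ):ℝ)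
      ≤ ∑ T ∈ TSm J N, v^J * ((1/v)^T.card * (1/((∏ p ∈ T, p : ℕ):ℝ))) := by
        refine Finset.sum_le_sum fun T hT => ?_
        have hc := (mem_TSm.mp hT).2
        rw [← mul_assoc]
        refine le_mul_of_one_le_left (by positivity) ?_
        rw [one_div, inv_pow, ← div_eq_mul_inv, one_le_div (by positivity)]
        exact pow_le_pow_right₀ hv hc.le
    _ ≤ ∑ T ∈ PS.powerset, v^J * ((1/v)^T.card * (1/((∏ p ∈ T, p : ℕ):ℝ))) :=
        Finset.sum_le_sum_of_subset_of_nonneg (Finset.filter_subset _ _) fun _ _ _ => by positivity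
    _ = v^J * ∏ p ∈ PS, (1 + 1/v * ((1:ℝ)/p)) := by rw [← Finset.mul_sum, hall]
    _ ≤ _ := by
        gcongr
        rw [Finset.sum_div, Real.exp_sum]
        refine Finset.prod_le_prod (fun _ _ => by positivity) fun p _ => ?_
        have := Real.add_one_le_exp ((1:ℝ)/p/v)
        have e : 1/v * ((1:ℝ)/p) = 1/p/v := by ring
        rw [e]; linarith

lemma upper_count {f : ℕ → ℤ}
    (hfm : ∀ m n : ℕ, Nat.Coprime m n → f (m * n) = f m * f n)
    {q Y J : ℕ} {δ L : ℝ} (hL : 0 < L) (hℓ : 2 ≤ L^(δ/2)) (hJ : J = ⌊Real.log (Real.log L)⌋₊) (hJ1 : 1 ≤ J)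
    (hY : Y = ⌊Real.exp (L^(δ/2))⌋₊) :
    (cnt (Real.exp L) (fun n => ¬ convenient δ (Real.exp L) n ∧ Int.gcd (f n) (q : ℤ) = 1) : ℝ) ≤
      Real.exp (3*L/4) + Real.exp L/Y +
      Real.exp L * (Real.exp (-((L/2)/L^(δ/2))) * Real.exp (12 * ∑ p ∈ (Icc 1 Y).filter Nat.Prime, (1:ℝ)/p)) +
      2 * Real.exp L / (L/(4*J)) * (∑ m ∈ MM f q Y (Real.exp L), (1:ℝ)/m) *
        ∑ T ∈ TSm J ⌊Real.exp L⌋₊, 1/((∏ p ∈ T, p : ℕ):ℝ) := by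
  classical
  rw [cnt_eq]
  set x := Real.exp L with hx
  have hx0 : 0 < x := Real.exp_pos _
  have hlx : Real.log x = L := Real.log_exp L
  set N := ⌊x⌋₊ with hN
  set w := Real.exp (L/(4*J)) with hw
  have hJ0 : (0:ℝ) < J := by exact_mod_cast hJ1
  have hw1 : 1 < w := by rw [hw, Real.one_lt_exp_iff]; positivity
  have hwJ : w^J = Real.exp (L/4) := by
    rw [hw, ← Real.exp_nat_mul]; congr 1; field_simp
  have hYpos : 0 < Y := by
    rw [hY, Nat.floor_pos]; exact Real.one_le_exp (by linarith)
  set Bad := (Icc 1 N).filter (fun n => ¬ convenient δ x n ∧ Int.gcd (f n) (q : ℤ) = 1) with hBad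
  set D := (Icc 1 N).filter (fun m : ℕ => √x < m ∧ ∀ p : ℕ, p.Prime → p ∣ m → p ≤ Y) with hD
  set M := MM f q Y x with hM
  set A0 := Bad.filter (fun n : ℕ => (n:ℝ) ≤ Real.exp (3*L/4)) with hA0
  set A1 := Bad.filter (fun n : ℕ => ∃ p : ℕ, p.Prime ∧ Y < p ∧ p^2 ∣ n) with hA1
  set A2 := Bad.filter (fun n : ℕ => ∃ m ∈ D, m ∣ n) with hA2
  set A3 := Bad.filter (fun n : ℕ => ∃ m ∈ M, ∃ T ∈ TSm J N, ∃ P : ℕ, P.Prime ∧ w < P ∧ n = m * (∏ p ∈ T, p) * P) with hA3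
  have hsub : Bad ⊆ ((A0 ∪ A1) ∪ A2) ∪ A3 := by
    intro n hn
    have hn' := hn
    simp only [hBad, Finset.mem_filter, Finset.mem_Icc] at hn'
    obtain ⟨⟨hn1, hnN⟩, hnc, hng⟩ := hn'
    have hnx : (n:ℝ) ≤ x := (Nat.le_floor_iff' (by omega)).mp hnN
    by_cases h1 : ∃ p : ℕ, p.Prime ∧ Y < p ∧ p^2 ∣ n
    · apply Finset.mem_union_left; apply Finset.mem_union_left; apply Finset.mem_union_right
      exact Finset.mem_filter.mpr ⟨hn, h1⟩
    push Not at h1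
    obtain ⟨m, R, hm0, hmY, hR, hnm⟩ := decomp Y n hn1 h1
    have hRpos : 0 < ∏ p ∈ R, p := Finset.prod_pos fun p hp => (hR p hp).1.pos
    have hRJ : R.card < J := by
      by_contra hcon
      push Not at hcon
      apply hnc
      refine conv_of δ x n m R hm0 hnx ?_ ?_ hnm ?_
      · rw [hlx, ← hY]; exact hmY
      · rw [hlx, ← hY]; exact hR
      · rw [hlx, ← hJ]; exact hcon
    have hmn : m ≤ n := Nat.le_of_dvd hn1 ⟨_, hnm⟩
    by_cases h2 : √x < m
    · apply Finset.mem_union_left; apply Finset.mem_union_right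
      refine Finset.mem_filter.mpr ⟨hn, m, ?_, ⟨_, hnm⟩⟩
      rw [hD, Finset.mem_filter, Finset.mem_Icc]
      exact ⟨⟨hm0, by omega⟩, h2, hmY⟩
    push Not at h2
    by_cases h3 : (n:ℝ) ≤ Real.exp (3*L/4)
    · apply Finset.mem_union_left; apply Finset.mem_union_left; apply Finset.mem_union_left
      exact Finset.mem_filter.mpr ⟨hn, h3⟩
    push Not at h3
    apply Finset.mem_union_right
    refine Finset.mem_filter.mpr ⟨hn, m, ?_, ?_⟩
    · rw [hM, mem_MM]
      refine ⟨⟨hm0, Nat.le_floor h2⟩, hmY, ?_⟩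
      rw [hnm, hfm _ _ (cop_sm hmY R hR)] at hng
      exact gcd_mul_one_left hng
    · have hP : ∃ P ∈ R, w < (P:ℝ) := by
        by_contra hcon
        push Not at hcon
        have h4 : ((∏ p ∈ R, p : ℕ):ℝ) ≤ w^J := by
          calc ((∏ p ∈ R, p : ℕ):ℝ) ≤ ∏ p ∈ R, w := by
                push_cast
                exact Finset.prod_le_prod (fun _ _ => by positivity) hcon
            _ = w^R.card := by rw [Finset.prod_const]
            _ ≤ w^J := pow_le_pow_right₀ hw1.le hRJ.le
        rw [hwJ] at h4
        have h5 : (m:ℝ) ≤ Real.exp (L/2) := by rw [hx, ← Real.exp_half] at h2; exact h2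
        have h6 : (n:ℝ) ≤ Real.exp (L/2) * Real.exp (L/4) := by
          rw [hnm]; push_cast; push_cast at h4; gcongr
        rw [← Real.exp_add, show L/2 + L/4 = 3*L/4 by ring] at h6
        linarith
      obtain ⟨P, hPR, hPw⟩ := hP
      refine ⟨R.erase P, ?_, P, (hR P hPR).1, hPw, ?_⟩
      · rw [mem_TSm]
        refine ⟨fun p hp => ?_, ?_⟩
        · have hpR := Finset.mem_of_mem_erase hp
          refine ⟨(hR p hpR).1, ?_⟩
          have : p ∣ n := by
            rw [hnm]; exact Dvd.dvd.mul_left (Finset.dvd_prod_of_mem (fun t => t) hpR) _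
          exact (Nat.le_of_dvd hn1 this).trans hnN
        · exact lt_of_le_of_lt (Finset.card_le_card (Finset.erase_subset _ _)) hRJ
      · rw [hnm, mul_assoc, Finset.prod_erase_mul _ _ hPR]
  have c0 : (A0.card:ℝ) ≤ Real.exp (3*L/4) := by
    have : A0 ⊆ Icc 1 ⌊Real.exp (3*L/4)⌋₊ := by
      intro n hn
      simp only [hA0, hBad, Finset.mem_filter, Finset.mem_Icc] at hn
      exact Finset.mem_Icc.mpr ⟨hn.1.1.1, Nat.le_floor hn.2⟩
    have h := Finset.card_le_card this
    rw [Nat.card_Icc, Nat.add_sub_cancel] at h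
    calc (A0.card:ℝ) ≤ ((⌊Real.exp (3*L/4)⌋₊:ℕ):ℝ) := by exact_mod_cast h
      _ ≤ _ := Nat.floor_le (Real.exp_nonneg _)
  have hBI : ∀ n ∈ Bad, n ∈ Icc 1 ⌊x⌋₊ := fun n hn => (Finset.mem_filter.mp hn).1
  have c1 : (A1.card:ℝ) ≤ x/Y := B1_card hx0.le hYpos A1 fun n hn => by
    rw [hA1, Finset.mem_filter] at hn; exact ⟨hBI n hn.1, hn.2⟩
  have c2 : (A2.card:ℝ) ≤ x * ∑ m ∈ D, (1:ℝ)/m := B2_card hx0.le D A2 fun n hn => by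
    rw [hA2, Finset.mem_filter] at hn; exact ⟨hBI n hn.1, hn.2⟩
  have c2' : ∑ m ∈ D, (1:ℝ)/m ≤ Real.exp (-((L/2)/L^(δ/2))) * Real.exp (12 * ∑ p ∈ (Icc 1 Y).filter Nat.Prime, (1:ℝ)/p) := by
    have := smooth_sum (Y := Y) (X := √x) (Real.sqrt_pos.mpr hx0) hℓ (by rw [hY]; exact Nat.floor_le (Real.exp_nonneg _)) D (fun m hm => by
      rw [hD, Finset.mem_filter, Finset.mem_Icc] at hm
      exact ⟨hm.1.1, hm.2⟩)
    rwa [Real.log_sqrt hx0.le, hlx] at this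
  have c3 := B3_card hx0.le hw1 M (TSm J N) A3 (fun m hm => (mem_MM.mp hm).1.1)
    (fun T hT => Finset.prod_pos fun p hp => ((mem_TSm.mp hT).1 p hp).1.pos) (fun n hn => by
    rw [hA3, Finset.mem_filter] at hn; exact ⟨hBI n hn.1, hn.2⟩)
  rw [hw, Real.log_exp] at c3
  have hcard : (Bad.card:ℝ) ≤ A0.card + A1.card + A2.card + A3.card := by
    have h1 := Finset.card_le_card hsub
    have h2 := Finset.card_union_le ((A0 ∪ A1) ∪ A2) A3
    have h3 := Finset.card_union_le (A0 ∪ A1) A2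
    have h4 := Finset.card_union_le A0 A1
    exact_mod_cast (by omega : Bad.card ≤ A0.card + A1.card + A2.card + A3.card)
  have c2'' := c2.trans (mul_le_mul_of_nonneg_left c2' hx0.le)
  linarith

end S11


namespace S11
open Finset Filter Topology

lemma mertens_exp {C : ℝ} (hC : ∀ N : ℕ, 2 ≤ N →
    ∑ p ∈ (Icc 1 N).filter Nat.Prime, (1:ℝ)/p ≤ 6 * Real.log (Real.log N) + C) {ℓ L : ℝ} (hℓ : 1 ≤ ℓ) (hL : ℓ ≤ L) :
    ∑ p ∈ (Icc 1 ⌊Real.exp ℓ⌋₊).filter Nat.Prime, (1:ℝ)/p ≤ 6 * Real.log L + C := by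
  have h2 : 2 ≤ ⌊Real.exp ℓ⌋₊ := by
    apply Nat.le_floor
    have := Real.add_one_le_exp ℓ
    push_cast; linarith
  refine (hC _ h2).trans ?_
  have h2' : (2:ℝ) ≤ ((⌊Real.exp ℓ⌋₊:ℕ):ℝ) := by exact_mod_cast h2
  have h3 : Real.log ((⌊Real.exp ℓ⌋₊:ℕ):ℝ) ≤ ℓ := by
    rw [Real.log_le_iff_le_exp (by linarith)]; exact Nat.floor_le (Real.exp_nonneg _)
  have h4 : 0 < Real.log ((⌊Real.exp ℓ⌋₊:ℕ):ℝ) := Real.log_pos (by linarith)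
  have := Real.log_le_log h4 (h3.trans hL)
  linarith

set_option maxHeartbeats 1000000 in
lemma main_ev (f : ℕ → ℤ) (F : Polynomial ℤ)
    (hf1 : f 1 = 1)
    (hfm : ∀ m n : ℕ, Nat.Coprime m n → f (m * n) = f m * f n)
    (hfp : ∀ p : ℕ, p.Prime → f p = F.eval (p : ℤ))
    (δ : ℝ) (hδ0 : 0 < δ) (hδ1 : δ ≤ 1) (K : ℝ) (hK : 0 < K) (ε : ℝ) (hε : 0 < ε) :
    ∀ᶠ L : ℝ in atTop, ∀ q : ℕ, 0 < q → (q : ℝ) ≤ L ^ K → alpha F q ≠ 0 →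
        (cnt (Real.exp L) (fun n => ¬ convenient δ (Real.exp L) n ∧ Int.gcd (f n) (q : ℤ) = 1) : ℝ)
          ≤ ε * (cnt (Real.exp L) (fun n => Int.gcd (f n) (q : ℤ) = 1) : ℝ) := by
  obtain ⟨C, hC0, hC⟩ := mertens_up
  obtain ⟨η, hη⟩ : ∃ η, η = |Real.log (ε/4)| := ⟨_, rfl⟩
  have hη0 : 0 ≤ η := hη ▸ abs_nonneg _
  have hεη : Real.exp (-η) ≤ ε/4 := by
    rw [← Real.le_log_iff_exp_le (by positivity), hη]; exact neg_abs_le _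
  have hθ0 : 0 < δ/2 := by linarith
  have hθ1 : δ/2 ≤ 1/2 := by linarith
  have e0 := ev_pow (a := 1) (by norm_num) 4 4 η (by norm_num) hη0 1
  have e1 := ev_pow (a := δ/2) hθ0 1 4 (η+1) (by norm_num) (by linarith) 1
  have e2 := ev_pow (a := 1/2) (by norm_num) 2 76 (12*C+η) (by norm_num) (by linarith) 1
  have e3 := ev_pow (a := 1/10) (by norm_num) 4 18 (3*C) (by norm_num) (by linarith) 1
  have e4 := Real.tendsto_log_atTop.eventually
    (ev_pow (a := 1/2) (by norm_num) 2 1 (14+C+η) (by norm_num) (by linarith) 2)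
  have e5 : ∀ᶠ L : ℝ in atTop, 1000 ≤ Real.log L := Real.tendsto_log_atTop.eventually_ge_atTop _
  filter_upwards [e0, e1, e2, e3, e4, e5, ev_B, eventually_ge_atTop 1, propA F hK hθ0, S_lower hθ0 hθ1,
    pi_lower hθ0 hθ1] with L e0 e1 e2 e3 e4 e5 e8 hL1 hA hSl hpi
  intro q hq hqL hα
  have hPA : PA F q L (δ/2) := by
    intro l hl
    have := hA q hq.ne' hqL (alpha_local hα) l hl
    refine this.trans (le_of_eq (Finset.sum_congr ?_ fun _ _ => rfl))
    ext p
    rw [Finset.mem_filter, Finset.mem_filter]; exact Iff.rfl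
  have hSl := hSl F q hPA
  have hpi := hpi F q hPA
  clear hA hPA
  simp only [pow_one, one_mul, Real.rpow_one] at e0 e1 e2 e3 e4
  have hLp : 0 < L := by linarith only [hL1]
  set v := Real.log L with hv
  set B := Real.log v with hB
  have hv0 : 0 < v := by linarith only [e5]
  have hexpB : Real.exp B = v := Real.exp_log hv0
  have hexpv : Real.exp v = L := Real.exp_log hLp
  have hBv : B ≤ v := by have := Real.log_le_sub_one_of_pos hv0; linarith only [this]
  have hθL : 1 ≤ L^(δ/2) := Real.one_le_rpow hL1 hθ0.le
  have hθL' : L^(δ/2) ≤ L := by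
    calc L^(δ/2) ≤ L^(1:ℝ) := Real.rpow_le_rpow_of_exponent_le hL1 (by linarith only [hθ1])
      _ = L := Real.rpow_one L
  have h9L : 1 ≤ L^(9/10:ℝ) := Real.one_le_rpow hL1 (by norm_num)
  have h9L' : L^(9/10:ℝ) ≤ L := by
    calc L^(9/10:ℝ) ≤ L^(1:ℝ) := Real.rpow_le_rpow_of_exponent_le hL1 (by norm_num)
      _ = L := Real.rpow_one L
  have hθ9 : L^(δ/2) ≤ L^(9/10:ℝ) := Real.rpow_le_rpow_of_exponent_le hL1 (by linarith only [hθ1])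
  set Y := ⌊Real.exp (L^(δ/2))⌋₊ with hY
  set Z := ⌊Real.exp (L^(9/10:ℝ))⌋₊ with hZ
  set J := ⌊B⌋₊ with hJ
  have hJ1 : 1 ≤ J := Nat.le_floor (by push_cast; linarith only [e8])
  have hJB : (J:ℝ) ≤ B := Nat.floor_le (by linarith only [e8])
  have hYZ : Y ≤ Z := Nat.floor_mono (Real.exp_le_exp.mpr hθ9)
  have hl := lower_count (q := q) (Y := Y) (Z := Z) (L := L) (c := 1/(v^3*L)) hf1 hfm hfp hLp.le hYZ (by
    intro u hu h1 h2
    have := hpi u hu h1 h2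
    refine le_trans (le_of_eq ?_) this
    rw [div_mul_eq_mul_div, one_mul])
  have hu := upper_count (f := f) (q := q) (Y := Y) (J := J) (δ := δ) (L := L) hfm hLp
    (by linarith only [e1, e5, hη0]) hJ hJ1 hY
  have hT := TT_lower (F := F) (q := q) (Y := Y) (Z := Z) (X := Real.exp (L/4)) (ℓ := L^(9/10:ℝ)) (Real.exp_pos _)
    (by linarith only [h9L]) (Nat.floor_le (Real.exp_nonneg _)) rfl
  have hSM := one_le_SM (f := f) hf1 (q := q) (Y := Y) (x := Real.exp L) (Real.one_le_exp hLp.le)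
  have hS1 := mertens_exp hC h9L h9L'
  have hS2 := mertens_exp hC hθL hθL'
  have hS3 := mertens_exp hC hL1 (le_refl L)
  rw [← hv] at hS1 hS2 hS3
  rw [← hY] at hS2
  rw [← hZ] at hS1
  have hTS := TSm_sum (J := J) (N := ⌊Real.exp L⌋₊) (v := v) (by linarith only [e5])
  have hSub : ∑ p ∈ (Icc 1 Z).filter (fun p => gp F q p ∧ Y < p), (1:ℝ)/p ≤ ∑ p ∈ (Icc 1 Z).filter Nat.Prime, (1:ℝ)/p := by
    refine Finset.sum_le_sum_of_subset_of_nonneg ?_ fun _ _ _ => by positivity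
    intro p hp
    rw [Finset.mem_filter] at hp ⊢
    exact ⟨hp.1, hp.2.1.1⟩
  have hSJ0 : 0 ≤ ∑ T ∈ TSm J ⌊Real.exp L⌋₊, 1/((∏ p ∈ T, p : ℕ):ℝ) := Finset.sum_nonneg fun _ _ => by positivity
  generalize ∑ p ∈ (Icc 1 Z).filter (fun p => gp F q p ∧ Y < p), (1:ℝ)/p = S at hSl hT hSub
  generalize ∑ p ∈ (Icc 1 Z).filter Nat.Prime, (1:ℝ)/p = S1 at hS1 hSub
  generalize ∑ p ∈ (Icc 1 Y).filter Nat.Prime, (1:ℝ)/p = S2 at hS2 hu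
  generalize ∑ p ∈ (Icc 1 ⌊Real.exp L⌋₊).filter Nat.Prime, (1:ℝ)/p = S3 at hS3 hTS
  generalize ∑ m ∈ MM f q Y (Real.exp L), (1:ℝ)/m = SM at hl hu hSM
  generalize ∑ T ∈ TT F q Y Z (Real.exp (L/4)), 1/((∏ p ∈ T, p : ℕ):ℝ) = ST at hl hT
  generalize ∑ T ∈ TSm J ⌊Real.exp L⌋₊, 1/((∏ p ∈ T, p : ℕ):ℝ) = SJ at hu hTS hSJ0
  generalize (cnt (Real.exp L) (fun n => Int.gcd (f n) (q : ℤ) = 1) : ℝ) = NN at hl ⊢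
  generalize (cnt (Real.exp L) (fun n => ¬ convenient δ (Real.exp L) n ∧ Int.gcd (f n) (q : ℤ) = 1) : ℝ) = NB at hu ⊢
  have hYlow : Real.exp (L^(δ/2)) / 2 ≤ Y := by
    have h1 := Nat.lt_floor_add_one (Real.exp (L^(δ/2)))
    have h2 : 2 ≤ Real.exp (L^(δ/2)) := by have := Real.add_one_le_exp (L^(δ/2)); linarith only [this, hθL]
    linarith only [h1, h2]
  set E := Real.exp (v^(1/2:ℝ)/2) with hE
  have hv2 : 4 ≤ v^(1/2:ℝ) := by
    have : (0:ℝ) ≤ (B + (14+C+η))^2 - 2 := by nlinarith only [e8, hC0, hη0]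
    linarith only [this, e4]
  have hE2 : 2 ≤ E := by have := Real.add_one_le_exp (v^(1/2:ℝ)/2); linarith only [this, hv2]
  have hSTlow : E/2 ≤ ST := by
    have h1 : E ≤ Real.exp (S/2) := Real.exp_le_exp.mpr (by linarith only [hSl])
    have h2 : Real.exp (3*S - Real.log (Real.exp (L/4))/L^(9/10:ℝ)) ≤ 1 := by
      rw [Real.exp_le_one_iff, Real.log_exp]
      have h3 : L/4/L^(9/10:ℝ) = L^(1/10:ℝ)/4 := by
        rw [div_div, mul_comm, ← div_div]
        congr 1
        rw [div_eq_iff (by positivity), ← Real.rpow_add hLp]; norm_num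
      rw [h3]
      linarith only [hSub, hS1, e3]
    linarith only [h1, h2, hT, hE2]
  have hc : 1/(v^3*L) = Real.exp (-(v+3*B)) := by
    rw [Real.exp_neg, Real.exp_add, hexpv, show 3*B = ((3:ℕ):ℝ)*B by norm_num, Real.exp_nat_mul, hexpB, one_div, mul_comm L]
  rw [hc] at hl
  set x := Real.exp L with hx
  have hx0 : 0 < x := Real.exp_pos _
  set G := x * Real.exp (-(v+3*B)) with hG
  have hG0 : 0 < G := by positivity
  have hNl : G * SM * (E/2) ≤ NN := by
    refine le_trans ?_ hl
    have : Real.exp (-(v+3*B)) * x * SM * ST = G * SM * ST := by rw [hG]; ring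
    rw [this]
    exact mul_le_mul_of_nonneg_left hSTlow (mul_nonneg hG0.le (by linarith only [hSM]))
  have hNG : G ≤ NN := by
    refine le_trans ?_ hNl
    have : 1 ≤ SM * (E/2) := by nlinarith only [hSM, hE2]
    rw [mul_assoc]
    exact le_mul_of_one_le_right hG0.le this
  have hsmall : ∀ t : ℝ, t ≤ -(4*v+η) → x * Real.exp t ≤ ε/4 * NN := by
    intro t ht
    calc x * Real.exp t ≤ x * (Real.exp (-η) * Real.exp (-(v+3*B))) := by
          rw [← Real.exp_add (-η)]
          apply mul_le_mul_of_nonneg_left (Real.exp_le_exp.mpr ?_) hx0.le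
          linarith only [ht, hBv]
      _ = Real.exp (-η) * G := by rw [hG]; ring
      _ ≤ ε/4 * NN := by gcongr
  have t0 : Real.exp (3*L/4) ≤ ε/4 * NN := by
    have := hsmall (-(L/4)) (by linarith only [e0])
    refine le_trans (le_of_eq ?_) this
    rw [hx, ← Real.exp_add]; congr 1; ring
  have t1 : x/Y ≤ ε/4 * NN := by
    have := hsmall (1 - L^(δ/2)) (by linarith only [e1])
    refine le_trans ?_ this
    rw [Real.exp_sub, ← mul_div_assoc]
    have h2 : (2:ℝ) ≤ Real.exp 1 := by have := Real.add_one_le_exp (1:ℝ); linarith only [this]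
    calc x/Y ≤ x/(Real.exp (L^(δ/2)) / 2) := by gcongr
      _ = x * 2 / Real.exp (L^(δ/2)) := by rw [div_div_eq_mul_div]
      _ ≤ _ := by gcongr
  have t2 : x * (Real.exp (-((L/2)/L^(δ/2))) * Real.exp (12*S2)) ≤ ε/4 * NN := by
    rw [← Real.exp_add (-((L/2)/L^(δ/2)))]
    apply hsmall
    have h1 : L^(1/2:ℝ)/2 ≤ (L/2)/L^(δ/2) := by
      rw [le_div_iff₀ (by positivity)]
      have : L^(1/2:ℝ) * L^(δ/2) ≤ L := by
        rw [← Real.rpow_add hLp]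
        calc L^(1/2+δ/2) ≤ L^(1:ℝ) := Real.rpow_le_rpow_of_exponent_le hL1 (by linarith only [hθ1])
          _ = L := Real.rpow_one L
      linarith only [this]
    linarith only [h1, e2, hS2]
  have t3 : 2 * x / (L/(4*J)) * SM * SJ ≤ ε/4 * NN := by
    have hJ0 : (0:ℝ) < J := by exact_mod_cast hJ1
    have hSJ : SJ ≤ Real.exp (B^2 + (6 + C)) := by
      refine hTS.trans ?_
      rw [Real.exp_add]
      gcongr
      · rw [← hexpB, ← Real.exp_nat_mul]
        apply Real.exp_le_exp.mpr
        rw [pow_two]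
        gcongr
      · rw [div_le_iff₀ hv0]
        have : C * 1 ≤ C * v := by gcongr; linarith only [e5]
        linarith only [this, hS3]
    have h8 : 2 * x / (L/(4*J)) ≤ x * Real.exp (3 + B - v) := by
      have e1 : 2 * x / (L/(4*J)) = x * (8 * J / L) := by rw [div_div_eq_mul_div]; ring
      rw [e1, Real.exp_sub, Real.exp_add, hexpv, hexpB]
      have h3 : (8:ℝ) ≤ Real.exp 3 := by
        have h2 : (2:ℝ) ≤ Real.exp 1 := by have := Real.add_one_le_exp (1:ℝ); linarith only [this]
        calc (8:ℝ) = 2^3 := by norm_num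
          _ ≤ (Real.exp 1)^3 := by gcongr
          _ = Real.exp 3 := by rw [← Real.exp_nat_mul]; norm_num
      gcongr
      exact hJB.trans hBv
    have hSM0 : 0 < SM := by linarith only [hSM]
    calc 2 * x / (L/(4*J)) * SM * SJ ≤ x * Real.exp (3 + B - v) * SM * Real.exp (B^2 + (6 + C)) := by gcongr
      _ = x * SM * Real.exp ((3 + B - v) + (B^2 + (6 + C))) := by rw [Real.exp_add (3+B-v)]; ring
      _ ≤ x * SM * Real.exp (-η + -(v+3*B) + (v^(1/2:ℝ)/2 - 1)) := by
          apply mul_le_mul_of_nonneg_left (Real.exp_le_exp.mpr ?_) (by positivity)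
          have : (0:ℝ) ≤ (14+C+η) * B := by
            apply mul_nonneg <;> linarith only [hC0, hη0, e8]
          nlinarith only [e4, e8, hC0, hη0, this, mul_nonneg hC0 hη0, mul_nonneg hC0 hC0, mul_nonneg hη0 hη0, mul_nonneg hC0 (by linarith only [e8] : 0 ≤ B), mul_nonneg hη0 (by linarith only [e8] : 0 ≤ B)]
      _ = Real.exp (-η) * (G * SM * (E * Real.exp (-1))) := by
          rw [Real.exp_add, Real.exp_add, hG, hE, sub_eq_add_neg, Real.exp_add]; ring
      _ ≤ Real.exp (-η) * (G * SM * (E/2)) := by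
          have h2 : Real.exp (-1) ≤ 1/2 := by
            rw [Real.exp_neg, ← one_div]
            gcongr
            have := Real.add_one_le_exp (1:ℝ); linarith only [this]
          have : E * Real.exp (-1) ≤ E / 2 := by
            have : E * Real.exp (-1) ≤ E * (1/2) := by gcongr
            linarith only [this]
          gcongr
      _ ≤ ε/4 * NN := by
          have : 0 ≤ G * SM * (E/2) := by positivity
          gcongr
  linarith only [hu, t0, t1, t2, t3]

end S11


/-- **Lemma 3.1.** `N(q) ∼ N_con(q)` as `x → ∞`, uniformly for `q ≤ (log x)^K` with
`α(q) ≠ 0`: the inconvenient `n ≤ x` with `gcd(f(n), q) = 1` are negligible. -/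
theorem stmt11 (f : ℕ → ℤ) (F : Polynomial ℤ)
    (hf1 : f 1 = 1)
    (hfm : ∀ m n : ℕ, Nat.Coprime m n → f (m * n) = f m * f n)
    (hfp : ∀ p : ℕ, p.Prime → f p = F.eval (p : ℤ))
    (hFdeg : 0 < F.natDegree)
    (δ : ℝ) (hδ0 : 0 < δ) (hδ1 : δ ≤ 1) (K : ℝ) (hK : 0 < K) :
    ∀ ε : ℝ, 0 < ε → ∃ x₀ : ℝ, ∀ x : ℝ, x₀ ≤ x →
      ∀ q : ℕ, 0 < q → (q : ℝ) ≤ Real.log x ^ K → alpha F q ≠ 0 →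
        (cnt x (fun n => ¬ convenient δ x n ∧ Int.gcd (f n) (q : ℤ) = 1) : ℝ)
          ≤ ε * (cnt x (fun n => Int.gcd (f n) (q : ℤ) = 1) : ℝ) := by
  intro ε hε
  have h := Real.tendsto_log_atTop.eventually
    (S11.main_ev f F hf1 hfm hfp δ hδ0 hδ1 K hK ε hε)
  obtain ⟨x₀, hx₀⟩ := Filter.eventually_atTop.mp (h.and (Filter.eventually_gt_atTop 0))
  refine ⟨x₀, fun x hx q hq hqK hα => ?_⟩
  obtain ⟨h1, h2⟩ := hx₀ x hx
  have h3 := h1 q hq hqK hα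
  rw [Real.exp_log h2] at h3
  exact h3
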